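/- For every integer n ≥ 1 there exist N = p(n−1) − ⌊(n−1)/2⌋ two-arrangements A_1, …, A_N, each consisting of n planes in ℝ⁴, such that for all i ≠ j the complements X(A_i) and X(A_j) are not homotopy equivalent (there exists no homotopy equivalence of topological spaces between them). Here p(·) denotes the partition function (the number of partitions of a natural number) and ⌊·⌋ the integer part. -/

import Mathlib

/-- A 2-arrangement of `n` planes in `ℝ⁴`: a family of 2-dimensional real linear
subspaces of `ℝ⁴` that pairwise intersect only in `0`. -/
def IsTwoArrangement {n : ℕ} (H : Fin n → Submodule ℝ (EuclideanSpace ℝ (Fin 4))) : Prop :=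
  (∀ i, Module.finrank ℝ (H i) = 2) ∧ ∀ i j, i ≠ j → H i ⊓ H j = ⊥

section Part_1
set_option linter.all false
open Filter Topology Set

namespace TA

section basics
variable {E E' : Type*} [TopologicalSpace E] [TopologicalSpace E'] {K : Type*} [Field K]

def N2 (W : Set E) (P : E → E → Prop) : Prop :=
  ∀ x ∈ W, ∀ᶠ U in (𝓝[W] x).smallSets, ∀ y ∈ U, ∀ z ∈ U, P y z

def N3 (W : Set E) (P : E → E → E → Prop) : Prop :=
  ∀ x ∈ W, ∀ᶠ U in (𝓝[W] x).smallSets, ∀ y ∈ U, ∀ z ∈ U, ∀ t ∈ U, P y z t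

theorem N2.N3 {W : Set E} {P : E → E → Prop} (h : N2 W P) :
    N3 W fun y z t => P y z ∧ P z t ∧ P y t := by
  intro x hx
  filter_upwards [h x hx] with U h y hy z hz t ht
  exact ⟨h y hy z hz, h z hz t ht, h y hy t ht⟩

theorem N3.N2 {W : Set E} {P : E → E → E → Prop} (h : N3 W P) :
    N2 W fun y z => P y y y ∧ P y y z ∧ P y z y ∧ P y z z := by
  intro x hx
  filter_upwards [h x hx] with U h y hy z hz
  exact ⟨h _ hy _ hy _ hy, h _ hy _ hy _ hz, h _ hy _ hz _ hy, h _ hy _ hz _ hz⟩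

theorem N2.and {W : Set E} {P Q : E → E → Prop} (h : N2 W P) (h' : N2 W Q) :
    N2 W fun y z => P y z ∧ Q y z := by
  intro x hx
  filter_upwards [h x hx, h' x hx] with U h h' y hy z hz
  exact ⟨h y hy z hz, h' y hy z hz⟩

theorem N3.and {W : Set E} {P Q : E → E → E → Prop} (h : N3 W P) (h' : N3 W Q) :
    N3 W fun y z t => P y z t ∧ Q y z t := by
  intro x hx
  filter_upwards [h x hx, h' x hx] with U h h' y hy z hz t ht
  exact ⟨h y hy z hz t ht, h' y hy z hz t ht⟩

theorem N2.imp {W : Set E} {P Q : E → E → Prop} (h : N2 W P) (h' : ∀ y z, P y z → Q y z) :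
    N2 W Q := by
  intro x hx
  filter_upwards [h x hx] with U h y hy z hz
  exact h' _ _ (h y hy z hz)

theorem N3.imp {W : Set E} {P Q : E → E → E → Prop} (h : N3 W P)
    (h' : ∀ y z t, P y z t → Q y z t) : N3 W Q := by
  intro x hx
  filter_upwards [h x hx] with U h y hy z hz t ht
  exact h' _ _ _ (h y hy z hz t ht)

theorem N2.of_forall {W : Set E} {Q : E → E → Prop} (h' : ∀ y ∈ W, ∀ z ∈ W, Q y z) :
    N2 W Q := by
  intro x hx
  filter_upwards [eventually_smallSets_subset.2 (self_mem_nhdsWithin (s := W) (a := x))] with U h y hy z hz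
  exact h' _ (h hy) _ (h hz)

theorem N3.of_forall {W : Set E} {Q : E → E → E → Prop}
    (h' : ∀ y ∈ W, ∀ z ∈ W, ∀ t ∈ W, Q y z t) : N3 W Q := by
  intro x hx
  filter_upwards [eventually_smallSets_subset.2 (self_mem_nhdsWithin (s := W) (a := x))] with U h y hy z hz t ht
  exact h' _ (h hy) _ (h hz) _ (h ht)

theorem N2.comap {W : Set E} {W' : Set E'} {P : E' → E' → Prop} (h : N2 W' P) {φ : E → E'}
    (hφ : ContinuousOn φ W) (hm : MapsTo φ W W') : N2 W fun y z => P (φ y) (φ z) := by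
  intro x hx
  have := (tendsto_image_smallSets.2 ((hφ x hx).tendsto_nhdsWithin hm)).eventually (h _ (hm hx))
  filter_upwards [this] with U h y hy z hz
  exact h _ (mem_image_of_mem _ hy) _ (mem_image_of_mem _ hz)

theorem N3.comap {W : Set E} {W' : Set E'} {P : E' → E' → E' → Prop} (h : N3 W' P) {φ : E → E'}
    (hφ : ContinuousOn φ W) (hm : MapsTo φ W W') : N3 W fun y z t => P (φ y) (φ z) (φ t) := by
  intro x hx
  have := (tendsto_image_smallSets.2 ((hφ x hx).tendsto_nhdsWithin hm)).eventually (h _ (hm hx))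
  filter_upwards [this] with U h y hy z hz t ht
  exact h _ (mem_image_of_mem _ hy) _ (mem_image_of_mem _ hz) _ (mem_image_of_mem _ ht)

theorem N2.mono {W W' : Set E} {P : E → E → Prop} (h : N2 W' P) (hW : W ⊆ W') : N2 W P :=
  h.comap (φ := id) continuousOn_id hW

theorem N3.mono {W W' : Set E} {P : E → E → E → Prop} (h : N3 W' P) (hW : W ⊆ W') : N3 W P :=
  h.comap (φ := id) continuousOn_id hW

/-- Local to global along relatively open covers. -/
theorem N2.iUnion {ι : Type*} {W : Set E} {O : ι → Set E} {P : E → E → Prop}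
    (hO : ∀ i, IsOpen (O i)) (hW : ∀ x ∈ W, ∃ i, x ∈ O i) (h : ∀ i, N2 (W ∩ O i) P) : N2 W P := by
  intro x hx
  obtain ⟨i, hi⟩ := hW x hx
  have := h i x ⟨hx, hi⟩
  rwa [nhdsWithin_inter_of_mem' (mem_nhdsWithin_of_mem_nhds ((hO i).mem_nhds hi))] at this

theorem N3.iUnion {ι : Type*} {W : Set E} {O : ι → Set E} {P : E → E → E → Prop}
    (hO : ∀ i, IsOpen (O i)) (hW : ∀ x ∈ W, ∃ i, x ∈ O i) (h : ∀ i, N3 (W ∩ O i) P) : N3 W P := by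
  intro x hx
  obtain ⟨i, hi⟩ := hW x hx
  have := h i x ⟨hx, hi⟩
  rwa [nhdsWithin_inter_of_mem' (mem_nhdsWithin_of_mem_nhds ((hO i).mem_nhds hi))] at this

def Coc (W : Set E) (a : E → E → K) : Prop := N3 W fun y z t => a y t = a y z + a z t

def EqG (W : Set E) (a b : E → E → K) (g : E → K) : Prop :=
  N2 W fun y z => a y z = b y z + (g z - g y)

def Eqv (W : Set E) (a b : E → E → K) : Prop := ∃ g, EqG W a b g

def Rel (W : Set E) (a b : E → E → K) : Prop :=
  ∃ c : E → E → K, N3 W fun y z t => c y t = c y z + c z t + a y z * b z t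

def LC (W : Set E) (l : E → K) : Prop := N2 W fun y z => l y = l z

variable {W : Set E} {W' : Set E'} {a b c d a' b' : E → E → K}

/-- pull back of a cochain -/
def pb (φ : E → E') (a : E' → E' → K) : E → E → K := fun y z => a (φ y) (φ z)

theorem Coc.pb {a : E' → E' → K} (h : Coc W' a) {φ : E → E'}
    (hφ : ContinuousOn φ W) (hm : MapsTo φ W W') : Coc W (pb φ a) := N3.comap h hφ hm

theorem Eqv.pb {a b : E' → E' → K} (h : Eqv W' a b) {φ : E → E'}
    (hφ : ContinuousOn φ W) (hm : MapsTo φ W W') : Eqv W (TA.pb φ a) (TA.pb φ b) :=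
  let ⟨g, hg⟩ := h
  ⟨g ∘ φ, N2.comap hg hφ hm⟩

theorem Rel.pb {a b : E' → E' → K} (h : Rel W' a b) {φ : E → E'}
    (hφ : ContinuousOn φ W) (hm : MapsTo φ W W') : Rel W (TA.pb φ a) (TA.pb φ b) :=
  let ⟨g, hg⟩ := h
  ⟨TA.pb φ g, N3.comap hg hφ hm⟩

theorem Coc.mono {V : Set E} (h : Coc W a) (hV : V ⊆ W) : Coc V a := N3.mono h hV
theorem Eqv.mono {V : Set E} (h : Eqv W a b) (hV : V ⊆ W) : Eqv V a b :=
  let ⟨g, hg⟩ := h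
  ⟨g, N2.mono hg hV⟩
theorem Rel.mono {V : Set E} (h : Rel W a b) (hV : V ⊆ W) : Rel V a b :=
  let ⟨g, hg⟩ := h
  ⟨g, N3.mono hg hV⟩

theorem Coc.zero : Coc W (0 : E → E → K) := N3.of_forall (by simp)
theorem Coc.add (h : Coc W a) (h' : Coc W b) : Coc W (a + b) :=
  (N3.and h h').imp fun y z t ⟨h1, h2⟩ => by simp only [Pi.add_apply]; rw [h1, h2]; ring
theorem Coc.sub (h : Coc W a) (h' : Coc W b) : Coc W (a - b) :=
  (N3.and h h').imp fun y z t ⟨h1, h2⟩ => by simp only [Pi.sub_apply]; rw [h1, h2]; ring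
theorem Coc.smul (k : K) (h : Coc W a) : Coc W (k • a) :=
  N3.imp h fun y z t h1 => by simp only [Pi.smul_apply, smul_eq_mul]; rw [h1]; ring
theorem Coc.sum {ι : Type*} (s : Finset ι) {a : ι → E → E → K} (h : ∀ i ∈ s, Coc W (a i)) :
    Coc W (∑ i ∈ s, a i) := by
  classical
  induction s using Finset.induction_on with
  | empty => simpa using Coc.zero
  | insert i s hi ih =>
    rw [Finset.sum_insert hi]
    exact (h i (by simp)).add (ih fun j hj => h j (by simp [hj]))

theorem Eqv.refl (W : Set E) (a : E → E → K) : Eqv W a a := ⟨0, N2.of_forall (by simp)⟩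
theorem Eqv.symm (h : Eqv W a b) : Eqv W b a :=
  let ⟨g, hg⟩ := h
  ⟨-g, N2.imp hg fun y z h => by simp only [Pi.neg_apply]; rw [h]; ring⟩
theorem Eqv.trans (h : Eqv W a b) (h' : Eqv W b c) : Eqv W a c :=
  let ⟨g, hg⟩ := h
  let ⟨g', hg'⟩ := h'
  ⟨g + g', (N2.and hg hg').imp fun y z h => by simp only [Pi.add_apply]; rw [h.1, h.2]; ring⟩
theorem Eqv.add (h : Eqv W a b) (h' : Eqv W c d) : Eqv W (a + c) (b + d) :=
  let ⟨g, hg⟩ := h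
  let ⟨g', hg'⟩ := h'
  ⟨g + g', (N2.and hg hg').imp fun y z h => by simp only [Pi.add_apply]; rw [h.1, h.2]; ring⟩
theorem Eqv.sub (h : Eqv W a b) (h' : Eqv W c d) : Eqv W (a - c) (b - d) :=
  let ⟨g, hg⟩ := h
  let ⟨g', hg'⟩ := h'
  ⟨g - g', (N2.and hg hg').imp fun y z h => by simp only [Pi.sub_apply]; rw [h.1, h.2]; ring⟩
theorem Eqv.smul (k : K) (h : Eqv W a b) : Eqv W (k • a) (k • b) :=
  let ⟨g, hg⟩ := h
  ⟨k • g, N2.imp hg fun y z h => by simp only [Pi.smul_apply, smul_eq_mul]; rw [h]; ring⟩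
theorem Eqv.sum {ι : Type*} (s : Finset ι) {a b : ι → E → E → K}
    (h : ∀ i ∈ s, Eqv W (a i) (b i)) : Eqv W (∑ i ∈ s, a i) (∑ i ∈ s, b i) := by
  classical
  induction s using Finset.induction_on with
  | empty => simpa using Eqv.refl _ _
  | insert i s hi ih =>
    rw [Finset.sum_insert hi, Finset.sum_insert hi]
    exact (h i (by simp)).add (ih fun j hj => h j (by simp [hj]))
theorem Eqv.of_N2 (h : N2 W fun y z => a y z = b y z) : Eqv W a b :=
  ⟨0, h.imp fun y z h => by simp [h]⟩
theorem Eqv.sub_zero (h : Eqv W (a - b) 0) : Eqv W a b := by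
  have := h.add (Eqv.refl W b)
  simpa using this

theorem Coc.diag (h : Coc W a) {x : E} (hx : x ∈ W) : a x x = 0 := by
  obtain ⟨s, hs, h⟩ := (h x hx).exists_mem_of_smallSets
  have hx := mem_of_mem_nhdsWithin hx hs
  have := h x hx x hx x hx
  simpa using this

theorem Rel.of_eqv (h : Rel W a b) (ha : Coc W a) (hb : Coc W b) (haa : Eqv W a a')
    (hbb : Eqv W b b') : Rel W a' b' := by
  obtain ⟨c, hc⟩ := h
  obtain ⟨g, hg⟩ := haa
  obtain ⟨g', hg'⟩ := hbb
  refine ⟨fun y z => c y z + g y * b y z - (a y z - (g z - g y)) * g' z, ?_⟩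
  refine ((N3.and ha hb).and (N3.and hc (N3.and (N2.N3 hg) (N2.N3 hg')))).imp ?_
  rintro y z t ⟨⟨h1, h2⟩, h3, ⟨h4, h5, h6⟩, h7, h8, h9⟩
  have e1 : a' y z = a y z - (g z - g y) := by rw [h4]; ring
  have e2 : b' z t = b z t - (g' t - g' z) := by rw [h8]; ring
  simp only [e1, e2, h3, h1, h2]; ring

theorem LC.mono {V : Set E} {l : E → K} (h : LC W l) (hV : V ⊆ W) : LC V l := N2.mono h hV

theorem LC.of_eqG {g g' : E → K} (h : EqG W a b g) (h' : EqG W a b g') : LC W (g - g') :=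
  (N2.and h h').imp fun y z ⟨h, h'⟩ => by
    simp only [Pi.sub_apply]
    linear_combination h - h'

theorem LC.const {l : E → K} (h : LC W l) (hW : IsPreconnected W) {x y : E} (hx : x ∈ W)
    (hy : y ∈ W) : l x = l y := by
  refine hW.induction₂ (fun x y => l x = l y) (fun x hx => ?_) ?_ ?_ hx hy
  · obtain ⟨s, hs, h⟩ := (h x hx).exists_mem_of_smallSets
    filter_upwards [hs] with y hy
    exact h x (mem_of_mem_nhdsWithin hx hs) y hy
  · intro x y z _ _ _ h h'; exact h.trans h'
  · intro x y _ _ h; exact h.symm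

/-- gluing of trivialisations -/
theorem glue {ι : Type*} {O : ι → Set E} (hO : ∀ i, IsOpen (O i))
    (hW : ∀ x ∈ W, ∃ i, x ∈ O i) {g : ι → E → K} (h : ∀ i, EqG (W ∩ O i) a b (g i))
    (hg : ∀ i j, ∀ x ∈ W, x ∈ O i → x ∈ O j → g i x = g j x) : Eqv W a b := by
  classical
  choose f hf using hW
  refine ⟨fun x => if hx : x ∈ W then g (f x hx) x else 0, N2.iUnion hO (fun x hx => ⟨f x hx, hf x hx⟩) ?_⟩
  intro i
  refine (N2.and (h i) (N2.of_forall (Q := fun y z => (y ∈ W ∧ y ∈ O i) ∧ (z ∈ W ∧ z ∈ O i)) ?_)).imp ?_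
  · intro y hy z hz; exact ⟨hy, hz⟩
  · rintro y z ⟨h, ⟨hy, hy'⟩, hz, hz'⟩
    simp only [hy, hz, dif_pos]
    rw [hg _ i z hz (hf _ _) hz', hg _ i y hy (hf _ _) hy', h]

/-- gluing of cup product witnesses -/
theorem relGlue {ι : Type*} {O : ι → Set E} {c : ι → E → E → K}
    (hc : ∀ i, N3 (W ∩ O i) fun y z t => c i y t = c i y z + c i z t + a y z * b z t)
    (hcc : ∀ i j, N2 (W ∩ (O i ∩ O j)) fun y z => c i y z = c j y z) (hO : ∀ i, IsOpen (O i))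
    (sel : E → ι) [Finite ι] (hsel : ∀ x ∈ W, ∀ᶠ y in 𝓝[W] x, x ∈ O (sel y)) : Rel W a b := by
  refine ⟨fun y z => c (sel y) y z, ?_⟩
  intro x hx
  have hres : ∀ i, x ∈ O i → 𝓝[W ∩ O i] x = 𝓝[W] x := fun i hi =>
    nhdsWithin_inter_of_mem' (mem_nhdsWithin_of_mem_nhds ((hO i).mem_nhds hi))
  have h1 : ∀ᶠ U in (𝓝[W] x).smallSets, ∀ i, x ∈ O i → ∀ y ∈ U, ∀ z ∈ U, ∀ t ∈ U,
      c i y t = c i y z + c i z t + a y z * b z t := by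
    rw [eventually_all]; intro i
    by_cases hi : x ∈ O i
    · have := hc i x ⟨hx, hi⟩
      rw [hres i hi] at this
      filter_upwards [this] with U h _ using h
    · exact Eventually.of_forall fun U h => absurd h hi
  have h2 : ∀ᶠ U in (𝓝[W] x).smallSets, ∀ i j, x ∈ O i → x ∈ O j → ∀ y ∈ U, ∀ z ∈ U,
      c i y z = c j y z := by
    rw [eventually_all]; intro i
    rw [eventually_all]; intro j
    by_cases hi : x ∈ O i
    · by_cases hj : x ∈ O j
      · have := hcc i j x ⟨hx, hi, hj⟩
        rw [nhdsWithin_inter_of_mem' (mem_nhdsWithin_of_mem_nhds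
          (((hO i).inter (hO j)).mem_nhds ⟨hi, hj⟩))] at this
        filter_upwards [this] with U h _ _ using h
      · exact Eventually.of_forall fun U _ h => absurd h hj
    · exact Eventually.of_forall fun U h => absurd h hi
  filter_upwards [h1, h2, eventually_smallSets_forall.2 (hsel x hx)] with U h1 h2 h3 y hy z hz t ht
  rw [h1 _ (h3 y hy) y hy z hz t ht, h2 (sel z) (sel y) (h3 z hz) (h3 y hy) z hz t ht]

/-- cocycles on an interval are trivial -/
theorem interval {B : ℝ → ℝ → K} (hB : Coc (Icc (0:ℝ) 1) B) :
    ∃ P : ℝ → K, N2 (Icc (0:ℝ) 1) fun s s' => B s s' = P s' - P s := by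
  have h0 : ∀ x : Icc (0:ℝ) 1, ∃ u : Set ℝ, IsOpen u ∧ (x:ℝ) ∈ u ∧ ∀ y ∈ u ∩ Icc (0:ℝ) 1,
      ∀ z ∈ u ∩ Icc (0:ℝ) 1, ∀ t ∈ u ∩ Icc (0:ℝ) 1, B y t = B y z + B z t := by
    intro x
    obtain ⟨s, hs, h⟩ := (hB x x.2).exists_mem_of_smallSets
    obtain ⟨u, hu, hxu, hus⟩ := mem_nhdsWithin.1 hs
    exact ⟨u, hu, hxu, fun y hy z hz t ht => h y (hus hy) z (hus hz) t (hus ht)⟩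
  choose u hu hxu hcoc using h0
  obtain ⟨t, ht0, htm, ⟨m, hm⟩, ht⟩ := exists_monotone_Icc_subset_open_cover_Icc (a := (0:ℝ)) (b := 1)
    zero_le_one (c := fun i => Subtype.val ⁻¹' (u i)) (fun i => (hu i).preimage continuous_subtype_val)
    (fun x _ => mem_iUnion.2 ⟨x, hxu x⟩)
  have key : ∀ n, ∃ P : ℝ → K, N2 (Icc (0:ℝ) (t n)) fun s s' => B s s' = P s' - P s := by
    intro n
    induction n with
    | zero =>
      refine ⟨0, N2.of_forall ?_⟩
      intro y hy z hz
      rw [ht0] at hy hz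
      have hy' : y = 0 := le_antisymm hy.2 hy.1
      have hz' : z = 0 := le_antisymm hz.2 hz.1
      subst hy' hz'
      simp [hB.diag (show (0:ℝ) ∈ Icc (0:ℝ) 1 by simp)]
    | succ n ih =>
      obtain ⟨P, hP⟩ := ih
      obtain ⟨i, hi⟩ := ht n
      set A : ℝ := ((t n : Icc (0:ℝ) 1) : ℝ) with hA
      set A' : ℝ := ((t (n+1) : Icc (0:ℝ) 1) : ℝ) with hA'
      have hAA : A ≤ A' := htm (Nat.le_succ n)
      have hA0 : 0 ≤ A := (t n).2.1
      have hA1 : A' ≤ 1 := (t (n+1)).2.2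
      have hsub : Icc A A' ⊆ u i := by
        intro s hs
        exact hi (show (⟨s, hA0.trans hs.1, hs.2.trans hA1⟩ : Icc (0:ℝ) 1) ∈ Icc (t n) (t (n+1)) from hs)
      have hAu : A ∈ u i := hsub ⟨le_rfl, hAA⟩
      have hA01 : A ∈ Icc (0:ℝ) 1 := (t n).2
      have hAA0 : B A A = 0 := hB.diag hA01
      refine ⟨fun s => if s ≤ A then P s else P A + B A s, ?_⟩
      intro x hx
      rcases lt_trichotomy x A with hxA | hxA | hxA
      · have h1 := hP x ⟨hx.1, hxA.le⟩
        have : 𝓝[Icc 0 A'] x ≤ 𝓝[Icc 0 A] x := by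
          refine nhdsWithin_le_of_mem ?_
          filter_upwards [self_mem_nhdsWithin, mem_nhdsWithin_of_mem_nhds (Iio_mem_nhds hxA)] with y hy hy'
          exact ⟨hy.1, le_of_lt hy'⟩
        have h2 := h1.filter_mono (monotone_smallSets this)
        filter_upwards [h2, eventually_smallSets_subset.2 (mem_nhdsWithin_of_mem_nhds (Iio_mem_nhds hxA))] with U h hU y hy z hz
        rw [if_pos (le_of_lt (hU hz)), if_pos (le_of_lt (hU hy))]
        exact h y hy z hz
      · rw [hxA] at hx ⊢; clear hxA
        obtain ⟨s, hs, h⟩ := (hP A ⟨hx.1, le_rfl⟩).exists_mem_of_smallSets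
        obtain ⟨v, hv, hxv, hvs⟩ := mem_nhdsWithin.1 hs
        filter_upwards [eventually_smallSets_subset.2 (mem_nhdsWithin_of_mem_nhds ((hu i).mem_nhds hAu)),
          eventually_smallSets_subset.2 (mem_nhdsWithin_of_mem_nhds (hv.mem_nhds hxv)),
          eventually_smallSets_subset.2 (self_mem_nhdsWithin (s := Icc 0 A'))] with U h1 h2 h3 y hy z hz
        have hxs : A ∈ s := hvs ⟨hxv, hx.1, le_rfl⟩
        have hmem : ∀ y ∈ U, y ∈ u i ∩ Icc (0:ℝ) 1 := fun y hy => ⟨h1 hy, (h3 hy).1, (h3 hy).2.trans hA1⟩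
        have hc := hcoc i y (hmem y hy) A ⟨hAu, hA01⟩ z (hmem z hz)
        have hyy := hcoc i A ⟨hAu, hA01⟩ y (hmem y hy) A ⟨hAu, hA01⟩
        have hP1 : ∀ y ∈ U, y ≤ A → B y A = P A - P y ∧ B A y = P y - P A := fun y hy hyx =>
          have hys : y ∈ s := hvs ⟨h2 hy, (h3 hy).1, hyx⟩
          ⟨h y hys A hxs, h A hxs y hys⟩
        rw [hc]
        split_ifs with c1 c2 c2
        · rw [(hP1 y hy c2).1, (hP1 z hz c1).2]; ring
        · rw [(hP1 z hz c1).2]; linear_combination hAA0 - hyy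
        · rw [(hP1 y hy c2).1]; ring
        · linear_combination hAA0 - hyy
      · filter_upwards [eventually_smallSets_subset.2 (mem_nhdsWithin_of_mem_nhds (Ioi_mem_nhds hxA)),
          eventually_smallSets_subset.2 (self_mem_nhdsWithin (s := Icc 0 A'))] with U h1 h3 y hy z hz
        have hmem : ∀ y ∈ U, y ∈ u i ∩ Icc (0:ℝ) 1 := fun y hy =>
          ⟨hsub ⟨le_of_lt (h1 hy), (h3 hy).2⟩, (h3 hy).1, (h3 hy).2.trans hA1⟩
        rw [if_neg (not_le.2 (h1 hz)), if_neg (not_le.2 (h1 hy)),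
          hcoc i A ⟨hAu, hA01⟩ y (hmem y hy) z (hmem z hz)]
        ring
  obtain ⟨P, hP⟩ := key m
  rw [hm m le_rfl] at hP
  exact ⟨P, hP⟩

/-- homotopy invariance -/
theorem homotopy {a : E' → E' → K} (ha : Coc W' a) (H : E → ℝ → E')
    (hH : ContinuousOn (fun q : E × ℝ => H q.1 q.2) (W ×ˢ Icc (0:ℝ) 1))
    (hm : ∀ y ∈ W, ∀ s ∈ Icc (0:ℝ) 1, H y s ∈ W') :
    Eqv W (pb (fun y => H y 1) a) (pb (fun y => H y 0) a) := by
  have hA : Coc (W ×ˢ Icc (0:ℝ) 1) (pb (fun q : E × ℝ => H q.1 q.2) a) :=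
    ha.pb hH (fun q hq => hm _ hq.1 _ hq.2)
  have h1 : ∀ y, ∃ P : ℝ → K, y ∈ W → N2 (Icc (0:ℝ) 1) fun s s' => a (H y s) (H y s') = P s' - P s := by
    intro y
    by_cases hy : y ∈ W
    · obtain ⟨P, hP⟩ := interval (hA.pb (W := Icc (0:ℝ) 1) (φ := fun s => (y, s)) (by fun_prop)
        (fun s hs => ⟨hy, hs⟩))
      exact ⟨P, fun _ => hP⟩
    · exact ⟨0, fun h => absurd h hy⟩
  choose P hP using h1
  refine ⟨fun y => P y 1 - P y 0, ?_⟩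
  intro x hx
  have h2 : ∃ U ∈ 𝓝[W] x, ∀ s ∈ Icc (0:ℝ) 1, ∃ S ∈ 𝓝[Icc 0 1] s, ∀ y ∈ U, ∀ z ∈ U, ∀ r ∈ S, ∀ r' ∈ S,
      a (H y r) (H z r) + a (H z r) (H z r') = a (H y r) (H y r') + a (H y r') (H z r') := by
    refine isCompact_Icc.induction_on (p := fun T => ∃ U ∈ 𝓝[W] x, ∀ s ∈ T, ∃ S ∈ 𝓝[Icc 0 1] s, ∀ y ∈ U, ∀ z ∈ U, ∀ r ∈ S, ∀ r' ∈ S,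
      a (H y r) (H z r) + a (H z r) (H z r') = a (H y r) (H y r') + a (H y r') (H z r')) ?_ ?_ ?_ ?_
    · exact ⟨univ, univ_mem, by simp⟩
    · rintro s t hst ⟨U, hU, h⟩
      exact ⟨U, hU, fun r hr => h r (hst hr)⟩
    · rintro s t ⟨U, hU, h⟩ ⟨U', hU', h'⟩
      refine ⟨U ∩ U', inter_mem hU hU', ?_⟩
      rintro r (hr | hr)
      · obtain ⟨S, hS, h⟩ := h r hr
        exact ⟨S, hS, fun y hy z hz => h y hy.1 z hz.1⟩
      · obtain ⟨S, hS, h⟩ := h' r hr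
        exact ⟨S, hS, fun y hy z hz => h y hy.2 z hz.2⟩
    · intro s hs
      obtain ⟨V, hV, h⟩ := (hA (x, s) ⟨hx, hs⟩).exists_mem_of_smallSets
      rw [nhdsWithin_prod_eq] at hV
      obtain ⟨U, hU, S, hS, hUS⟩ := mem_prod_iff.1 hV
      obtain ⟨o, ho, hso, hoS⟩ := mem_nhdsWithin.1 hS
      refine ⟨o ∩ Icc 0 1, inter_mem (mem_nhdsWithin_of_mem_nhds (ho.mem_nhds hso)) self_mem_nhdsWithin, U, hU, ?_⟩
      rintro r ⟨hr, hr'⟩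
      refine ⟨o ∩ Icc 0 1, inter_mem (mem_nhdsWithin_of_mem_nhds (ho.mem_nhds hr)) self_mem_nhdsWithin, ?_⟩
      intro y hy z hz r hr r' hr'
      have m : ∀ y ∈ U, ∀ r ∈ o ∩ Icc 0 1, (y, r) ∈ V := fun y hy r hr => hUS ⟨hy, hoS hr⟩
      have e1 := h (y, r) (m y hy r hr) (z, r) (m z hz r hr) (z, r') (m z hz r' hr')
      have e2 := h (y, r) (m y hy r hr) (y, r') (m y hy r' hr') (z, r') (m z hz r' hr')
      exact e1.symm.trans e2
  obtain ⟨U, hU, h⟩ := h2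
  filter_upwards [eventually_smallSets_subset.2 hU, eventually_smallSets_subset.2 (self_mem_nhdsWithin (s := W))]
    with V h1 h3 y hy z hz
  have hlc : LC (Icc (0:ℝ) 1) (fun s => a (H y s) (H z s) - P z s + P y s) := by
    intro s hs
    obtain ⟨S, hS, hh⟩ := h s hs
    filter_upwards [eventually_smallSets_subset.2 hS, hP y (h3 hy) s hs, hP z (h3 hz) s hs]
      with T hT e1 e2 r hr r' hr'
    have := hh y (h1 hy) z (h1 hz) r (hT hr) r' (hT hr')
    rw [e1 r hr r' hr', e2 r hr r' hr'] at this
    linear_combination this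
  have := hlc.const isPreconnected_Icc (x := 0) (y := 1) (by simp) (by simp)
  simp only [pb]
  linear_combination -this

end basics
end TA
end Part_1

section Part_2
set_option linter.all false
open Filter Topology Set

namespace TA

section std
variable {E : Type*} [TopologicalSpace E] {K : Type*} [Field K]

theorem N2.of_prod {W : Set E} {P : E → E → Prop}
    (h : ∀ x ∈ W, ∀ᶠ q in 𝓝[W] x ×ˢ 𝓝[W] x, P q.1 q.2) : N2 W P := by
  intro x hx
  obtain ⟨t, ht, h⟩ := mem_prod_same_iff.1 (h x hx)
  filter_upwards [eventually_smallSets_subset.2 ht] with U hU y hy z hz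
  exact h (show (y, z) ∈ t ×ˢ t from ⟨hU hy, hU hz⟩)

noncomputable def nA (u v : ℂ) : ℤ :=
  round ((Complex.arg v - Complex.arg u - Complex.arg (v / u)) / (2 * Real.pi))

theorem round_aux {r : ℝ} (h : (r : Real.Angle) = 0) : 2 * Real.pi * (round (r / (2 * Real.pi)) : ℤ) = r := by
  obtain ⟨n, hn⟩ := Real.Angle.coe_eq_zero_iff.1 h
  have hp : (2 * Real.pi) ≠ 0 := by positivity
  subst hn
  simp [hp]
  ring

theorem nA_spec {u v : ℂ} (hu : u ≠ 0) (hv : v ≠ 0) :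
    2 * Real.pi * (nA u v : ℤ) = Complex.arg v - Complex.arg u - Complex.arg (v / u) := by
  apply round_aux
  rw [Real.Angle.coe_sub, Real.Angle.coe_sub, Complex.arg_div_coe_angle hv hu]
  abel

noncomputable def nM (u v : ℂ) : ℤ :=
  round ((Complex.arg (u * v) - Complex.arg u - Complex.arg v) / (2 * Real.pi))

theorem nM_spec {u v : ℂ} (hu : u ≠ 0) (hv : v ≠ 0) :
    2 * Real.pi * (nM u v : ℤ) = Complex.arg (u * v) - Complex.arg u - Complex.arg v := by
  apply round_aux
  rw [Real.Angle.coe_sub, Real.Angle.coe_sub, Complex.arg_mul_coe_angle hu hv]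
  abel

noncomputable def cls (f : E → ℂ) : E → E → K := fun x y => ((nA (f x) (f y) : ℤ) : K)

theorem near_arg {W : Set E} {f : E → ℂ} (hf : ContinuousOn f W) (h0 : ∀ x ∈ W, f x ≠ 0) :
    N2 W fun y z => f y ≠ 0 ∧ f z ≠ 0 ∧ |Complex.arg (f z / f y)| < 1 := by
  refine (N2.of_forall (Q := fun y z => f y ≠ 0 ∧ f z ≠ 0) fun y hy z hz => ⟨h0 y hy, h0 z hz⟩).and
    (Q := fun y z => |Complex.arg (f z / f y)| < 1) (N2.of_prod fun x hx => ?_) |>.imp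
      fun y z h => ⟨h.1.1, h.1.2, h.2⟩
  have h1 : Tendsto (fun q : E × E => f q.2 / f q.1) (𝓝[W] x ×ˢ 𝓝[W] x) (𝓝 (f x / f x)) :=
    ((hf x hx).tendsto.comp tendsto_snd).div ((hf x hx).tendsto.comp tendsto_fst) (h0 x hx)
  rw [div_self (h0 x hx)] at h1
  have h2 := ((Complex.continuousAt_arg (x := 1) (by simp)).abs.tendsto.comp h1)
  simp only [Complex.arg_one, abs_zero] at h2
  exact h2.eventually (Iio_mem_nhds one_pos)

theorem arg_mul_small {u v : ℂ} (hu : u ≠ 0) (hv : v ≠ 0) (h : |Complex.arg u| < 1)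
    (h' : |Complex.arg v| < 1) : Complex.arg (u * v) = Complex.arg u + Complex.arg v := by
  rw [Complex.arg_mul_eq_add_arg_iff hu hv]
  have := Real.pi_gt_three
  rw [abs_lt] at h h'
  constructor <;> linarith [h.1, h.2, h'.1, h'.2]

theorem int_cancel {m n : ℤ} (h : 2 * Real.pi * (m : ℝ) = 2 * Real.pi * (n : ℝ)) : m = n := by
  have hp : (2 * Real.pi) ≠ 0 := by positivity
  exact_mod_cast mul_left_cancel₀ hp h

theorem cls_coc {W : Set E} {f : E → ℂ} (hf : ContinuousOn f W) (h0 : ∀ x ∈ W, f x ≠ 0) :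
    Coc W (cls (K := K) f) := by
  refine (near_arg hf h0).N3.imp ?_
  rintro y z t ⟨⟨hy, hz, h1⟩, ⟨_, ht, h2⟩, _⟩
  have : nA (f y) (f t) = nA (f y) (f z) + nA (f z) (f t) := by
    apply int_cancel
    push_cast
    rw [mul_add, nA_spec hy ht, nA_spec hy hz, nA_spec hz ht]
    have : f t / f y = (f t / f z) * (f z / f y) := by field_simp
    rw [this, arg_mul_small (div_ne_zero ht hz) (div_ne_zero hz hy) h2 h1]
    ring
  simp only [cls, this]
  push_cast
  rfl

theorem cls_mul' {W : Set E} {f g : E → ℂ} (hf : ContinuousOn f W) (h0 : ∀ x ∈ W, f x ≠ 0)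
    (hg : ContinuousOn g W) (h0' : ∀ x ∈ W, g x ≠ 0) :
    EqG W (cls (K := K) fun x => f x * g x) (cls f + cls g) (fun x => ((nM (f x) (g x) : ℤ) : K)) := by
  refine ((near_arg hf h0).and (near_arg hg h0')).imp ?_
  rintro y z ⟨⟨hy, hz, h1⟩, hy', hz', h2⟩
  have : nA (f y * g y) (f z * g z) = nA (f y) (f z) + nA (g y) (g z) + (nM (f z) (g z) - nM (f y) (g y)) := by
    apply int_cancel
    push_cast
    rw [mul_add, mul_add, mul_sub, nA_spec hy hz, nA_spec hy' hz', nM_spec hy hy', nM_spec hz hz',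
      nA_spec (mul_ne_zero hy hy') (mul_ne_zero hz hz')]
    have : f z * g z / (f y * g y) = (f z / f y) * (g z / g y) := by field_simp
    rw [this, arg_mul_small (div_ne_zero hz hy) (div_ne_zero hz' hy') h1 h2]
    ring
  simp only [cls, this, Pi.add_apply]
  push_cast
  ring

theorem cls_mul {W : Set E} {f g : E → ℂ} (hf : ContinuousOn f W) (h0 : ∀ x ∈ W, f x ≠ 0)
    (hg : ContinuousOn g W) (h0' : ∀ x ∈ W, g x ≠ 0) :
    Eqv W (cls (K := K) fun x => f x * g x) (cls f + cls g) := ⟨_, cls_mul' hf h0 hg h0'⟩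

theorem cls_slit {W : Set E} {f : E → ℂ} (hf : ContinuousOn f W)
    (h0 : ∀ x ∈ W, f x ∈ Complex.slitPlane) : N2 W fun y z => cls (K := K) f y z = 0 := by
  have hn : ∀ x ∈ W, f x ≠ 0 := fun x hx => Complex.slitPlane_ne_zero (h0 x hx)
  have h1 : N2 W fun y z => |Complex.arg (f z) - Complex.arg (f y)| < 1 := by
    refine N2.of_prod fun x hx => ?_
    have hc : Tendsto (fun x => Complex.arg (f x)) (𝓝[W] x) (𝓝 (Complex.arg (f x))) :=
      (Complex.continuousAt_arg (h0 x hx)).tendsto.comp (hf x hx).tendsto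
    have h2 := ((hc.comp tendsto_snd).sub (hc.comp tendsto_fst) :
      Tendsto _ (𝓝[W] x ×ˢ 𝓝[W] x) _).abs
    simp only [sub_self, abs_zero] at h2
    exact h2.eventually (Iio_mem_nhds one_pos)
  refine (h1.and (near_arg hf hn)).imp ?_
  rintro y z ⟨h1, hy, hz, h2⟩
  have h3 := nA_spec hy hz
  have : nA (f y) (f z) = 0 := by
    have hp := Real.pi_gt_three
    rw [abs_lt] at h1 h2
    have e1 : 2 * Real.pi * (nA (f y) (f z) : ℝ) < 2 * Real.pi * 1 := by rw [h3]; linarith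
    have e2 : 2 * Real.pi * (-1) < 2 * Real.pi * (nA (f y) (f z) : ℝ) := by rw [h3]; linarith
    have e3 := lt_of_mul_lt_mul_left e1 (by positivity)
    have e4 := lt_of_mul_lt_mul_left e2 (by positivity)
    have e5 : nA (f y) (f z) < 1 := by exact_mod_cast e3
    have e6 : -1 < nA (f y) (f z) := by exact_mod_cast e4
    omega
  simp [cls, this]

theorem cls_slit' {W : Set E} {f : E → ℂ} (hf : ContinuousOn f W)
    (h0 : ∀ x ∈ W, f x ∈ Complex.slitPlane) : Eqv W (cls (K := K) f) 0 := .of_N2 (cls_slit hf h0)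

theorem cls_const (u : ℂ) : cls (K := K) (fun _ : E => u) = 0 := by
  funext x y
  by_cases hu : u = 0 <;> simp [cls, nA, hu]

/-- if `u * f` lands in slit plane then the class of `f` is trivial -/
theorem cls_triv {W : Set E} {f : E → ℂ} (hf : ContinuousOn f W) (u : ℂ)
    (h0 : ∀ x ∈ W, u * f x ∈ Complex.slitPlane) : Eqv W (cls (K := K) f) 0 := by
  by_cases hW : W.Nonempty
  · have hu : u ≠ 0 := by
      rintro rfl
      obtain ⟨x, hx⟩ := hW
      simpa using h0 x hx
    have hn : ∀ x ∈ W, f x ≠ 0 := by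
      rintro x hx h
      simpa [h] using h0 x hx
    have h1 := cls_mul (K := K) (W := W) (f := fun _ => u) (g := f) continuousOn_const (fun _ _ => hu) hf hn
    rw [cls_const, zero_add] at h1
    exact h1.symm.trans (cls_slit' (continuousOn_const.mul hf) h0)
  · rw [not_nonempty_iff_eq_empty] at hW
    subst hW
    exact ⟨0, N2.of_forall (by simp)⟩

theorem cls_const_mul {W : Set E} {f : E → ℂ} (hf : ContinuousOn f W) (hn : ∀ x ∈ W, f x ≠ 0) (u : ℂ)
    (hu : u ≠ 0) : Eqv W (cls (K := K) fun x => u * f x) (cls f) := by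
  have h1 := cls_mul (K := K) (W := W) (f := fun _ => u) (g := f) continuousOn_const (fun _ _ => hu) hf hn
  rwa [cls_const, zero_add] at h1

/-- if `f = h * g` with `h` in the slit plane then the classes are the same -/
theorem cls_close {W : Set E} {f g : E → ℂ} (hf : ContinuousOn f W) (hg : ContinuousOn g W)
    (hn : ∀ x ∈ W, g x ≠ 0) (h0 : ∀ x ∈ W, f x / g x ∈ Complex.slitPlane) :
    Eqv W (cls (K := K) f) (cls g) := by
  have hc : ContinuousOn (fun x => f x / g x) W := hf.div hg hn
  have h1 := cls_mul (K := K) hc (fun x hx => Complex.slitPlane_ne_zero (h0 x hx)) hg hn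
  have h2 : Eqv W (cls (K := K) f) (cls fun x => f x / g x * g x) := .of_N2 (N2.of_forall fun y hy z hz => by
    simp only [cls, div_mul_cancel₀ _ (hn y hy), div_mul_cancel₀ _ (hn z hz)])
  refine h2.trans (h1.trans ?_)
  have := (cls_slit' (K := K) hc h0).add (Eqv.refl W (cls g))
  rwa [zero_add] at this

theorem cls_conj {W : Set E} {f : E → ℂ} (hf : ContinuousOn f W) (hn : ∀ x ∈ W, f x ≠ 0) :
    Eqv W (cls (K := K) fun x => (starRingEnd ℂ) (f x)) (-cls f) := by
  have hc : ContinuousOn (fun x => (starRingEnd ℂ) (f x)) W := Complex.continuous_conj.comp_continuousOn hf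
  have hn' : ∀ x ∈ W, (starRingEnd ℂ) (f x) ≠ 0 := fun x hx => by simpa using hn x hx
  have h1 := cls_mul (K := K) hc hn' hf hn
  have h2 : Eqv W (cls (K := K) fun x => (starRingEnd ℂ) (f x) * f x) 0 := by
    refine cls_slit' (hc.mul hf) fun x hx => ?_
    rw [mul_comm, Complex.mul_conj]
    left
    simpa using hn x hx
  have := (h1.symm.trans h2).sub (Eqv.refl W (cls f))
  simpa using this

theorem cls_inv {W : Set E} {f : E → ℂ} (hf : ContinuousOn f W) (hn : ∀ x ∈ W, f x ≠ 0) :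
    Eqv W (cls (K := K) fun x => (f x)⁻¹) (-cls f) := by
  have h1 := cls_mul (K := K) (hf.inv₀ hn) (fun x hx => inv_ne_zero (hn x hx)) hf hn
  have h2 : Eqv W (cls (K := K) fun x => (f x)⁻¹ * f x) 0 := by
    refine cls_slit' ((hf.inv₀ hn).mul hf) fun x hx => ?_
    rw [inv_mul_cancel₀ (hn x hx)]
    simp
  have := (h1.symm.trans h2).sub (Eqv.refl W (cls f))
  rw [add_sub_cancel_right, zero_sub] at this
  exact this

noncomputable def qn (z : ℂ) : K := ((nM (-1) z : ℤ) : K)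

theorem qn_pos {z : ℂ} (h : 0 < z.im) : qn (K := K) z = -1 := by
  have hz : z ≠ 0 := by rintro rfl; simp at h
  have h1 := nM_spec (u := -1) (v := z) (by simp) hz
  have : nM (-1) z = -1 := by
    apply int_cancel
    rw [h1]
    rw [neg_one_mul, Complex.arg_neg_eq_arg_sub_pi_of_im_pos h, Complex.arg_neg_one]
    push_cast; ring
  simp [qn, this]

theorem qn_neg {z : ℂ} (h : z.im < 0) : qn (K := K) z = 0 := by
  have hz : z ≠ 0 := by rintro rfl; simp at h
  have h1 := nM_spec (u := -1) (v := z) (by simp) hz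
  have : nM (-1) z = 0 := by
    apply int_cancel
    rw [h1]
    rw [neg_one_mul, Complex.arg_neg_eq_arg_add_pi_of_im_neg h, Complex.arg_neg_one]
    push_cast; ring
  simp [qn, this]

/-- if `-f` lands in the slit plane, then the class of `f` is the coboundary of `qn (-f)`. -/
theorem cls_neg_slit {W : Set E} {f : E → ℂ} (hf : ContinuousOn f W)
    (h0 : ∀ x ∈ W, - f x ∈ Complex.slitPlane) : EqG W (cls (K := K) f) 0 (fun x => qn (- f x)) := by
  have h1 := cls_mul' (K := K) (W := W) (f := fun _ => -1) (g := fun x => - f x) continuousOn_const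
    (by simp) hf.neg (fun x hx => Complex.slitPlane_ne_zero (h0 x hx))
  have h2 := cls_slit (K := K) hf.neg h0
  refine (N2.and h1 h2).imp ?_
  rintro y z ⟨h1, h2⟩
  rw [cls_const, zero_add] at h1
  have e : (fun x => -1 * -f x) = f := by funext x; ring
  rw [e] at h1
  rw [h1, show cls (fun x => - f x) y z = (0:K) from h2]
  simp [qn]

theorem cls_ne {k : K} (h : Eqv {z : ℂ | z ≠ 0} (k • cls (fun z => z)) (0 : ℂ → ℂ → K)) : k = 0 := by
  obtain ⟨g, hg⟩ := h
  -- on slit plane g is locally constant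
  have h1 : LC Complex.slitPlane g := by
    have e1 := N2.mono hg (W := Complex.slitPlane) (fun z hz => Complex.slitPlane_ne_zero hz)
    have e2 := cls_slit (K := K) (W := Complex.slitPlane) (f := fun z => z) continuousOn_id (fun z hz => hz)
    refine (N2.and e1 e2).imp ?_
    rintro y z ⟨h1, h2⟩
    simp only [Pi.smul_apply, h2, smul_eq_mul, mul_zero, Pi.zero_apply, zero_add] at h1
    exact (sub_eq_zero.1 h1.symm).symm
  have hpre : IsPreconnected Complex.slitPlane :=
    (Complex.starConvex_one_slitPlane.isPathConnected (by simp)).isConnected.isPreconnected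
  have e2 := cls_neg_slit (K := K) (W := {z : ℂ | z.re < 0}) (f := fun z => z) continuousOn_id
    (fun z (hz : z.re < 0) => by left; simpa using hz)
  have e1 := N2.mono hg (W := {z : ℂ | z.re < 0}) (fun z (hz : z.re < 0) => by rintro rfl; simp at hz)
  obtain ⟨s, hs, h⟩ := (N2.and e1 e2 (-1) (by simp)).exists_mem_of_smallSets
  have hs' : s ∈ 𝓝 (-1:ℂ) := by
    rwa [IsOpen.nhdsWithin_eq (isOpen_lt Complex.continuous_re continuous_const) (by simp)] at hs
  have ht : ∀ v : ℂ, Tendsto (fun t : ℝ => (-1:ℂ) + t * v) (𝓝[>] 0) (𝓝 (-1)) := by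
    intro v
    have : Tendsto (fun t : ℝ => (-1:ℂ) + t * v) (𝓝 0) (𝓝 (-1 + (0:ℝ) * v)) :=
      Continuous.tendsto (by fun_prop) 0
    simp only [Complex.ofReal_zero, zero_mul, add_zero] at this
    exact this.mono_left nhdsWithin_le_nhds
  obtain ⟨t, ⟨h3, h4⟩, h5⟩ := (((ht Complex.I).eventually hs').and ((ht (-Complex.I)).eventually hs')
    |>.and self_mem_nhdsWithin).exists
  have h5 : 0 < t := h5
  obtain ⟨h6, h8⟩ := h _ h3 _ h4
  simp only [] at h8
  have h7 := h1.const hpre (x := -1 + t * Complex.I) (y := -1 + t * (-Complex.I))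
    (by right; simp; exact h5.ne') (by right; simp; exact h5.ne')
  rw [Pi.smul_apply, Pi.smul_apply, h8, h7, qn_pos (by simpa using h5), qn_neg (by simpa using h5)] at h6
  simpa using h6

end std
end TA
end Part_2

section Part_3
set_option linter.all false
open Filter Topology Set

namespace TA

section more
variable {E E' : Type*} [TopologicalSpace E] [TopologicalSpace E'] {K : Type*} [Field K]

theorem N2.all {ι : Type*} [Finite ι] {W : Set E} {P : ι → E → E → Prop} (h : ∀ i, N2 W (P i)) :
    N2 W fun y z => ∀ i, P i y z := by
  intro x hx
  filter_upwards [eventually_all.2 fun i => h i x hx] with U h y hy z hz i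
  exact h i y hy z hz

theorem N3.all {ι : Type*} [Finite ι] {W : Set E} {P : ι → E → E → E → Prop} (h : ∀ i, N3 W (P i)) :
    N3 W fun y z t => ∀ i, P i y z t := by
  intro x hx
  filter_upwards [eventually_all.2 fun i => h i x hx] with U h y hy z hz t ht i
  exact h i y hy z hz t ht

theorem LC.path {W : Set E} {l : E → K} (h : LC W l) (γ : ℝ → E) (hγ : ContinuousOn γ (Icc 0 1))
    (hm : ∀ s ∈ Icc (0:ℝ) 1, γ s ∈ W) : l (γ 0) = l (γ 1) :=
  LC.const (W := Icc (0:ℝ) 1) (l := l ∘ γ) (N2.comap h hγ hm) isPreconnected_Icc (by simp) (by simp)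

theorem pb_cls (φ : E → E') (f : E' → ℂ) : pb φ (cls (K := K) f) = cls (fun x => f (φ x)) := rfl
theorem pb_add (φ : E → E') (a b : E' → E' → K) : pb φ (a + b) = pb φ a + pb φ b := rfl
theorem pb_smul (φ : E → E') (k : K) (a : E' → E' → K) : pb φ (k • a) = k • pb φ a := rfl
theorem pb_zero (φ : E → E') : pb φ (0 : E' → E' → K) = 0 := rfl
theorem pb_sum {ι : Type*} (s : Finset ι) (φ : E → E') (a : ι → E' → E' → K) :
    pb φ (∑ i ∈ s, a i) = ∑ i ∈ s, pb φ (a i) := by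
  funext y z; simp [pb]
end more

structure Dat (κ : Type) [Fintype κ] where
  I : Set ℝ
  ρ : ℝ
  c : κ → ℝ
  hI : IsOpen I
  hconv : Convex ℝ I
  hρ : 0 ≤ ρ
  h0 : Icc (-(ρ+1)) (ρ+1) ⊆ I
  hc : ∀ i, Icc (c i - (ρ+1)) (c i + (ρ+1)) ⊆ I
  hsep : ∀ i j, i ≠ j → 2 * ρ + 1 ≤ |c i - c j|
  x0 : ℝ
  hx0 : x0 ∈ I
  hx0' : ∀ i, ρ < |x0 - c i|

namespace Dat
variable {κ : Type} [Fintype κ] (d : Dat κ) {K : Type*} [Field K]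

def D : Set ℂ := {ζ | ζ.re ∈ d.I ∧ ζ.im ∈ d.I ∧ ∀ i, d.ρ ^ 2 < (ζ.re - d.c i) ^ 2 + ζ.im ^ 2}

def De (e : ℝ) : Set ℂ := {ζ | ζ ∈ d.D ∧ ∀ i, |ζ.re - d.c i| ≤ d.ρ → 0 < e * ζ.im}

def off : Set ℝ := {x | x ∈ d.I ∧ ∀ i, d.ρ < |x - d.c i|}

noncomputable def σ (i : κ) : ℂ × ℂ → ℂ × ℂ → K := cls fun q => -Complex.I * (q.2 - d.c i)
noncomputable def τ : ℂ × ℂ → ℂ × ℂ → K := cls fun q => q.1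

theorem isOpen_D : IsOpen d.D := by
  refine (d.hI.preimage Complex.continuous_re).inter ((d.hI.preimage Complex.continuous_im).inter ?_)
  have : {ζ : ℂ | ∀ i, d.ρ ^ 2 < (ζ.re - d.c i) ^ 2 + ζ.im ^ 2} =
      ⋂ i, {ζ : ℂ | d.ρ ^ 2 < (ζ.re - d.c i) ^ 2 + ζ.im ^ 2} := by ext; simp
  change IsOpen {ζ : ℂ | ∀ i, d.ρ ^ 2 < (ζ.re - d.c i) ^ 2 + ζ.im ^ 2}
  rw [this]
  exact isOpen_iInter_of_finite fun i => isOpen_lt continuous_const (by fun_prop)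

theorem isOpen_De (e : ℝ) : IsOpen (d.De e) := by
  refine d.isOpen_D.inter ?_
  have : {ζ : ℂ | ∀ i, |ζ.re - d.c i| ≤ d.ρ → 0 < e * ζ.im} =
      ⋂ i, ({ζ : ℂ | d.ρ < |ζ.re - d.c i|} ∪ {ζ : ℂ | 0 < e * ζ.im}) := by
    ext; simp [← not_le, imp_iff_not_or]
  change IsOpen {ζ : ℂ | ∀ i, |ζ.re - d.c i| ≤ d.ρ → 0 < e * ζ.im}
  rw [this]
  exact isOpen_iInter_of_finite fun i => (isOpen_lt continuous_const (by fun_prop)).union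
    (isOpen_lt continuous_const (by fun_prop))

theorem cover {ζ : ℂ} (h : ζ ∈ d.D) : ζ ∈ d.De 1 ∨ ζ ∈ d.De (-1) := by
  by_cases hi : 0 < ζ.im
  · left; exact ⟨h, fun i _ => by linarith⟩
  · right
    refine ⟨h, fun i hi' => ?_⟩
    have h1 := h.2.2 i
    rcases lt_or_eq_of_le (not_lt.1 hi) with h2 | h2
    · linarith
    · rw [h2] at h1
      have : (ζ.re - d.c i) ^ 2 ≤ d.ρ ^ 2 := by
        rw [← sq_abs]; gcongr
      linarith

theorem mem_De_of_off {ζ : ℂ} (h : ζ.re ∈ d.off) (h' : ζ.im ∈ d.I) (e : ℝ) : ζ ∈ d.De e := by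
  refine ⟨⟨h.1, h', fun i => ?_⟩, fun i hi => absurd hi (not_le.2 (h.2 i))⟩
  have := h.2 i
  have h2 : d.ρ ^ 2 < (ζ.re - d.c i) ^ 2 := by
    rw [← sq_abs (ζ.re - d.c i)]; gcongr; exact d.hρ
  nlinarith [sq_nonneg ζ.im]

theorem off_of_mem {ζ : ℂ} (h : ζ ∈ d.De 1) (h' : ζ ∈ d.De (-1)) : ζ.re ∈ d.off := by
  refine ⟨h.1.1, fun i => ?_⟩
  by_contra hi
  have h1 := h.2 i (not_lt.1 hi)
  have h2 := h'.2 i (not_lt.1 hi)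
  linarith

theorem zero_mem : (0:ℝ) ∈ d.I := d.h0 ⟨by linarith [d.hρ], by linarith [d.hρ]⟩

theorem conv {x y s : ℝ} (hx : x ∈ d.I) (hy : y ∈ d.I) (hs : s ∈ Icc (0:ℝ) 1) :
    (1 - s) * x + s * y ∈ d.I :=
  d.hconv hx hy (by linarith [hs.2]) hs.1 (by ring)

theorem eh_mem {e : ℝ} (he : e = 1 ∨ e = -1) : e * (d.ρ + 1) ∈ d.I := by
  apply d.h0
  have := d.hρ
  rcases he with rfl | rfl <;> constructor <;> linarith

theorem move1 {e : ℝ} (he : e = 1 ∨ e = -1) {ζ : ℂ} (h : ζ ∈ d.De e) {s : ℝ} (hs : s ∈ Icc (0:ℝ) 1) :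
    (⟨ζ.re, (1 - s) * ζ.im + s * (e * (d.ρ + 1))⟩ : ℂ) ∈ d.De e := by
  have key : ∀ i, |ζ.re - d.c i| ≤ d.ρ → 0 < e * ((1 - s) * ζ.im + s * (e * (d.ρ + 1))) ∧
      d.ρ ^ 2 < (ζ.re - d.c i) ^ 2 + ((1 - s) * ζ.im + s * (e * (d.ρ + 1))) ^ 2 := by
    intro i hi
    have h1 := h.2 i hi
    have h2 := h.1.2.2 i
    have e2 : e * e = 1 := by rcases he with rfl | rfl <;> norm_num
    have h3 : e * ((1 - s) * ζ.im + s * (e * (d.ρ + 1))) = (1 - s) * (e * ζ.im) + s * (d.ρ + 1) := by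
      linear_combination s * (d.ρ + 1) * e2
    have h4 : ((1 - s) * ζ.im + s * (e * (d.ρ + 1))) ^ 2 = ((1 - s) * (e * ζ.im) + s * (d.ρ + 1)) ^ 2 := by
      rw [← h3]; linear_combination (-((1 - s) * ζ.im + s * (e * (d.ρ + 1)))^2) * e2
    have h5 : ζ.im ^ 2 = (e * ζ.im) ^ 2 := by linear_combination (- ζ.im ^ 2) * e2
    rw [h3, h4]
    rw [h5] at h2
    set u := e * ζ.im
    have hρ := d.hρ
    obtain ⟨hs0, hs1⟩ := hs
    rcases le_total u (d.ρ + 1) with hu | hu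
    · have : u ≤ (1 - s) * u + s * (d.ρ + 1) := by nlinarith
      exact ⟨by linarith, by nlinarith⟩
    · have : d.ρ + 1 ≤ (1 - s) * u + s * (d.ρ + 1) := by nlinarith
      exact ⟨by linarith, by nlinarith [sq_nonneg (ζ.re - d.c i)]⟩
  refine ⟨⟨h.1.1, d.conv h.1.2.1 (d.eh_mem he) hs, fun i => ?_⟩, fun i hi => (key i hi).1⟩
  by_cases hi : |ζ.re - d.c i| ≤ d.ρ
  · exact (key i hi).2
  · have h2 : d.ρ ^ 2 < (ζ.re - d.c i) ^ 2 := by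
      rw [← sq_abs (ζ.re - d.c i)]; gcongr; exacts [d.hρ, not_le.1 hi]
    simp only
    nlinarith [sq_nonneg ((1 - s) * ζ.im + s * (e * (d.ρ + 1)))]

theorem high {e : ℝ} (he : e = 1 ∨ e = -1) {x : ℝ} (hx : x ∈ d.I) : (⟨x, e * (d.ρ + 1)⟩ : ℂ) ∈ d.De e := by
  have e2 : e * e = 1 := by rcases he with rfl | rfl <;> norm_num
  have hρ := d.hρ
  refine ⟨⟨hx, d.eh_mem he, fun i => ?_⟩, fun i _ => ?_⟩
  · have : (e * (d.ρ + 1)) ^ 2 = (d.ρ + 1) ^ 2 := by linear_combination (d.ρ + 1) ^ 2 * e2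
    simp only [this]
    nlinarith [sq_nonneg (x - d.c i)]
  · simp only
    have : e * (e * (d.ρ + 1)) = d.ρ + 1 := by linear_combination (d.ρ + 1) * e2
    rw [this]; linarith

noncomputable def H1 (e : ℝ) (q : ℂ × ℂ) (s : ℝ) : ℂ × ℂ := (q.1, ⟨q.2.re, (1 - s) * q.2.im + s * (e * (d.ρ + 1))⟩)
noncomputable def H2 (z0 : ℂ) (e : ℝ) (q : ℂ × ℂ) (s : ℝ) : ℂ × ℂ :=
  ((1 - s) • q.1 + s • z0, ⟨(1 - s) * q.2.re + s * 0, e * (d.ρ + 1)⟩)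

theorem cont_mk {X : Type*} [TopologicalSpace X] {f g : X → ℝ} (hf : Continuous f) (hg : Continuous g) :
    Continuous fun x => (⟨f x, g x⟩ : ℂ) := by
  have : (fun x => (⟨f x, g x⟩ : ℂ)) = fun x => (f x : ℂ) + g x * Complex.I := by
    funext x; exact Complex.mk_eq_add_mul_I _ _
  rw [this]; fun_prop

theorem H1_cont (e : ℝ) : Continuous fun p : (ℂ × ℂ) × ℝ => d.H1 e p.1 p.2 := by
  unfold H1
  exact (by fun_prop : Continuous fun p : (ℂ × ℂ) × ℝ => p.1.1).prodMk (cont_mk (by fun_prop) (by fun_prop))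

theorem H2_cont (z0 : ℂ) (e : ℝ) : Continuous fun p : (ℂ × ℂ) × ℝ => d.H2 z0 e p.1 p.2 := by
  unfold H2
  exact (by fun_prop : Continuous fun p : (ℂ × ℂ) × ℝ => (1 - p.2) • p.1.1 + p.2 • z0).prodMk
    (cont_mk (by fun_prop) (by fun_prop))

variable {Z : Set ℂ} {z0 : ℂ}

theorem H1_mem {e : ℝ} (he : e = 1 ∨ e = -1) {q : ℂ × ℂ} (hq : q ∈ Z ×ˢ d.De e) {s : ℝ}
    (hs : s ∈ Icc (0:ℝ) 1) : d.H1 e q s ∈ Z ×ˢ d.De e := ⟨hq.1, d.move1 he hq.2 hs⟩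

theorem star_mem (hZ : StarConvex ℝ z0 Z) {z : ℂ} (hz : z ∈ Z) {s : ℝ} (hs : s ∈ Icc (0:ℝ) 1) :
    (1 - s) • z + s • z0 ∈ Z := by
  rw [add_comm]; exact hZ hz hs.1 (by linarith [hs.2]) (by ring)

theorem H2_mem (hZ : StarConvex ℝ z0 Z) {e : ℝ} (he : e = 1 ∨ e = -1) {q : ℂ × ℂ} (hq : q ∈ Z ×ˢ d.De e) {s : ℝ}
    (hs : s ∈ Icc (0:ℝ) 1) : d.H2 z0 e q s ∈ Z ×ˢ d.De e :=
  ⟨star_mem hZ hq.1 hs, d.high he (d.conv hq.2.1.1 d.zero_mem hs)⟩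

theorem acyc (hZ : StarConvex ℝ z0 Z) (hz0 : z0 ∈ Z) {e : ℝ} (he : e = 1 ∨ e = -1)
    {a : ℂ × ℂ → ℂ × ℂ → K} (ha : Coc (Z ×ˢ d.De e) a) : Eqv (Z ×ˢ d.De e) a 0 := by
  have h1 := homotopy (W := Z ×ˢ d.De e) ha (d.H1 e) (d.H1_cont e).continuousOn
    (fun y hy s hs => d.H1_mem he hy hs)
  have h2 := homotopy (W := Z ×ˢ d.De e) ha (d.H2 z0 e) (d.H2_cont z0 e).continuousOn
    (fun y hy s hs => d.H2_mem hZ he hy hs)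
  have h3 := h2.pb (W := Z ×ˢ d.De e) (φ := fun y => d.H1 e y 1)
    ((d.H1_cont e).comp (by fun_prop : Continuous fun y : ℂ × ℂ => (y, (1:ℝ)))).continuousOn
    (fun q hq => d.H1_mem he hq (by simp))
  have e0 : pb (fun y => d.H1 e y 0) a = a := by
    funext y z; simp [pb, H1]
  have e1 : pb (fun y => d.H1 e y 1) (pb (fun y => d.H2 z0 e y 0) a) = pb (fun y => d.H1 e y 1) a := by
    funext y z; simp [pb, H1, H2]
  have e2 : pb (fun y => d.H1 e y 1) (pb (fun y => d.H2 z0 e y 1) a) = 0 := by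
    funext y z
    simp only [pb, H2, sub_self, zero_smul, zero_add, one_smul, zero_mul, mul_zero]
    exact ha.diag ⟨hz0, d.high he d.zero_mem⟩
  rw [e0] at h1
  rw [e1, e2] at h3
  exact h1.symm.trans h3.symm

theorem lc_De (hZ : StarConvex ℝ z0 Z) {e : ℝ} (he : e = 1 ∨ e = -1)
    {l : ℂ × ℂ → K} (hl : LC (Z ×ˢ d.De e) l) {q : ℂ × ℂ} (hq : q ∈ Z ×ˢ d.De e) :
    l q = l (z0, ⟨0, e * (d.ρ + 1)⟩) := by
  have h1 := hl.path (fun s => d.H1 e q s)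
    ((d.H1_cont e).comp (by fun_prop : Continuous fun s : ℝ => (q, s))).continuousOn
    (fun s hs => d.H1_mem he hq hs)
  have hq' := d.H1_mem (s := 1) he hq (by simp)
  have h2 := hl.path (fun s => d.H2 z0 e (d.H1 e q 1) s)
    ((d.H2_cont z0 e).comp (by fun_prop : Continuous fun s : ℝ => (d.H1 e q 1, s))).continuousOn
    (fun s hs => d.H2_mem hZ he hq' hs)
  simp [H1, H2] at h1 h2
  rw [h1, h2]

theorem x0_off : d.x0 ∈ d.off := ⟨d.hx0, d.hx0'⟩
theorem x0_mem (e : ℝ) : (d.x0 : ℂ) ∈ d.De e :=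
  d.mem_De_of_off (by simpa using d.x0_off) (by simpa using d.zero_mem) e

/-- connectedness of `Z × D` -/
theorem lc_D (hZ : StarConvex ℝ z0 Z) (hz0 : z0 ∈ Z) {l : ℂ × ℂ → K} (hl : LC (Z ×ˢ d.D) l)
    {q : ℂ × ℂ} (hq : q ∈ Z ×ˢ d.D) : l q = l (z0, d.x0) := by
  have hl' : ∀ e, LC (Z ×ˢ d.De e) l := fun e => hl.mono (prod_mono le_rfl fun ζ h => h.1)
  rcases d.cover hq.2 with h | h
  · rw [d.lc_De hZ (Or.inl rfl) (hl' _) ⟨hq.1, h⟩, d.lc_De hZ (Or.inl rfl) (hl' _) (q := (z0, d.x0)) ⟨hz0, d.x0_mem _⟩]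
  · rw [d.lc_De hZ (Or.inr rfl) (hl' _) ⟨hq.1, h⟩, d.lc_De hZ (Or.inr rfl) (hl' _) (q := (z0, d.x0)) ⟨hz0, d.x0_mem _⟩]

theorem isOpen_off : IsOpen d.off := by
  have : d.off = d.I ∩ ⋂ i, {x | d.ρ < |x - d.c i|} := by ext; simp [off]
  rw [this]
  exact d.hI.inter (isOpen_iInter_of_finite fun i => isOpen_lt continuous_const (by fun_prop))

theorem stepfun {Λ : ℝ → K} (hΛ : LC d.off Λ) :
    ∃ (k : κ → K) (k0 : K), ∀ x ∈ d.off, Λ x = k0 + ∑ i, if d.c i < x then k i else 0 := by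
  classical
  have hρ := d.hρ
  set k : κ → K := fun i => Λ (d.c i + d.ρ + 1/4) - Λ (d.c i - d.ρ - 1/4) with hk
  set st : ℝ → K := fun x => ∑ i, if d.c i < x then k i else 0 with hst
  -- points near `c i` but off
  have nb : ∀ i x, d.ρ < |x - d.c i| → |x - d.c i| < d.ρ + 1/2 → x ∈ d.off := by
    intro i x h1 h2
    refine ⟨d.hc i ?_, fun j => ?_⟩
    · rw [abs_lt] at h2; constructor <;> linarith [h2.1, h2.2]
    · by_cases hij : i = j
      · rwa [← hij]
      · have h3 := d.hsep i j hij
        have h4 : |d.c i - d.c j| ≤ |x - d.c j| + |x - d.c i| := by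
          have := abs_sub_le (d.c i) x (d.c j); rw [abs_sub_comm (d.c i) x] at this; linarith
        linarith
  have lt_iff : ∀ i j, j ≠ i → ∀ x, |x - d.c i| < d.ρ + 1/2 → (d.c j < x ↔ d.c j < d.c i) := by
    intro i j hij x hx
    have h3 := d.hsep j i hij
    rw [abs_lt] at hx
    rcases le_abs.1 h3 with h | h
    · constructor <;> intro <;> linarith
    · constructor <;> intro <;> linarith
  have jump : ∀ i x, d.ρ < |x - d.c i| → |x - d.c i| < d.ρ + 1/2 →
      Λ x - st x = Λ (d.c i + d.ρ + 1/4) - st (d.c i + d.ρ + 1/4) := by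
    intro i x h1 h2
    have hr : |d.c i + d.ρ + 1/4 - d.c i| < d.ρ + 1/2 := by
      rw [abs_lt]; constructor <;> linarith
    have hsum : ∀ y, |y - d.c i| < d.ρ + 1/2 → st y = (if d.c i < y then k i else 0) +
        ∑ j ∈ Finset.univ.erase i, if d.c j < d.c i then k j else 0 := by
      intro y hy
      rw [hst]
      simp only
      rw [← Finset.add_sum_erase _ _ (Finset.mem_univ i)]
      congr 1
      refine Finset.sum_congr rfl fun j hj => ?_
      simp only [lt_iff i j (Finset.ne_of_mem_erase hj) y hy]
    rw [hsum _ h2, hsum _ hr, if_pos (show d.c i < d.c i + d.ρ + 1/4 by linarith)]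
    rcases lt_abs.1 h1 with h | h
    · have hx : x < d.c i + d.ρ + 1/2 := by rw [abs_lt] at h2; linarith [h2.2]
      rw [if_pos (by linarith)]
      have : Λ x = Λ (d.c i + d.ρ + 1/4) := by
        refine LC.const (W := Ioo (d.c i + d.ρ) (d.c i + d.ρ + 1/2)) (hΛ.mono ?_) isPreconnected_Ioo
          ⟨by linarith, by linarith⟩ ⟨by linarith, by linarith⟩
        intro y hy
        have : |y - d.c i| = y - d.c i := abs_of_nonneg (by linarith [hy.1])
        exact nb i y (by rw [this]; linarith [hy.1]) (by rw [this]; linarith [hy.2])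
      rw [this]
    · have hx : d.c i - d.ρ - 1/2 < x := by rw [abs_lt] at h2; linarith [h2.1]
      rw [if_neg (by linarith)]
      have : Λ x = Λ (d.c i - d.ρ - 1/4) := by
        refine LC.const (W := Ioo (d.c i - d.ρ - 1/2) (d.c i - d.ρ)) (hΛ.mono ?_) isPreconnected_Ioo
          ⟨by linarith, by linarith⟩ ⟨by linarith, by linarith⟩
        intro y hy
        have : |y - d.c i| = -(y - d.c i) := abs_of_nonpos (by linarith [hy.2])
        exact nb i y (by rw [this]; linarith [hy.2]) (by rw [this]; linarith [hy.1])
      rw [this, hk]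
      ring
  set F : ℝ → K := fun x => if h : ∃ i, |x - d.c i| ≤ d.ρ then
    Λ (d.c h.choose + d.ρ + 1/4) - st (d.c h.choose + d.ρ + 1/4) else Λ x - st x with hF
  have Fnear : ∀ i x, |x - d.c i| < d.ρ + 1/2 →
      F x = Λ (d.c i + d.ρ + 1/4) - st (d.c i + d.ρ + 1/4) := by
    intro i x hx
    simp only [hF]
    split_ifs with h
    · have h1 := h.choose_spec
      have : h.choose = i := by
        by_contra hne
        have h3 := d.hsep _ _ hne
        have h4 : |d.c h.choose - d.c i| ≤ |x - d.c i| + |x - d.c h.choose| := by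
          have := abs_sub_le (d.c h.choose) x (d.c i); rw [abs_sub_comm (d.c h.choose) x] at this; linarith
        linarith
      rw [this]
    · push Not at h
      exact jump i x (h i) hx
  have Foff : ∀ x ∈ d.off, F x = Λ x - st x := by
    intro x hx
    simp only [hF]
    rw [dif_neg]
    rintro ⟨i, hi⟩
    exact absurd hi (not_le.2 (hx.2 i))
  have hLC : LC d.I F := by
    intro x hx
    by_cases h : ∃ i, |x - d.c i| ≤ d.ρ
    · obtain ⟨i, hi⟩ := h
      have : {y | |y - d.c i| < d.ρ + 1/2} ∈ 𝓝[d.I] x := mem_nhdsWithin_of_mem_nhds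
        ((isOpen_lt (by fun_prop) continuous_const).mem_nhds (show |x - d.c i| < d.ρ + 1/2 by linarith))
      filter_upwards [eventually_smallSets_subset.2 this] with U hU y hy z hz
      rw [Fnear i y (hU hy), Fnear i z (hU hz)]
    · push Not at h
      have hxo : x ∈ d.off := ⟨hx, h⟩
      have h1 : 𝓝[d.I] x ≤ 𝓝[d.off] x :=
        nhdsWithin_le_of_mem (mem_nhdsWithin_of_mem_nhds (d.isOpen_off.mem_nhds hxo))
      have h2 := (hΛ x hxo).filter_mono (monotone_smallSets h1)
      have h3 : ∀ᶠ y in 𝓝[d.I] x, ∀ i, d.c i < y ↔ d.c i < x := by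
        rw [eventually_all]
        intro i
        refine mem_nhdsWithin_of_mem_nhds ?_
        have : x ≠ d.c i := by
          rintro e; have := h i; rw [e] at this; simp at this; linarith
        rcases lt_or_gt_of_ne this with hl | hl
        · filter_upwards [Iio_mem_nhds hl] with y hy
          exact ⟨fun h => absurd h (not_lt.2 (le_of_lt hy)), fun h => absurd h (not_lt.2 hl.le)⟩
        · filter_upwards [Ioi_mem_nhds hl] with y hy
          exact ⟨fun _ => hl, fun _ => hy⟩
      filter_upwards [h2, eventually_smallSets_subset.2 (h1 self_mem_nhdsWithin), eventually_smallSets_forall.2 h3]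
        with U h2 hU h3 y hy z hz
      rw [Foff y (hU hy), Foff z (hU hz), h2 y hy z hz]
      simp only [hst, h3 y hy, h3 z hz]
  refine ⟨k, F d.x0, fun x hx => ?_⟩
  have := hLC.const d.hconv.isPreconnected hx.1 d.hx0
  rw [← this, Foff x hx]
  simp [hst]

theorem c_slit1 {ζ : ℂ} (h : ζ ∈ d.De 1) (i : κ) : -Complex.I * (ζ - d.c i) ∈ Complex.slitPlane := by
  rw [Complex.mem_slitPlane_iff]
  by_cases hi : |ζ.re - d.c i| ≤ d.ρ
  · left; have := h.2 i hi; simp; linarith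
  · right
    simp
    intro h0
    rw [show ζ.re - d.c i = 0 by linarith] at hi
    simp at hi
    linarith [d.hρ]

theorem c_slit2 {ζ : ℂ} (h : ζ ∈ d.De (-1)) (i : κ) : -(-Complex.I * (ζ - d.c i)) ∈ Complex.slitPlane := by
  rw [Complex.mem_slitPlane_iff]
  by_cases hi : |ζ.re - d.c i| ≤ d.ρ
  · left; have := h.2 i hi; simp at this ⊢; linarith
  · right
    simp
    intro h0
    rw [h0] at hi
    simp at hi
    linarith [d.hρ]

theorem f_ne {ζ : ℂ} (h : ζ ∈ d.D) (i : κ) : -Complex.I * (ζ - d.c i) ≠ 0 := by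
  rcases d.cover h with h | h
  · exact Complex.slitPlane_ne_zero (d.c_slit1 h i)
  · exact neg_ne_zero.1 (Complex.slitPlane_ne_zero (d.c_slit2 h i))

theorem f_cont (i : κ) (W : Set (ℂ × ℂ)) : ContinuousOn (fun q : ℂ × ℂ => -Complex.I * (q.2 - d.c i)) W := by
  fun_prop

theorem σ_coc (i : κ) : Coc (Z ×ˢ d.D) (d.σ (K := K) i) := cls_coc (d.f_cont i _) fun q hq => d.f_ne hq.2 i

theorem T1 (hZ : StarConvex ℝ z0 Z) (hz0 : z0 ∈ Z) {a : ℂ × ℂ → ℂ × ℂ → K} (ha : Coc (Z ×ˢ d.D) a) :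
    ∃ k : κ → K, Eqv (Z ×ˢ d.D) a (∑ i, k i • d.σ i) := by
  have hs : ∀ e, Z ×ˢ d.De e ⊆ Z ×ˢ d.D := fun e => prod_mono le_rfl fun ζ h => h.1
  obtain ⟨g, hg⟩ := d.acyc hZ hz0 (Or.inl rfl) (ha.mono (hs 1))
  obtain ⟨g', hg'⟩ := d.acyc hZ hz0 (Or.inr rfl) (ha.mono (hs (-1)))
  have hlc : LC (Z ×ˢ (d.De 1 ∩ d.De (-1))) (g - g') :=
    LC.of_eqG (N2.mono hg (prod_mono le_rfl inter_subset_left)) (N2.mono hg' (prod_mono le_rfl inter_subset_right))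
  have hL : LC d.off (fun x => (g - g') (z0, (x:ℂ))) := by
    refine N2.comap hlc (by fun_prop) fun x hx => ⟨hz0, ?_, ?_⟩ <;>
      exact d.mem_De_of_off (by simpa using hx) (by simpa using d.zero_mem) _
  obtain ⟨k, k0, hk⟩ := d.stepfun hL
  have hkk : ∀ q ∈ Z ×ˢ (d.De 1 ∩ d.De (-1)), (g - g') q = k0 + ∑ i, if d.c i < q.2.re then k i else 0 := by
    intro q hq
    have hoff := d.off_of_mem hq.2.1 hq.2.2
    have := hlc.path (fun s => ((1 - s) • q.1 + s • z0, (⟨q.2.re, (1 - s) * q.2.im + s * 0⟩ : ℂ)))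
      (Continuous.continuousOn ((by fun_prop : Continuous fun s : ℝ => (1 - s) • q.1 + s • z0).prodMk
        (cont_mk (by fun_prop) (by fun_prop))))
      (fun s hs => ⟨star_mem hZ hq.1 hs,
        d.mem_De_of_off (ζ := ⟨q.2.re, (1 - s) * q.2.im + s * 0⟩) hoff (d.conv hq.2.1.1.2.1 d.zero_mem hs) _,
        d.mem_De_of_off (ζ := ⟨q.2.re, (1 - s) * q.2.im + s * 0⟩) hoff (d.conv hq.2.1.1.2.1 d.zero_mem hs) _⟩)
    have h2 := hk _ hoff
    have e1 : (⟨q.2.re, 0⟩ : ℂ) = (q.2.re : ℂ) := rfl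
    simp only [sub_zero, one_smul, zero_smul, add_zero, one_mul, zero_mul, sub_self, zero_add, mul_zero] at this
    rw [← h2, ← e1, ← this]
  refine ⟨k, glue (ι := Bool) (O := fun b => {q | q.2 ∈ d.De (if b then 1 else -1)})
    (g := fun b q => if b then g q else g' q - ∑ i, k i * qn (- (-Complex.I * (q.2 - d.c i))) + k0) ?_ ?_ ?_ ?_⟩
  · exact fun b => (d.isOpen_De _).preimage continuous_snd
  · intro q hq
    rcases d.cover hq.2 with h | h
    · exact ⟨true, by simpa using h⟩
    · exact ⟨false, by simpa using h⟩
  · have hsub : ∀ e, Z ×ˢ d.D ∩ {q : ℂ × ℂ | q.2 ∈ d.De e} ⊆ Z ×ˢ d.De e := fun e q hq => ⟨hq.1.1, hq.2⟩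
    rintro (_ | _)
    · have h2 : N2 (Z ×ˢ d.De (-1)) fun y z => ∀ i, d.σ (K := K) i y z = _ :=
        N2.all fun i => cls_neg_slit (d.f_cont i _) fun q hq => d.c_slit2 hq.2 i
      refine ((N2.and hg' h2).mono (by simpa using hsub (-1))).imp ?_
      rintro y z ⟨h1, h2⟩
      simp only [Pi.zero_apply, zero_add] at h1 h2
      simp [Finset.sum_apply, h2, h1, mul_sub]
      ring
    · have h2 : N2 (Z ×ˢ d.De 1) fun y z => ∀ i, d.σ (K := K) i y z = 0 :=
        N2.all fun i => cls_slit (d.f_cont i _) fun q hq => d.c_slit1 hq.2 i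
      refine ((N2.and hg h2).mono (by simpa using hsub 1)).imp ?_
      rintro y z ⟨h1, h2⟩
      simp only [Pi.zero_apply, zero_add] at h1 h2
      simp [Finset.sum_apply, h2, h1]
  · have key : ∀ q ∈ Z ×ˢ d.D, q.2 ∈ d.De 1 → q.2 ∈ d.De (-1) →
        g q = g' q - ∑ i, k i * qn (- (-Complex.I * (q.2 - d.c i))) + k0 := by
      intro q hq h1 h2
      have h3 := hkk q ⟨hq.1, h1, h2⟩
      have h4 := d.off_of_mem h1 h2
      have h5 : ∑ i, k i * qn (K := K) (- (-Complex.I * (q.2 - d.c i))) = - ∑ i, if d.c i < q.2.re then k i else 0 := by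
        rw [← Finset.sum_neg_distrib]
        refine Finset.sum_congr rfl fun i _ => ?_
        split_ifs with h
        · rw [qn_pos (by simp; linarith)]; ring
        · have h6 : q.2.re < d.c i := by
            refine lt_of_le_of_ne (not_lt.1 h) fun h => ?_
            have := h4.2 i; rw [h] at this; simp at this; linarith [d.hρ]
          rw [qn_neg (by simp; linarith)]; ring
      rw [h5]
      simp only [Pi.sub_apply] at h3
      linear_combination h3
    rintro (_ | _) (_ | _) q hq h1 h2
    · rfl
    · simpa using (key q hq (by simpa using h2) (by simpa using h1)).symm
    · simpa using (key q hq (by simpa using h1) (by simpa using h2))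
    · rfl

end Dat
end TA
end Part_3

section Part_4
set_option linter.all false
open Filter Topology Set

namespace TA

namespace Dat
variable {κ : Type} [Fintype κ] (d : Dat κ) {K : Type*} [Field K] {Z : Set ℂ} {z0 : ℂ}

/-- the unit circle retraction -/
noncomputable def un (ξ : ℂ) : ℂ := ξ / (‖ξ‖ : ℂ)

theorem un_norm {ξ : ℂ} (h : ξ ≠ 0) : ‖un ξ‖ = 1 := by simp [un, h]

theorem un_cont : ContinuousOn un {z : ℂ | z ≠ 0} :=
  continuousOn_id.div (by fun_prop) (by intro z hz; simpa using hz)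

theorem un_ne {ξ : ℂ} (h : ξ ≠ 0) : un ξ ≠ 0 := by simp [un, h]

theorem cls_un {u : ℂ} (hu : u ≠ 0) : Eqv {z : ℂ | z ≠ 0} (cls (K := K) fun z => u * un z) (cls fun z => z) := by
  refine (cls_const_mul un_cont (fun x hx => un_ne hx) u hu).trans
    (cls_close un_cont continuousOn_id (fun x hx => hx) fun x (hx : x ≠ 0) => ?_)
  have : un x / x = ((‖x‖⁻¹ : ℝ) : ℂ) := by
    simp only [un]; push_cast; field_simp
  rw [this]
  left; simpa using hx

theorem circ_mem (i : κ) {ξ : ℂ} (h : ξ ≠ 0) : (d.c i : ℂ) + ((d.ρ + 1/2 : ℝ) : ℂ) * un ξ ∈ d.D := by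
  have h1 := un_norm h
  have hρ := d.hρ
  have h2 : (un ξ).re ^ 2 + (un ξ).im ^ 2 = 1 := by
    have := Complex.sq_norm (un ξ)
    rw [h1, Complex.normSq_apply] at this; linarith
  have hre : |(un ξ).re| ≤ 1 := by rw [← h1]; exact Complex.abs_re_le_norm _
  have him : |(un ξ).im| ≤ 1 := by rw [← h1]; exact Complex.abs_im_le_norm _
  have hre' : |(d.ρ + 1/2) * (un ξ).re| ≤ d.ρ + 1/2 := by
    rw [abs_mul, abs_of_nonneg (by linarith : 0 ≤ d.ρ + 1/2)]; nlinarith [abs_nonneg (un ξ).re]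
  have him' : |(d.ρ + 1/2) * (un ξ).im| ≤ d.ρ + 1/2 := by
    rw [abs_mul, abs_of_nonneg (by linarith : 0 ≤ d.ρ + 1/2)]; nlinarith [abs_nonneg (un ξ).im]
  have e1 : ((d.c i : ℂ) + ((d.ρ + 1/2 : ℝ) : ℂ) * un ξ).re = d.c i + (d.ρ + 1/2) * (un ξ).re := by
    rw [Complex.add_re, Complex.re_ofReal_mul, Complex.ofReal_re]
  have e2 : ((d.c i : ℂ) + ((d.ρ + 1/2 : ℝ) : ℂ) * un ξ).im = (d.ρ + 1/2) * (un ξ).im := by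
    rw [Complex.add_im, Complex.im_ofReal_mul, Complex.ofReal_im, zero_add]
  refine ⟨?_, ?_, fun j => ?_⟩
  · rw [e1]; apply d.hc i; rw [abs_le] at hre'; constructor <;> linarith [hre'.1, hre'.2]
  · rw [e2]; apply d.h0; rw [abs_le] at him'; constructor <;> linarith [him'.1, him'.2]
  · rw [e1, e2]
    by_cases hij : i = j
    · subst hij
      nlinarith
    · have h3 := d.hsep i j hij
      have h4 : d.ρ + 1/2 ≤ |d.c i + (d.ρ + 1/2) * (un ξ).re - d.c j| := by
        have := abs_sub_abs_le_abs_sub (d.c i - d.c j) (-((d.ρ + 1/2) * (un ξ).re))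
        rw [abs_neg] at this
        have e : d.c i - d.c j - -((d.ρ + 1/2) * (un ξ).re) = d.c i + (d.ρ + 1/2) * (un ξ).re - d.c j := by ring
        rw [e] at this; linarith
      have h5 : (d.ρ + 1/2) ^ 2 ≤ (d.c i + (d.ρ + 1/2) * (un ξ).re - d.c j) ^ 2 := by
        rw [← sq_abs (d.c i + (d.ρ + 1/2) * (un ξ).re - d.c j)]; gcongr
      nlinarith [sq_nonneg ((d.ρ + 1/2) * (un ξ).im)]

/-- uniqueness, σ part -/
theorem uniqσ (hz0 : z0 ∈ Z) {h : K} {k : κ → K}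
    (hh : Eqv (Z ×ˢ d.D) (h • τ + ∑ i, k i • d.σ i) (0 : ℂ × ℂ → ℂ × ℂ → K)) (i : κ) : k i = 0 := by
  classical
  have hρ := d.hρ
  have h1 := hh.pb (W := {z : ℂ | z ≠ 0}) (φ := fun ξ => (z0, (d.c i : ℂ) + ((d.ρ + 1/2 : ℝ) : ℂ) * un ξ))
    (continuousOn_const.prodMk (continuousOn_const.add (continuousOn_const.mul un_cont)))
    (fun ξ hξ => ⟨hz0, d.circ_mem i hξ⟩)
  rw [pb_add, pb_smul, pb_sum, pb_zero] at h1
  simp only [pb_smul, σ, τ, pb_cls] at h1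
  rw [cls_const, smul_zero, zero_add] at h1
  have hne : ((d.ρ + 1/2 : ℝ) : ℂ) ≠ 0 := by
    rw [Complex.ofReal_ne_zero]; linarith
  have h2 : Eqv {z : ℂ | z ≠ 0} (∑ j, k j • cls (K := K) (fun ξ => -Complex.I * ((d.c i : ℂ) +
      ((d.ρ + 1/2 : ℝ) : ℂ) * un ξ - d.c j))) (∑ j, if j = i then k j • cls (fun z => z) else 0) := by
    refine Eqv.sum _ fun j _ => ?_
    split_ifs with hj
    · subst hj
      refine Eqv.smul _ ?_
      have := cls_un (K := K) (u := -Complex.I * ((d.ρ + 1/2 : ℝ) : ℂ)) (mul_ne_zero (by simp) hne)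
      convert this using 3
      ring
    · have := (cls_triv (K := K) (W := {z : ℂ | z ≠ 0}) (f := fun ξ => -Complex.I * ((d.c i : ℂ) +
        ((d.ρ + 1/2 : ℝ) : ℂ) * un ξ - d.c j)) ?_ (Complex.I * ((d.c i - d.c j : ℝ) : ℂ)) ?_).smul (k j)
      · rwa [smul_zero] at this
      · exact continuousOn_const.mul ((continuousOn_const.add (continuousOn_const.mul un_cont)).sub continuousOn_const)
      · intro ξ hξ
        have h3 := d.hsep i j (Ne.symm hj)
        left
        have e1 : Complex.I * ((d.c i - d.c j : ℝ) : ℂ) * (-Complex.I * ((d.c i : ℂ) +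
          ((d.ρ + 1/2 : ℝ) : ℂ) * un ξ - d.c j)) = (((d.c i - d.c j) * (d.c i - d.c j) : ℝ) : ℂ) +
            (((d.c i - d.c j) * (d.ρ + 1/2) : ℝ) : ℂ) * un ξ := by
          push_cast
          linear_combination (-(d.c i - d.c j : ℂ) * ((d.c i : ℂ) + ((d.ρ : ℂ) + 1/2) * un ξ - d.c j)) * Complex.I_mul_I
        rw [e1, Complex.add_re, Complex.re_ofReal_mul, Complex.ofReal_re]
        have hre : |(un ξ).re| ≤ 1 := by rw [← un_norm hξ]; exact Complex.abs_re_le_norm _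
        set D := d.c i - d.c j
        have h4 : |D * (d.ρ + 1/2) * (un ξ).re| ≤ |D| * (d.ρ + 1/2) := by
          rw [abs_mul, abs_mul, abs_of_nonneg (by linarith : 0 ≤ d.ρ + 1/2)]
          have : 0 ≤ |D| * (d.ρ + 1/2) := by positivity
          nlinarith
        have h5 : D * D = |D| * |D| := (abs_mul_abs_self D).symm
        rw [abs_le] at h4
        rw [h5]
        nlinarith [h4.1]
  have h3 := h2.symm.trans h1
  rw [Finset.sum_ite_eq' Finset.univ i, if_pos (Finset.mem_univ _)] at h3
  exact cls_ne h3

theorem x0_memD : (d.x0 : ℂ) ∈ d.D := (d.x0_mem 1).1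

/-- the punctured product -/
def P : Set (ℂ × ℂ) := {z : ℂ | z ≠ 0} ×ˢ d.D

theorem isOpen_P : IsOpen d.P := (isOpen_ne).prod d.isOpen_D

/-- uniqueness -/
theorem uniq {h : K} {k : κ → K} (hh : Eqv d.P (h • τ + ∑ i, k i • d.σ i) (0 : ℂ × ℂ → ℂ × ℂ → K)) : h = 0 ∧ ∀ i, k i = 0 := by
  have hk : ∀ i, k i = 0 := fun i => d.uniqσ (z0 := 1) (by simp) hh i
  refine ⟨?_, hk⟩
  simp only [hk, zero_smul, Finset.sum_const_zero, add_zero] at hh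
  have h1 := hh.pb (W := {z : ℂ | z ≠ 0}) (φ := fun z => (z, (d.x0 : ℂ))) (by fun_prop)
    (fun z hz => ⟨hz, d.x0_memD⟩)
  exact cls_ne h1

def S (e : ℝ) : Set ℂ := {z | (e : ℂ) * z ∈ Complex.slitPlane}

theorem S_star {e : ℝ} (he : e = 1 ∨ e = -1) : StarConvex ℝ (e : ℂ) (S e) := by
  intro z hz a b ha hb hab
  have := Complex.starConvex_one_slitPlane hz ha hb hab
  simp only [S, mem_setOf_eq] at *
  convert this using 1
  have e2 : (e : ℂ) * e = 1 := by rcases he with rfl | rfl <;> norm_num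
  simp only [Complex.real_smul]
  linear_combination (a : ℂ) * e2

theorem S_self {e : ℝ} (he : e = 1 ∨ e = -1) : (e : ℂ) ∈ S e := by
  rcases he with rfl | rfl <;> simp [S]

theorem S_open (e : ℝ) : IsOpen (S e) := Complex.isOpen_slitPlane.preimage (by fun_prop)

theorem S_ne {e : ℝ} {z : ℂ} (h : z ∈ S e) : z ≠ 0 := by rintro rfl; simp [S] at h

theorem S_cover {z : ℂ} (h : z ≠ 0) : z ∈ S 1 ∨ z ∈ S (-1) := by
  simp only [S, mem_setOf_eq, Complex.mem_slitPlane_iff]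
  by_contra hc
  push Not at hc
  simp at hc
  apply h
  apply Complex.ext <;> simp <;> linarith [hc.1.1, hc.1.2, hc.2.1]

theorem S_im {z : ℂ} (h : z ∈ S 1) (h' : z ∈ S (-1)) : z.im ≠ 0 := by
  simp only [S, mem_setOf_eq, Complex.mem_slitPlane_iff] at h h'
  intro h0
  simp [h0] at h h'
  linarith

def Hf (e : ℝ) : Set ℂ := {z | 0 < e * z.im}

theorem Hf_star {e : ℝ} (he : e = 1 ∨ e = -1) : StarConvex ℝ (e * Complex.I) (Hf e) := by
  have e2 : e * e = 1 := by rcases he with rfl | rfl <;> norm_num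
  intro z hz a b ha hb hab
  simp only [Hf, mem_setOf_eq] at *
  simp only [Complex.add_im, Complex.real_smul, Complex.im_ofReal_mul, Complex.I_im, mul_one]
  have : e * (a * e + b * z.im) = a + b * (e * z.im) := by linear_combination a * e2
  rw [this]
  rcases eq_or_lt_of_le ha with h | h
  · rw [← h] at hab ⊢; rw [zero_add] at hab; rw [hab]; linarith
  · nlinarith [mul_nonneg hb hz.le]

theorem Hf_self {e : ℝ} (he : e = 1 ∨ e = -1) : e * Complex.I ∈ Hf e := by
  rcases he with rfl | rfl <;> simp [Hf]

theorem Hf_S {e e' : ℝ} (he : e = 1 ∨ e = -1) (he' : e' = 1 ∨ e' = -1) {z : ℂ} (h : z ∈ Hf e) : z ∈ S e' := by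
  right
  intro h0
  simp only [Hf, mem_setOf_eq] at h
  rw [Complex.im_ofReal_mul] at h0
  have : z.im = 0 := by rcases he' with rfl | rfl <;> linarith
  rw [this] at h; linarith

theorem τ_coc {W : Set (ℂ × ℂ)} (h : ∀ q ∈ W, q.1 ≠ 0) : Coc W (τ (K := K)) := cls_coc (by fun_prop) h

/-- connectedness of P -/
theorem lc_P {l : ℂ × ℂ → K} (hl : LC d.P l) {q q' : ℂ × ℂ} (hq : q ∈ d.P) (hq' : q' ∈ d.P) : l q = l q' := by
  have key : ∀ q ∈ d.P, l q = l (Complex.I, d.x0) := by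
    intro q hq
    have h1 : ∀ e : ℝ, (e = 1 ∨ e = -1) → ∀ q ∈ S e ×ˢ d.D, l q = l (Complex.I, d.x0) := by
      intro e he q hq
      have hl' : LC (S e ×ˢ d.D) l := hl.mono (prod_mono (fun z hz => S_ne hz) le_rfl)
      rw [d.lc_D (S_star he) (S_self he) hl' hq, d.lc_D (S_star he) (S_self he) hl' (q := (Complex.I, d.x0))]
      refine ⟨Hf_S (Or.inl rfl) he ?_, d.x0_memD⟩
      simpa using Hf_self (Or.inl rfl)
    rcases S_cover hq.1 with h | h
    · exact h1 _ (Or.inl rfl) q ⟨h, hq.2⟩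
    · exact h1 _ (Or.inr rfl) q ⟨h, hq.2⟩
  rw [key q hq, key q' hq']

theorem T2 {a : ℂ × ℂ → ℂ × ℂ → K} (ha : Coc d.P a) :
    ∃ (h : K) (k : κ → K), Eqv d.P a (h • τ + ∑ i, k i • d.σ i) := by
  have hs : ∀ e, S e ×ˢ d.D ⊆ d.P := fun e => prod_mono (fun z hz => S_ne hz) le_rfl
  obtain ⟨k, g, hg⟩ := d.T1 (S_star (Or.inl rfl)) (S_self (Or.inl rfl)) (ha.mono (hs 1))
  obtain ⟨k', hk'⟩ := d.T1 (S_star (Or.inr rfl)) (S_self (Or.inr rfl)) (ha.mono (hs (-1)))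
  have hkE : Eqv (S 1 ×ˢ d.D) a (∑ i, k i • d.σ i) := ⟨g, hg⟩
  have hkk : k' = k := by
    have hH : ∀ e, (e = 1 ∨ e = -1) → Hf 1 ×ˢ d.D ⊆ S e ×ˢ d.D := fun e he =>
      prod_mono (fun z hz => Hf_S (Or.inl rfl) he hz) le_rfl
    have h1 := (hk'.mono (hH _ (Or.inr rfl))).symm.sub (hkE.mono (hH _ (Or.inl rfl))).symm
    rw [sub_self, ← Finset.sum_sub_distrib] at h1
    simp only [← sub_smul] at h1
    have h2 := d.uniqσ (Hf_self (Or.inl rfl)) (h := 0) (k := fun i => k' i - k i) (by simpa using h1)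
    funext i; exact sub_eq_zero.1 (h2 i)
  subst hkk
  obtain ⟨g', hg'⟩ := hk'
  have hlc : ∀ e, (e = 1 ∨ e = -1) → ∀ q ∈ Hf e ×ˢ d.D, (g - g') q = (g - g') (e * Complex.I, d.x0) := by
    intro e he q hq
    refine d.lc_D (Hf_star he) (Hf_self he) (LC.of_eqG (a := a) (b := ∑ i, k' i • d.σ i) ?_ ?_) hq
    · exact N2.mono hg (prod_mono (fun z hz => Hf_S he (Or.inl rfl) hz) le_rfl)
    · exact N2.mono hg' (prod_mono (fun z hz => Hf_S he (Or.inr rfl) hz) le_rfl)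
  set u := (g - g') (((1:ℝ):ℂ) * Complex.I, d.x0) with hu
  set v := (g - g') (((-1:ℝ):ℂ) * Complex.I, d.x0) with hv
  -- on S (-1) τ = δ qn(-z): 0 on upper, -1 on lower
  refine ⟨v - u, k', glue (ι := Bool) (O := fun b => {q | q.1 ∈ S (if b then 1 else -1)})
    (g := fun b q => if b then g q else g' q - (v - u) * qn (-q.1) + u) ?_ ?_ ?_ ?_⟩
  · exact fun b => (S_open _).preimage continuous_fst
  · intro q hq
    rcases S_cover hq.1 with h | h
    · exact ⟨true, by simpa using h⟩
    · exact ⟨false, by simpa using h⟩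
  · have hsub : ∀ e, d.P ∩ {q : ℂ × ℂ | q.1 ∈ S e} ⊆ S e ×ˢ d.D := fun e q hq => ⟨hq.2, hq.1.2⟩
    rintro (_ | _)
    · have h2 : N2 (S (-1) ×ˢ d.D) fun y z => τ (K := K) y z = _ :=
        cls_neg_slit (f := fun q : ℂ × ℂ => q.1) (by fun_prop) fun q hq => by simpa [S] using hq.1
      refine ((N2.and hg' h2).mono (by simpa using hsub (-1))).imp ?_
      rintro y z ⟨h1, h2⟩
      simp only [Pi.zero_apply, zero_add] at h2
      simp only [Pi.add_apply, Pi.smul_apply, h1, h2, smul_eq_mul, Bool.false_eq_true, if_false]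
      ring
    · have h2 : N2 (S 1 ×ˢ d.D) fun y z => τ (K := K) y z = 0 :=
        cls_slit (f := fun q : ℂ × ℂ => q.1) (by fun_prop) fun q hq => by simpa [S] using hq.1
      refine ((N2.and hg h2).mono (by simpa using hsub 1)).imp ?_
      rintro y z ⟨h1, h2⟩
      simp only [Pi.add_apply, Pi.smul_apply, h1, h2, smul_eq_mul, if_true]
      ring
  · have key : ∀ q ∈ d.P, q.1 ∈ S 1 → q.1 ∈ S (-1) → g q = g' q - (v - u) * qn (-q.1) + u := by
      intro q hq h1 h2
      rcases lt_or_gt_of_ne (S_im h1 h2) with h | h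
      · have := hlc (-1) (Or.inr rfl) q ⟨by simp only [Hf, mem_setOf_eq]; linarith, hq.2⟩
        rw [← hv] at this
        rw [qn_pos (by simpa using h)]
        simp only [Pi.sub_apply] at this
        linear_combination this
      · have := hlc 1 (Or.inl rfl) q ⟨by simp only [Hf, mem_setOf_eq]; linarith, hq.2⟩
        rw [← hu] at this
        rw [qn_neg (by simpa using h)]
        simp only [Pi.sub_apply] at this
        linear_combination this
    rintro (_ | _) (_ | _) q hq h1 h2
    · rfl
    · simpa using (key q hq (by simpa using h2) (by simpa using h1)).symm
    · simpa using (key q hq (by simpa using h1) (by simpa using h2))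
    · rfl

theorem σσ {i j : κ} (hij : i ≠ j) : N3 (Z ×ˢ d.D) fun y z t => d.σ (K := K) i y z * d.σ j z t = 0 := by
  have hρ := d.hρ
  refine N3.iUnion (ι := Bool) (O := fun b => {q : ℂ × ℂ | -Complex.I * (q.2 - d.c (if b then i else j)) ∈ Complex.slitPlane})
    ?_ ?_ ?_
  · exact fun b => Complex.isOpen_slitPlane.preimage (by fun_prop)
  · intro q hq
    by_contra hc
    push Not at hc
    have h1 := hc true
    have h2 := hc false
    simp only [mem_setOf_eq, Complex.mem_slitPlane_iff] at h1 h2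
    push Not at h1 h2
    have e1 := h1.2
    have e2 := h2.2
    simp at e1 e2
    have h3 := d.hsep i j hij
    rw [show d.c i - d.c j = 0 by linarith, abs_zero] at h3
    linarith
  · rintro (_ | _)
    · refine (N2.N3 (cls_slit (K := K) (d.f_cont j _) (W := Z ×ˢ d.D ∩ {q : ℂ × ℂ | -Complex.I * (q.2 - d.c (if false then i else j)) ∈ Complex.slitPlane})
        fun q hq => by simpa using hq.2)).imp ?_
      rintro y z t ⟨_, h, _⟩
      change _ * cls _ _ _ = _
      rw [h, mul_zero]
    · refine (N2.N3 (cls_slit (K := K) (d.f_cont i _) (W := Z ×ˢ d.D ∩ {q : ℂ × ℂ | -Complex.I * (q.2 - d.c (if true then i else j)) ∈ Complex.slitPlane})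
        fun q hq => by simpa using hq.2)).imp ?_
      rintro y z t ⟨h, _, _⟩
      change cls _ _ _ * _ = _
      rw [h, zero_mul]

theorem rel_self {E : Type*} [TopologicalSpace E] {W : Set E} (h2 : (2:K) ≠ 0) {s : E → E → K} (hs : Coc W s) (h h' : K) :
    Rel W (h • s) (h' • s) := by
  refine ⟨fun y z => h * h' * s y z ^ 2 / 2, N3.imp hs ?_⟩
  intro y z t e
  simp only [Pi.smul_apply, smul_eq_mul, e]
  field_simp
  ring

theorem pieceRel (h2 : (2:K) ≠ 0) {h h' : K} {x x' : κ → K} (hx : ∀ i, h * x' i = h' * x i) :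
    Rel d.P (h • τ (K := K) + ∑ i, x i • d.σ (K := K) i) (h' • τ (K := K) + ∑ i, x' i • d.σ (K := K) i) := by
  classical
  have hτ : Coc d.P (τ (K := K)) := τ_coc fun q hq => hq.1
  have hσ : ∀ i, Coc d.P (d.σ (K := K) i) := fun i => d.σ_coc i
  by_cases h0 : h = 0 ∧ h' = 0
  · obtain ⟨rfl, rfl⟩ := h0
    simp only [zero_smul, zero_add]
    refine ⟨fun y z => ∑ i, x i * x' i * d.σ i y z ^ 2 / 2, ?_⟩
    have h3 : N3 d.P fun y z t => ∀ i j, i ≠ j → d.σ (K := K) i y z * d.σ j z t = 0 :=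
      N3.all fun i => N3.all fun j => by
        by_cases hij : i = j
        · exact N3.of_forall fun _ _ _ _ _ _ h => absurd hij h
        · exact (d.σσ hij).imp fun y z t h _ => h
    refine (N3.and (N3.all hσ) h3).imp ?_
    rintro y z t ⟨h4, h5⟩
    have : (∑ i, x i • d.σ i) y z * (∑ i, x' i • d.σ i) z t = ∑ i, x i * x' i * (d.σ (K := K) i y z * d.σ i z t) := by
      simp only [Finset.sum_apply, Pi.smul_apply, smul_eq_mul, Finset.sum_mul_sum]
      refine Finset.sum_congr rfl fun i _ => ?_
      rw [Finset.sum_eq_single i]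
      · ring
      · intro j _ hj
        linear_combination x i * x' j * h5 i j (Ne.symm hj)
      · simp
    rw [this, ← Finset.sum_add_distrib, ← Finset.sum_add_distrib]
    refine Finset.sum_congr rfl fun i _ => ?_
    rw [h4 i]
    field_simp
    ring
  · obtain ⟨r, hr, hr'⟩ : ∃ r : κ → K, (∀ i, x i = h * r i) ∧ ∀ i, x' i = h' * r i := by
      by_cases hh : h = 0
      · have hh' : h' ≠ 0 := fun e => h0 ⟨hh, e⟩
        refine ⟨fun i => x' i / h', fun i => ?_, fun i => by field_simp⟩
        have := hx i
        rw [hh, zero_mul] at this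
        rw [hh, zero_mul]
        exact (mul_eq_zero.1 this.symm).resolve_left hh'
      · refine ⟨fun i => x i / h, fun i => by field_simp, fun i => ?_⟩
        have := hx i
        field_simp
        linear_combination this
    have := rel_self (W := d.P) h2 (s := τ + ∑ i, r i • d.σ i)
      (hτ.add (Coc.sum _ fun i _ => (hσ i).smul (r i))) h h'
    simp only [smul_add, Finset.smul_sum, smul_smul] at this
    simpa only [hr, hr'] using this

end Dat
end TA
end Part_4

section Part_5
set_option linter.all false
open Filter Topology Set

namespace TA

theorem Eqv.to_sub {E K : Type*} [TopologicalSpace E] [Field K] {W : Set E} {a b : E → E → K} (h : Eqv W a b) :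
    Eqv W (a - b) 0 := by
  have := h.sub (Eqv.refl W b)
  simpa using this

namespace Dat
variable {κ : Type} [Fintype κ] (d : Dat κ) {K : Type*} [Field K] {Z : Set ℂ} {z0 : ℂ}

theorem torus (h2 : (2:K) ≠ 0) {h h' : K} {x x' : κ → K}
    (hr : Rel d.P (h • τ (K := K) + ∑ i, x i • d.σ (K := K) i) (h' • τ (K := K) + ∑ i, x' i • d.σ (K := K) i)) (i : κ) :
    h * x' i = h' * x i := by
  classical
  obtain ⟨c, hc⟩ := hr
  have hτ : Coc d.P (τ (K := K)) := τ_coc fun q hq => hq.1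
  have hσ : ∀ i, Coc d.P (d.σ (K := K) i) := fun i => d.σ_coc i
  set A := ∑ i, x i • d.σ (K := K) i with hA
  set B := ∑ i, x' i • d.σ (K := K) i with hB
  have hAc : Coc d.P A := Coc.sum _ fun i _ => (hσ i).smul _
  have hBc : Coc d.P B := Coc.sum _ fun i _ => (hσ i).smul _
  set G : ℂ × ℂ → ℂ × ℂ → K := h • B - h' • A with hG
  have hGc : Coc d.P G := (hBc.smul _).sub (hAc.smul _)
  have hAB : N3 d.P fun y z t => A y z * B z t = ∑ i, x i * x' i * (d.σ (K := K) i y z * d.σ i z t) := by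
    have h3 : N3 d.P fun y z t => ∀ i j, i ≠ j → d.σ (K := K) i y z * d.σ j z t = 0 :=
      N3.all fun i => N3.all fun j => by
        by_cases hij : i = j
        · exact N3.of_forall fun _ _ _ _ _ _ h => absurd hij h
        · exact (d.σσ hij).imp fun y z t h _ => h
    refine h3.imp fun y z t h5 => ?_
    simp only [hA, hB, Finset.sum_apply, Pi.smul_apply, smul_eq_mul, Finset.sum_mul_sum]
    refine Finset.sum_congr rfl fun i _ => ?_
    rw [Finset.sum_eq_single i]
    · ring
    · intro j _ hj
      linear_combination x i * x' j * h5 i j (Ne.symm hj)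
    · simp
  set c1 : ℂ × ℂ → ℂ × ℂ → K := fun y z => c y z - h * h' * τ y z ^ 2 / 2 -
    (∑ i, x i * x' i * d.σ i y z ^ 2 / 2) - h' * (τ y z * A y z) with hc1
  have key : N3 d.P fun y z t => c1 y t = c1 y z + c1 z t + τ y z * G z t := by
    refine (((N3.and hc hτ).and (N3.all hσ)).and (N3.and hAc hAB)).imp ?_
    rintro y z t ⟨⟨⟨e1, e2⟩, e3⟩, e4, e5⟩
    have e6 : (∑ i, x i * x' i * d.σ (K := K) i y t ^ 2 / 2) = (∑ i, x i * x' i * d.σ i y z ^ 2 / 2) +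
        (∑ i, x i * x' i * d.σ i z t ^ 2 / 2) + A y z * B z t := by
      rw [e5, ← Finset.sum_add_distrib, ← Finset.sum_add_distrib]
      refine Finset.sum_congr rfl fun i _ => ?_
      rw [e3 i]
      field_simp
      ring
    simp only [hc1, hG]
    rw [e6, e1, e2, e4]
    simp only [Pi.add_apply, Pi.sub_apply, Pi.smul_apply, smul_eq_mul]
    field_simp
    ring
  have hs : ∀ e, S e ×ˢ d.D ⊆ d.P := fun e => prod_mono (fun z hz => S_ne hz) le_rfl
  have hH : ∀ e e', (e = 1 ∨ e = -1) → (e' = 1 ∨ e' = -1) → Hf e ×ˢ d.D ⊆ S e' ×ˢ d.D := fun e e' he he' =>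
      prod_mono (fun z hz => Hf_S he he' hz) le_rfl
  have cc1 : Coc (S 1 ×ˢ d.D) c1 := by
    have h2 : N2 (S 1 ×ˢ d.D) fun y z => τ (K := K) y z = 0 :=
      cls_slit (f := fun q : ℂ × ℂ => q.1) (by fun_prop) fun q hq => by simpa [S] using hq.1
    refine (N3.and (key.mono (hs 1)) h2.N3).imp ?_
    rintro y z t ⟨e1, e2, _⟩
    rw [e1, e2, zero_mul, add_zero]
  set c2 : ℂ × ℂ → ℂ × ℂ → K := fun y z => c1 y z + qn (-y.1) * G y z with hc2
  have cc2 : Coc (S (-1) ×ˢ d.D) c2 := by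
    have h2 : N2 (S (-1) ×ˢ d.D) fun y z => τ (K := K) y z = _ :=
      cls_neg_slit (f := fun q : ℂ × ℂ => q.1) (by fun_prop) fun q hq => by simpa [S] using hq.1
    refine (N3.and ((key.and hGc).mono (hs (-1))) h2.N3).imp ?_
    rintro y z t ⟨⟨e1, e3⟩, e2, _⟩
    simp only [Pi.zero_apply, zero_add] at e2
    simp only [hc2]
    rw [e1, e2, e3]
    ring
  obtain ⟨q, hq⟩ := d.T1 (S_star (Or.inl rfl)) (S_self (Or.inl rfl)) cc1
  obtain ⟨q', hq'⟩ := d.T1 (S_star (Or.inr rfl)) (S_self (Or.inr rfl)) cc2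
  have E1 : Eqv (Hf 1 ×ˢ d.D) c1 c2 := Eqv.of_N2 (N2.of_forall fun y hy z hz => by
    have : 0 < y.1.im := by simpa [Hf] using hy.1
    simp only [hc2]; rw [qn_neg (by simpa using this)]; ring)
  have E2 : Eqv (Hf (-1) ×ˢ d.D) (c1 - c2) G := Eqv.of_N2 (N2.of_forall fun y hy z hz => by
    have : y.1.im < 0 := by simpa [Hf] using hy.1
    simp only [hc2, Pi.sub_apply]; rw [qn_pos (by simpa using this)]; ring)
  have hqq : ∀ i, q i - q' i = 0 := by
    have h1 := ((hq.mono (hH 1 1 (Or.inl rfl) (Or.inl rfl))).symm.trans E1).trans (hq'.mono (hH 1 (-1) (Or.inl rfl) (Or.inr rfl)))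
    have h1 := h1.to_sub
    rw [← Finset.sum_sub_distrib] at h1
    simp only [← sub_smul] at h1
    exact d.uniqσ (Hf_self (Or.inl rfl)) (h := 0) (k := fun i => q i - q' i) (by simpa using h1)
  have hqe : q' = q := by funext i; linear_combination -hqq i
  subst hqe
  have h3 := ((hq.mono (hH (-1) 1 (Or.inr rfl) (Or.inl rfl))).sub (hq'.mono (hH (-1) (-1) (Or.inr rfl) (Or.inr rfl)))).symm.trans E2
  rw [sub_self] at h3
  have h4 : G = ∑ i, (h * x' i - h' * x i) • d.σ (K := K) i := by
    simp only [hG, hA, hB, Finset.smul_sum, ← Finset.sum_sub_distrib, sub_smul, smul_smul]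
  rw [h4] at h3
  have := d.uniqσ (Hf_self (Or.inr rfl)) (h := 0) (k := fun i => h * x' i - h' * x i) (by simpa using h3.symm) i
  exact sub_eq_zero.1 this

end Dat
end TA
end Part_5

section Part_6
set_option linter.all false
open Filter Topology Set

namespace TA
open Dat (τ)

structure Piece {κ : Type} [Fintype κ] {K : Type*} [Field K] (W : Set (ℂ × ℂ)) (B : κ → ℂ × ℂ → ℂ × ℂ → K) : Prop where
  op : IsOpen W
  tc : Coc W (τ (K := K))
  bc : ∀ i, Coc W (B i)
  T2 : ∀ a, Coc W a → ∃ (h : K) (k : κ → K), Eqv W a (h • τ + ∑ i, k i • B i)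
  uniq : ∀ (h : K) (k : κ → K), Eqv W (h • τ + ∑ i, k i • B i) 0 → h = 0 ∧ ∀ i, k i = 0
  lc : ∀ l : ℂ × ℂ → K, LC W l → ∀ q ∈ W, ∀ q' ∈ W, l q = l q'
  relI : ∀ (h h' : K) (x x' : κ → K), (∀ i, h * x' i = h' * x i) →
    Rel W (h • τ + ∑ i, x i • B i) (h' • τ + ∑ i, x' i • B i)
  relE : ∀ (h h' : K) (x x' : κ → K), Rel W (h • τ + ∑ i, x i • B i) (h' • τ + ∑ i, x' i • B i) →
    ∀ i, h * x' i = h' * x i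

structure Chart where
  Φ : ℂ × ℂ → ℂ × ℂ
  Ψ : ℂ × ℂ → ℂ × ℂ
  f1 : ∀ q, (Φ q).1 = q.1
  f2 : ∀ q, (Ψ q).1 = q.1
  c1 : ContinuousOn Φ {q | q.1 ≠ 0}
  c2 : ContinuousOn Ψ {q | q.1 ≠ 0}
  i1 : ∀ q, q.1 ≠ 0 → Ψ (Φ q) = q
  i2 : ∀ q, q.1 ≠ 0 → Φ (Ψ q) = q

namespace Chart
variable (C : Chart) {κ : Type} [Fintype κ] (d : Dat κ) {K : Type*} [Field K]

def W : Set (ℂ × ℂ) := {q | q.1 ≠ 0 ∧ (C.Φ q).2 ∈ d.D}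

theorem isOpen_W : IsOpen (C.W d) := by
  have h : IsOpen {q : ℂ × ℂ | q.1 ≠ 0} := isOpen_ne.preimage continuous_fst
  have := C.c1.isOpen_inter_preimage h (d.isOpen_D.preimage continuous_snd)
  exact this

theorem Φ_cont : ContinuousOn C.Φ (C.W d) := C.c1.mono fun q hq => hq.1
theorem Ψ_cont : ContinuousOn C.Ψ d.P := C.c2.mono fun q hq => hq.1
theorem Φ_maps : MapsTo C.Φ (C.W d) d.P := fun q hq => ⟨by rw [C.f1]; exact hq.1, hq.2⟩
theorem Ψ_maps : MapsTo C.Ψ d.P (C.W d) := fun q hq => ⟨by rw [C.f2]; exact hq.1, by rw [C.i2 q hq.1]; exact hq.2⟩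

theorem pbΦτ : pb C.Φ (τ (K := K)) = τ := by
  simp only [τ, pb_cls, C.f1]
theorem pbΨτ : pb C.Ψ (τ (K := K)) = τ := by
  simp only [τ, pb_cls, C.f2]

theorem pbΨΦ (a : ℂ × ℂ → ℂ × ℂ → K) : Eqv d.P (pb C.Ψ (pb C.Φ a)) a :=
  Eqv.of_N2 (N2.of_forall fun y hy z hz => by simp only [pb]; rw [C.i2 y hy.1, C.i2 z hz.1])
theorem pbΦΨ (a : ℂ × ℂ → ℂ × ℂ → K) : Eqv (C.W d) (pb C.Φ (pb C.Ψ a)) a :=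
  Eqv.of_N2 (N2.of_forall fun y hy z hz => by simp only [pb]; rw [C.i1 y hy.1, C.i1 z hz.1])

theorem piece (h2 : (2:K) ≠ 0) {B : κ → ℂ × ℂ → ℂ × ℂ → K} (hB : ∀ i, Eqv (C.W d) (pb C.Φ (d.σ i)) (B i))
    (hBc : ∀ i, Coc (C.W d) (B i)) : Piece (C.W d) B := by
  have hτ : Coc d.P (τ (K := K)) := Dat.τ_coc fun q hq => hq.1
  have hτ' : Coc (C.W d) (τ (K := K)) := Dat.τ_coc fun q hq => hq.1
  have hσ : ∀ i, Coc d.P (d.σ (K := K) i) := fun i => d.σ_coc i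
  have e1 : ∀ (h : K) (k : κ → K), Eqv (C.W d) (pb C.Φ (h • τ + ∑ i, k i • d.σ i)) (h • τ + ∑ i, k i • B i) := by
    intro h k
    rw [pb_add, pb_smul, pb_sum, C.pbΦτ]
    exact (Eqv.refl _ _).add (Eqv.sum _ fun i _ => (hB i).smul _)
  have e2 : ∀ (h : K) (k : κ → K), Eqv d.P (pb C.Ψ (h • τ + ∑ i, k i • B i)) (h • τ + ∑ i, k i • d.σ i) := by
    intro h k
    exact ((e1 h k).symm.pb (C.Ψ_cont d) (C.Ψ_maps d)).trans (C.pbΨΦ d _)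
  have cc : ∀ (h : K) (k : κ → K), Coc d.P (h • τ (K := K) + ∑ i, k i • d.σ i) := fun h k =>
    (hτ.smul h).add (Coc.sum _ fun i _ => (hσ i).smul _)
  have cc' : ∀ (h : K) (k : κ → K), Coc (C.W d) (h • τ (K := K) + ∑ i, k i • B i) := fun h k =>
    (hτ'.smul h).add (Coc.sum _ fun i _ => (hBc i).smul _)
  refine ⟨C.isOpen_W d, hτ', hBc, ?_, ?_, ?_, ?_, ?_⟩
  · intro a ha
    obtain ⟨h, k, hk⟩ := d.T2 (ha.pb (C.Ψ_cont d) (C.Ψ_maps d))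
    exact ⟨h, k, ((C.pbΦΨ d a).symm.trans (hk.pb (C.Φ_cont d) (C.Φ_maps d))).trans (e1 h k)⟩
  · intro h k hk
    have := hk.pb (C.Ψ_cont d) (C.Ψ_maps d)
    exact d.uniq ((e2 h k).symm.trans this)
  · intro l hl q hq q' hq'
    have h3 : LC d.P (l ∘ C.Ψ) := N2.comap hl (C.Ψ_cont d) (C.Ψ_maps d)
    have := d.lc_P h3 (C.Φ_maps d hq) (C.Φ_maps d hq')
    simpa [C.i1 q hq.1, C.i1 q' hq'.1] using this
  · intro h h' x x' hx
    have h3 := (d.pieceRel h2 hx).pb (C.Φ_cont d) (C.Φ_maps d)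
    exact h3.of_eqv ((cc _ _).pb (C.Φ_cont d) (C.Φ_maps d)) ((cc _ _).pb (C.Φ_cont d) (C.Φ_maps d)) (e1 _ _) (e1 _ _)
  · intro h h' x x' hr
    have h3 := hr.pb (C.Ψ_cont d) (C.Ψ_maps d)
    exact d.torus h2 (h3.of_eqv ((cc' _ _).pb (C.Ψ_cont d) (C.Ψ_maps d)) ((cc' _ _).pb (C.Ψ_cont d) (C.Ψ_maps d)) (e2 _ _) (e2 _ _))

end Chart

noncomputable def ch0 : Chart where
  Φ q := (q.1, q.2 / q.1)
  Ψ q := (q.1, q.2 * q.1)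
  f1 _ := rfl
  f2 _ := rfl
  c1 := continuousOn_fst.prodMk (continuousOn_snd.div continuousOn_fst fun q hq => hq)
  c2 := by fun_prop
  i1 q hq := by ext <;> simp [hq]
  i2 q hq := by ext <;> simp [hq]

noncomputable def chj (c : ℝ) : Chart where
  Φ q := (q.1, (q.2 - c * q.1) / (starRingEnd ℂ) q.1)
  Ψ q := (q.1, c * q.1 + q.2 * (starRingEnd ℂ) q.1)
  f1 _ := rfl
  f2 _ := rfl
  c1 := continuousOn_fst.prodMk (ContinuousOn.div (by fun_prop) (by
    exact (Complex.continuous_conj.comp continuous_fst).continuousOn) fun q hq => by simpa using hq)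
  c2 := by
    refine Continuous.continuousOn ?_
    have := Complex.continuous_conj.comp (continuous_fst (X := ℂ) (Y := ℂ))
    exact continuous_fst.prodMk ((by fun_prop : Continuous fun q : ℂ × ℂ => (c:ℂ) * q.1).add (continuous_snd.mul this))
  i1 q hq := by
    have : (starRingEnd ℂ) q.1 ≠ 0 := by simpa using hq
    apply Prod.ext
    · rfl
    · simp only [div_mul_cancel₀ _ this]; ring
  i2 q hq := by
    have : (starRingEnd ℂ) q.1 ≠ 0 := by simpa using hq
    apply Prod.ext
    · rfl
    · simp only [add_sub_cancel_left, mul_div_cancel_right₀ _ this]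

end TA
end Part_6

section Part_7
set_option linter.all false
open Filter Topology Set

namespace TA
open Dat (τ)

section geo
variable {m r : ℕ} (b : Fin m → Fin r)

def LL (m : ℕ) : ℝ := m + 2
def CC (m : ℕ) (j : Fin r) : ℝ := 10 * LL m * (j : ℕ)

theorem LL_ge : 2 ≤ LL m := by unfold LL; linarith [(Nat.cast_nonneg m : (0:ℝ) ≤ m)]
theorem dd_nonneg (i : Fin m) : (0:ℝ) ≤ (i : ℕ) := Nat.cast_nonneg _
theorem dd_lt (i : Fin m) : ((i : ℕ) : ℝ) + 2 < LL m := by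
  unfold LL
  have : ((i : ℕ) : ℝ) < m := by exact_mod_cast i.2
  linarith
theorem CC_nonneg (j : Fin r) : 0 ≤ CC m j := by
  unfold CC; have := LL_ge (m := m); positivity
theorem CC_sep {j j' : Fin r} (h : j ≠ j') : 10 * LL m ≤ |CC m j - CC m j'| := by
  unfold CC
  have h1 := LL_ge (m := m)
  rw [← mul_sub, abs_mul, abs_of_nonneg (by linarith)]
  have : (1:ℝ) ≤ |((j:ℕ):ℝ) - ((j':ℕ):ℝ)| := by
    have h2 : ((j:ℕ):ℤ) - ((j':ℕ):ℤ) ≠ 0 := by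
      intro h0; apply h; ext; omega
    have := Int.one_le_abs h2
    exact_mod_cast this
  nlinarith

theorem nrm (ζ : ℂ) (c : ℝ) : (ζ.re - c) ^ 2 + ζ.im ^ 2 = ‖ζ - c‖ ^ 2 := by
  rw [Complex.sq_norm, Complex.normSq_apply]; simp; ring

theorem nrm_lt {ζ : ℂ} {c ρ : ℝ} (hρ : 0 ≤ ρ) : ρ ^ 2 < (ζ.re - c) ^ 2 + ζ.im ^ 2 ↔ ρ < ‖ζ - c‖ := by
  rw [nrm, sq_lt_sq₀ hρ (norm_nonneg _)]

noncomputable def d0 (m r : ℕ) : Dat (Fin r) where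
  I := univ
  ρ := LL m
  c := CC m
  hI := isOpen_univ
  hconv := convex_univ
  hρ := by linarith [LL_ge (m := m)]
  h0 := subset_univ _
  hc _ := subset_univ _
  hsep i j h := by linarith [LL_ge (m := m), CC_sep (m := m) h]
  x0 := -(LL m + 1)
  hx0 := mem_univ _
  hx0' i := by
    rw [abs_of_nonpos] <;> linarith [LL_ge (m := m), CC_nonneg (m := m) i]

noncomputable def dN (j : Fin r) : Dat {i // b i = j} where
  I := Ioo (-(2 * LL m)) (2 * LL m)
  ρ := 0
  c i := ((i.1 : ℕ) : ℝ)
  hI := isOpen_Ioo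
  hconv := convex_Ioo _ _
  hρ := le_rfl
  h0 := by
    rintro x ⟨h1, h2⟩
    constructor <;> linarith [LL_ge (m := m)]
  hc i := by
    rintro x ⟨h1, h2⟩
    constructor <;> linarith [LL_ge (m := m), dd_nonneg i.1, dd_lt i.1]
  hsep i j h := by
    have h2 : ((i.1:ℕ):ℤ) - ((j.1:ℕ):ℤ) ≠ 0 := by
      intro h0; apply h; ext; omega
    have := Int.one_le_abs h2
    rw [mul_zero, zero_add]
    exact_mod_cast this
  x0 := -1
  hx0 := by constructor <;> linarith [LL_ge (m := m)]
  hx0' i := by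
    rw [abs_of_nonpos] <;> linarith [dd_nonneg i.1]

noncomputable def dT (m : ℕ) : Dat Unit where
  I := Ioo (-(2 * LL m)) (2 * LL m)
  ρ := LL m
  c _ := 0
  hI := isOpen_Ioo
  hconv := convex_Ioo _ _
  hρ := by linarith [LL_ge (m := m)]
  h0 := by
    rintro x ⟨h1, h2⟩
    constructor <;> linarith [LL_ge (m := m)]
  hc i := by
    rintro x ⟨h1, h2⟩
    constructor <;> linarith [LL_ge (m := m)]
  hsep i j h := absurd rfl h
  x0 := LL m + 1
  hx0 := by constructor <;> linarith [LL_ge (m := m)]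
  hx0' i := by
    rw [abs_of_nonneg] <;> linarith [LL_ge (m := m)]

/-- the complement -/
def X : Set (ℂ × ℂ) := {q | q.1 ≠ 0 ∧ ∀ i, q.2 - CC m (b i) * q.1 - (i : ℕ) * (starRingEnd ℂ) q.1 ≠ 0}

noncomputable def zt (m : ℕ) (j : Fin r) (q : ℂ × ℂ) : ℂ := (q.2 - CC m j * q.1) / (starRingEnd ℂ) q.1
noncomputable def vv (m : ℕ) (j : Fin r) (q : ℂ × ℂ) : ℂ := q.2 / q.1 - CC m j

def X0 (m r : ℕ) : Set (ℂ × ℂ) := ch0.W (d0 m r)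
def Nn (j : Fin r) : Set (ℂ × ℂ) := (chj (CC m j)).W (dN b j)
def Tt (m : ℕ) (j : Fin r) : Set (ℂ × ℂ) := (chj (CC m j)).W (dT m)

theorem vv_eq {q : ℂ × ℂ} (hq : q.1 ≠ 0) (j : Fin r) : vv m j q = zt m j q * ((starRingEnd ℂ) q.1 / q.1) := by
  have : (starRingEnd ℂ) q.1 ≠ 0 := by simpa using hq
  unfold vv zt; field_simp

theorem nvv {q : ℂ × ℂ} (hq : q.1 ≠ 0) (j : Fin r) : ‖zt m j q‖ = ‖vv m j q‖ := by
  rw [vv_eq hq, norm_mul, norm_div, Complex.norm_conj, div_self (by simpa using hq), mul_one]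

theorem vv_sep (q : ℂ × ℂ) {j j' : Fin r} (h : j ≠ j') : 10 * LL m ≤ ‖vv m j q‖ + ‖vv m j' q‖ := by
  have h1 := CC_sep (m := m) h
  have h2 : ‖vv m j' q - vv m j q‖ = |CC m j - CC m j'| := by
    unfold vv
    rw [show q.2 / q.1 - (CC m j' : ℂ) - (q.2 / q.1 - CC m j) = ((CC m j - CC m j' : ℝ) : ℂ) by push_cast; ring,
      Complex.norm_real, Real.norm_eq_abs]
  have := norm_sub_le (vv m j' q) (vv m j q)
  linarith

theorem mem_X0 {q : ℂ × ℂ} : q ∈ X0 m r ↔ q.1 ≠ 0 ∧ ∀ j : Fin r, LL m < ‖vv m j q‖ := by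
  have hL := LL_ge (m := m)
  simp only [X0, Chart.W, Dat.D, d0, ch0, mem_setOf_eq, mem_univ, true_and, vv, nrm_lt (by linarith : 0 ≤ LL m)]

theorem box {ζ : ℂ} (h : ζ.re ∈ Ioo (-(2 * LL m)) (2 * LL m)) (h' : ζ.im ∈ Ioo (-(2 * LL m)) (2 * LL m)) :
    ‖ζ‖ < 3 * LL m := by
  have hL := LL_ge (m := m)
  have : ‖ζ‖ ^ 2 < (3 * LL m) ^ 2 := by
    rw [Complex.sq_norm, Complex.normSq_apply]
    nlinarith [h.1, h.2, h'.1, h'.2]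
  exact lt_of_pow_lt_pow_left₀ 2 (by linarith) this

theorem box' {ζ : ℂ} (h : ‖ζ‖ < 2 * LL m) : ζ.re ∈ Ioo (-(2 * LL m)) (2 * LL m) ∧ ζ.im ∈ Ioo (-(2 * LL m)) (2 * LL m) :=
  ⟨abs_lt.1 ((Complex.abs_re_le_norm ζ).trans_lt h), abs_lt.1 ((Complex.abs_im_le_norm ζ).trans_lt h)⟩

def Bx (m : ℕ) (ζ : ℂ) : Prop := ζ.re ∈ Ioo (-(2 * LL m)) (2 * LL m) ∧ ζ.im ∈ Ioo (-(2 * LL m)) (2 * LL m)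

theorem mem_N {q : ℂ × ℂ} {j : Fin r} : q ∈ Nn b j ↔ q.1 ≠ 0 ∧ Bx m (zt m j q) ∧ ∀ i, b i = j → zt m j q ≠ (i : ℕ) := by
  simp only [Nn, Chart.W, Dat.D, dN, chj, mem_setOf_eq, Bx, nrm_lt (le_refl (0:ℝ)), norm_pos_iff, sub_ne_zero,
    Subtype.forall, and_assoc]
  rfl

theorem mem_T {q : ℂ × ℂ} {j : Fin r} : q ∈ Tt m j ↔ q.1 ≠ 0 ∧ Bx m (zt m j q) ∧ LL m < ‖zt m j q‖ := by
  have hL := LL_ge (m := m)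
  simp only [Tt, Chart.W, Dat.D, dT, chj, mem_setOf_eq, Bx, nrm_lt (by linarith : 0 ≤ LL m), and_assoc, forall_const]
  simp only [Complex.ofReal_zero, sub_zero]
  rfl

theorem N_lt {q : ℂ × ℂ} (hq : q.1 ≠ 0) {j : Fin r} (h : Bx m (zt m j q)) : ‖vv m j q‖ < 3 * LL m := by
  rw [← nvv hq]; exact box h.1 h.2

theorem other {q : ℂ × ℂ} {j j' : Fin r} (hj : j ≠ j') (hq : q.1 ≠ 0) (h : Bx m (zt m j q)) : 7 * LL m < ‖vv m j' q‖ := by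
  linarith [N_lt hq h, vv_sep (m := m) q hj]

theorem T_eq (j : Fin r) : X0 m r ∩ Nn b j = Tt m j := by
  have hL := LL_ge (m := m)
  ext q
  rw [mem_inter_iff, mem_X0, mem_N, mem_T]
  constructor
  · rintro ⟨⟨h1, h2⟩, _, h3, h4⟩
    exact ⟨h1, h3, by rw [nvv h1]; exact h2 j⟩
  · rintro ⟨h1, h2, h3⟩
    refine ⟨⟨h1, fun j' => ?_⟩, h1, h2, fun i _ he => ?_⟩
    · by_cases hj : j = j'
      · subst hj; rwa [← nvv h1]
      · linarith [other hj h1 h2]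
    · rw [he, Complex.norm_natCast] at h3
      linarith [dd_lt i]

theorem N_disj {j j' : Fin r} (h : j ≠ j') {q : ℂ × ℂ} (h1 : q ∈ Nn b j) (h2 : q ∈ Nn b j') : False := by
  rw [mem_N] at h1 h2
  have hL := LL_ge (m := m)
  linarith [other h h1.1 h1.2.1, N_lt h2.1 h2.2.1]

/-- `f_i` in terms of `vv` -/
theorem ff_eq {q : ℂ × ℂ} (hq : q.1 ≠ 0) (i : Fin m) (j : Fin r) : (q.2 - CC m j * q.1 - (i : ℕ) * (starRingEnd ℂ) q.1) / q.1 =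
    vv m j q - (i : ℕ) * ((starRingEnd ℂ) q.1 / q.1) := by
  unfold vv; field_simp

theorem cn {q : ℂ × ℂ} (hq : q.1 ≠ 0) (i : Fin m) : ‖((i : ℕ) : ℂ) * ((starRingEnd ℂ) q.1 / q.1)‖ = (i : ℕ) := by
  rw [norm_mul, norm_div, Complex.norm_conj, div_self (by simpa using hq), mul_one, Complex.norm_natCast]

theorem X0_sub : X0 m r ⊆ X b := by
  intro q hq
  rw [mem_X0] at hq
  refine ⟨hq.1, fun i h => ?_⟩
  have h1 := ff_eq hq.1 i (b i)
  rw [h, zero_div, eq_comm, sub_eq_zero] at h1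
  have h2 := hq.2 (b i)
  rw [h1, cn hq.1] at h2
  linarith [dd_lt i]

theorem N_sub (j : Fin r) : Nn b j ⊆ X b := by
  have hL := LL_ge (m := m)
  intro q hq
  rw [mem_N] at hq
  refine ⟨hq.1, fun i h => ?_⟩
  by_cases hj : b i = j
  · subst hj
    apply hq.2.2 i rfl
    have : (starRingEnd ℂ) q.1 ≠ 0 := by simpa using hq.1
    unfold zt
    rw [div_eq_iff this]
    linear_combination h
  · have h1 := ff_eq hq.1 i (b i)
    rw [h, zero_div, eq_comm, sub_eq_zero] at h1
    have h2 := other (Ne.symm hj) hq.1 hq.2.1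
    rw [h1, cn hq.1] at h2
    linarith [dd_lt i]

theorem X_cover {q : ℂ × ℂ} (hq : q ∈ X b) : q ∈ X0 m r ∨ ∃ j, q ∈ Nn b j ∧ ‖vv m j q‖ ≤ LL m := by
  have hL := LL_ge (m := m)
  by_cases h : q ∈ X0 m r
  · exact Or.inl h
  · right
    rw [mem_X0] at h
    push Not at h
    obtain ⟨j, hj⟩ := h hq.1
    refine ⟨j, ?_, hj⟩
    rw [mem_N]
    refine ⟨hq.1, box' (by rw [nvv hq.1]; linarith), fun i hi h => ?_⟩
    have : (starRingEnd ℂ) q.1 ≠ 0 := by simpa using hq.1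
    unfold zt at h
    rw [div_eq_iff this] at h
    apply hq.2 i
    rw [hi]
    linear_combination h

end geo
end TA
end Part_7

section Part_8
set_option linter.all false
open Filter Topology Set

namespace TA
open Dat (τ)

theorem cls_pert {E : Type*} [TopologicalSpace E] {K : Type*} [Field K] {W : Set E} {f g : E → ℂ} (hf : ContinuousOn f W)
    (hg : ContinuousOn g W) (h : ∀ x ∈ W, ‖f x - g x‖ < ‖g x‖) : Eqv W (cls (K := K) f) (cls g) := by
  have hn : ∀ x ∈ W, g x ≠ 0 := fun x hx h0 => by
    have := h x hx
    rw [h0, norm_zero] at this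
    exact absurd this (not_lt.2 (norm_nonneg _))
  refine cls_close hf hg hn fun x hx => ?_
  left
  have h1 : f x / g x = 1 + (f x - g x) / g x := by field_simp [hn x hx]; ring
  have h2 : ‖(f x - g x) / g x‖ < 1 := by
    rw [norm_div, div_lt_one (norm_pos_iff.2 (hn x hx))]; exact h x hx
  have h3 := (abs_lt.1 ((Complex.abs_re_le_norm _).trans_lt h2)).1
  rw [h1, Complex.add_re, Complex.one_re]; linarith

section cl
variable {m r : ℕ} (b : Fin m → Fin r) (K : Type*) [Field K]

noncomputable def ff (i : Fin m) (q : ℂ × ℂ) : ℂ := (q.2 - CC m (b i) * q.1 - (i : ℕ) * (starRingEnd ℂ) q.1) / q.1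
noncomputable def ss (i : Fin m) : ℂ × ℂ → ℂ × ℂ → K := cls (ff b i)
noncomputable def Aa (m : ℕ) (j : Fin r) : ℂ × ℂ → ℂ × ℂ → K := cls (vv m j)
noncomputable def Bb (m : ℕ) (j : Fin r) (i : Fin m) : ℂ × ℂ → ℂ × ℂ → K := cls fun q => zt m j q - (i : ℕ)
noncomputable def Zz (m : ℕ) (j : Fin r) : ℂ × ℂ → ℂ × ℂ → K := cls (zt m j)

theorem U_conj : Continuous fun q : ℂ × ℂ => (starRingEnd ℂ) q.1 := Complex.continuous_conj.comp continuous_fst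

theorem ff_cont {W : Set (ℂ × ℂ)} (hW : ∀ q ∈ W, q.1 ≠ 0) (i : Fin m) : ContinuousOn (ff b i) W := by
  have := U_conj
  exact ContinuousOn.div (by fun_prop) (by fun_prop) hW
theorem vv_cont {W : Set (ℂ × ℂ)} (hW : ∀ q ∈ W, q.1 ≠ 0) (j : Fin r) : ContinuousOn (vv m j) W :=
  (continuousOn_snd.div continuousOn_fst hW).sub continuousOn_const
theorem zt_cont {W : Set (ℂ × ℂ)} (hW : ∀ q ∈ W, q.1 ≠ 0) (j : Fin r) : ContinuousOn (zt m j) W := by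
  have := U_conj
  exact ContinuousOn.div (by fun_prop) (by fun_prop) fun q hq => by simpa using hW q hq

theorem ss_coc (i : Fin m) : Coc (X b) (ss b K i) :=
  cls_coc (ff_cont b (fun q hq => hq.1) i) fun q hq => div_ne_zero (hq.2 i) hq.1

theorem tau_coc : Coc (X b) (τ (K := K)) := Dat.τ_coc fun q hq => hq.1

variable {K}
/-- multiplication by `conj z / z` -/
theorem cls_cz {W : Set (ℂ × ℂ)} (hW : ∀ q ∈ W, q.1 ≠ 0) {f : ℂ × ℂ → ℂ} (hf : ContinuousOn f W) (h0 : ∀ q ∈ W, f q ≠ 0) :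
    Eqv W (cls (K := K) fun q => f q * ((starRingEnd ℂ) q.1 / q.1)) (cls f - (2:K) • τ) := by
  have hc := U_conj
  have h1 := cls_mul (K := K) (W := W) (f := f) (g := fun q : ℂ × ℂ => (starRingEnd ℂ) q.1 / q.1) hf h0
    (ContinuousOn.div (by fun_prop) (by fun_prop) hW) (fun q hq => div_ne_zero (by simpa using hW q hq) (hW q hq))
  have h2 := cls_mul (K := K) (W := W) (f := fun q : ℂ × ℂ => (starRingEnd ℂ) q.1) (g := fun q => (q.1)⁻¹)
    (by fun_prop) (fun q hq => by simpa using hW q hq) (continuousOn_fst.inv₀ hW) (fun q hq => inv_ne_zero (hW q hq))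
  have h3 := cls_conj (K := K) (W := W) (f := fun q : ℂ × ℂ => q.1) (by fun_prop) hW
  have h4 := cls_inv (K := K) (W := W) (f := fun q : ℂ × ℂ => q.1) (by fun_prop) hW
  have h5 := h1.trans ((Eqv.refl W (cls f)).add (h2.trans (h3.add h4)))
  convert h5 using 1
  rw [two_smul, sub_eq_add_neg, neg_add]; rfl

theorem F1 (i : Fin m) : Eqv (X0 m r) (ss b K i) (Aa K m (b i)) := by
  have hW : ∀ q ∈ X0 m r, q.1 ≠ 0 := fun q hq => hq.1
  refine cls_pert (ff_cont b hW i) (vv_cont hW _) fun q hq => ?_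
  unfold ff
  rw [ff_eq hq.1, sub_sub_cancel_left, norm_neg, cn hq.1]
  linarith [(mem_X0.1 hq).2 (b i), dd_lt i]

theorem N_ne {j : Fin r} : ∀ q ∈ Nn b j, q.1 ≠ 0 := fun q hq => hq.1
theorem T_ne {j : Fin r} : ∀ q ∈ Tt m j, q.1 ≠ 0 := fun q hq => hq.1

theorem F2 {i : Fin m} {j : Fin r} (h : b i = j) : Eqv (Nn b j) (ss b K i) (Bb K m j i - (2:K) • τ) := by
  subst h
  have := cls_cz (K := K) (W := Nn b (b i)) (N_ne b) (f := fun q => zt m (b i) q - (i : ℕ))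
    ((zt_cont (N_ne b) _).sub continuousOn_const) (fun q hq => sub_ne_zero.2 (((mem_N b).1 hq).2.2 i rfl))
  refine Eqv.trans (Eqv.of_N2 (N2.of_forall fun y hy z hz => ?_)) this
  have e : ∀ q ∈ Nn b (b i), ff b i q = (zt m (b i) q - (i : ℕ)) * ((starRingEnd ℂ) q.1 / q.1) := by
    intro q hq
    unfold ff
    rw [ff_eq hq.1, vv_eq hq.1]; ring
  simp only [ss, cls, e y hy, e z hz]

theorem F3 {i : Fin m} {j : Fin r} (h : b i ≠ j) : Eqv (Nn b j) (ss b K i) 0 := by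
  have := cls_pert (K := K) (W := Nn b j) (f := ff b i) (g := fun _ => ((CC m j - CC m (b i) : ℝ) : ℂ))
    (ff_cont b (N_ne b) i) continuousOn_const ?_
  · rwa [cls_const] at this
  · intro q hq
    have hL := LL_ge (m := m)
    have hq' := (mem_N b).1 hq
    have e : ff b i q - ((CC m j - CC m (b i) : ℝ) : ℂ) = vv m j q - (i : ℕ) * ((starRingEnd ℂ) q.1 / q.1) := by
      unfold ff
      rw [ff_eq hq.1]; unfold vv; push_cast; ring
    rw [e, Complex.norm_real, Real.norm_eq_abs]
    have := norm_sub_le (vv m j q) ((i : ℕ) * ((starRingEnd ℂ) q.1 / q.1))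
    rw [cn hq.1] at this
    linarith [N_lt hq.1 hq'.2.1, dd_lt i, CC_sep (m := m) (Ne.symm h)]

theorem F4 (j : Fin r) (i : Fin m) : Eqv (Tt m j) (Bb K m j i) (Zz K m j) := by
  refine cls_pert ((zt_cont T_ne _).sub continuousOn_const) (zt_cont T_ne _) fun q hq => ?_
  rw [sub_sub_cancel_left, norm_neg, Complex.norm_natCast]
  linarith [dd_lt i, (mem_T.1 hq).2.2]

theorem F5 (j : Fin r) : Eqv (Tt m j) (Aa K m j) (Zz K m j - (2:K) • τ) := by
  have := cls_cz (K := K) (W := Tt m j) T_ne (f := zt m j)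
    (zt_cont T_ne _) (fun q hq h0 => by
      have := (mem_T.1 hq).2.2
      rw [h0, norm_zero] at this
      linarith [LL_ge (m := m)])
  refine Eqv.trans (Eqv.of_N2 (N2.of_forall fun y hy z hz => ?_)) this
  simp only [Aa, cls, vv_eq (T_ne y hy), vv_eq (T_ne z hz)]

theorem F6 {j j' : Fin r} (h : j' ≠ j) : Eqv (Tt m j) (Aa K m j') 0 := by
  have := cls_pert (K := K) (W := Tt m j) (f := vv m j') (g := fun _ => ((CC m j - CC m j' : ℝ) : ℂ))
    (vv_cont T_ne _) continuousOn_const ?_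
  · rwa [cls_const] at this
  · intro q hq
    have hL := LL_ge (m := m)
    have hq' := mem_T.1 hq
    have e : vv m j' q - ((CC m j - CC m j' : ℝ) : ℂ) = vv m j q := by
      unfold vv; push_cast; ring
    rw [e, Complex.norm_real, Real.norm_eq_abs]
    linarith [N_lt hq.1 hq'.2.1, CC_sep (m := m) (Ne.symm h)]

theorem pX0 (h2 : (2:K) ≠ 0) : Piece (X0 m r) (fun j : Fin r => Aa K m j) := by
  have hW : ∀ q ∈ X0 m r, q.1 ≠ 0 := fun q hq => hq.1
  have hn : ∀ j, ∀ q ∈ X0 m r, vv (r := r) m j q ≠ 0 := fun j q hq h0 => by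
    have := (mem_X0.1 hq).2 j
    rw [h0, norm_zero] at this
    linarith [LL_ge (m := m)]
  exact Chart.piece ch0 (d0 m r) h2 (fun j => cls_const_mul (vv_cont hW j) (hn j) _ (by simp))
    (fun j => cls_coc (vv_cont hW j) (hn j))

theorem pN (h2 : (2:K) ≠ 0) (j : Fin r) : Piece (Nn b j) (fun i : {i // b i = j} => Bb K m j i.1) := by
  have hn : ∀ i : {i // b i = j}, ∀ q ∈ Nn b j, zt m j q - (i.1 : ℕ) ≠ 0 := fun i q hq =>
    sub_ne_zero.2 (((mem_N b).1 hq).2.2 i.1 i.2)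
  refine Chart.piece (chj (CC m j)) (dN b j) h2 (fun i => ?_)
    (fun i => cls_coc ((zt_cont (N_ne b) j).sub continuousOn_const) (hn i))
  have := cls_const_mul (K := K) ((zt_cont (N_ne b) j).sub continuousOn_const) (hn i) (-Complex.I) (by simp)
  exact this

theorem pT (h2 : (2:K) ≠ 0) (j : Fin r) : Piece (Tt m j) (fun _ : Unit => Zz K m j) := by
  have hn : ∀ q ∈ Tt m j, zt m j q ≠ 0 := fun q hq h0 => by
      have := (mem_T.1 hq).2.2
      rw [h0, norm_zero] at this
      linarith [LL_ge (m := m)]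
  refine Chart.piece (chj (CC m j)) (dT m) h2 (fun i => ?_) (fun i => cls_coc (zt_cont T_ne j) hn)
  have := cls_const_mul (K := K) (zt_cont T_ne j) hn (-Complex.I) (by simp)
  have e : pb (chj (CC m j)).Φ ((dT m).σ (K := K) i) = cls fun x => -Complex.I * zt m j x := by
    simp only [Dat.σ, pb_cls, dT, chj, Complex.ofReal_zero, sub_zero]
    rfl
  rw [e]
  exact this

end cl
end TA
end Part_8

section Part_9
set_option linter.all false
open Filter Topology Set

namespace TA
open Dat (τ)

section cl
variable {m r : ℕ} (b : Fin m → Fin r) {K : Type*} [Field K]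

noncomputable def comb (k : K) (x : Fin m → K) : ℂ × ℂ → ℂ × ℂ → K := k • τ + ∑ i, x i • ss b K i

def ee (x : Fin m → K) (j : Fin r) : K := ∑ i : {i // b i = j}, x i.1

theorem comb_coc (k : K) (x : Fin m → K) : Coc (X b) (comb b k x) :=
  ((tau_coc b K).smul k).add (Coc.sum _ fun i _ => (ss_coc b K i).smul _)

theorem sum_sub {M : Type*} [AddCommMonoid M] (f : Fin m → M) (j : Fin r) :
    (∑ i, if b i = j then f i else 0) = ∑ i : {i // b i = j}, f i.1 := by
  rw [← Finset.sum_filter]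
  exact Finset.sum_subtype _ (by simp) _

theorem R0 (k : K) (x : Fin m → K) : Eqv (X0 m r) (comb b k x) (k • τ + ∑ j, ee b x j • Aa K m j) := by
  have : ∑ j, ee b x j • Aa K m j = ∑ i, x i • Aa K m (b i) := by
    rw [← Fintype.sum_fiberwise b]
    refine Finset.sum_congr rfl fun j _ => ?_
    rw [ee, Finset.sum_smul]
    refine Finset.sum_congr rfl fun i _ => ?_
    rw [i.2]
  rw [this]
  exact (Eqv.refl _ _).add (Eqv.sum _ fun i _ => (F1 b i).smul _)

theorem RN (j : Fin r) (k : K) (x : Fin m → K) :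
    Eqv (Nn b j) (comb b k x) ((k - 2 * ee b x j) • τ + ∑ i : {i // b i = j}, x i.1 • Bb K m j i.1) := by
  have h1 : Eqv (Nn b j) (∑ i, x i • ss b K i) (∑ i, if b i = j then x i • (Bb K m j i - (2:K) • τ) else 0) := by
    refine Eqv.sum _ fun i _ => ?_
    split_ifs with h
    · exact (F2 b h).smul _
    · have := (F3 (K := K) b h).smul (x i)
      rwa [smul_zero] at this
  rw [sum_sub b (fun i => x i • (Bb K m j i - (2:K) • τ)) j] at h1
  have h3 := (Eqv.refl (Nn b j) (k • τ (K := K))).add h1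
  refine h3.trans (Eqv.of_N2 (N2.of_forall fun y hy z hz => ?_))
  simp only [smul_sub, Finset.sum_sub_distrib, Pi.add_apply, Pi.sub_apply, Pi.smul_apply, smul_eq_mul, Finset.sum_apply, ee,
    ← Finset.sum_mul]
  ring

theorem RT0 (j : Fin r) (h : K) (y : Fin r → K) :
    Eqv (Tt m j) (h • τ + ∑ j, y j • Aa K m j) ((h - 2 * y j) • τ + y j • Zz K m j) := by
  have h1 : Eqv (Tt m j) (∑ j, y j • Aa K m j) (∑ j', if j' = j then y j' • (Zz K m j - (2:K) • τ) else 0) := by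
    refine Eqv.sum _ fun j' _ => ?_
    split_ifs with hj
    · subst hj; exact (F5 j').smul _
    · have := (F6 (m := m) (K := K) hj).smul (y j')
      rwa [smul_zero] at this
  rw [Finset.sum_ite_eq' Finset.univ j, if_pos (Finset.mem_univ _)] at h1
  refine ((Eqv.refl (Tt m j) (h • τ (K := K))).add h1).trans (Eqv.of_N2 (N2.of_forall fun y hy z hz => ?_))
  simp only [Pi.add_apply, Pi.sub_apply, Pi.smul_apply, smul_eq_mul]
  ring

theorem RTN (j : Fin r) (h : K) (x : {i // b i = j} → K) :
    Eqv (Tt m j) (h • τ + ∑ i, x i • Bb K m j i.1) (h • τ + (∑ i, x i) • Zz K m j) := by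
  rw [Finset.sum_smul]
  exact (Eqv.refl _ _).add (Eqv.sum _ fun i _ => (F4 j i.1).smul _)

theorem uT (h2 : (2:K) ≠ 0) (j : Fin r) {h h' k k' : K}
    (he : Eqv (Tt m j) (h • τ + k • Zz K m j) (h' • τ + k' • Zz K m j)) : h = h' ∧ k = k' := by
  have h1 := he.to_sub
  have := (pT (m := m) h2 j).uniq (h - h') (fun _ => k - k') (by
    rw [Finset.univ_unique, Finset.sum_singleton]
    convert h1 using 1
    simp only [sub_smul]; abel)
  exact ⟨sub_eq_zero.1 this.1, sub_eq_zero.1 (this.2 ())⟩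

theorem T_sub0 (j : Fin r) : Tt m j ⊆ X0 m r := by
  have := T_eq (fun _ : Fin m => j) j; rw [← this]; exact inter_subset_left
theorem T_subN (j : Fin r) : Tt m j ⊆ Nn b j := by
  rw [← T_eq b j]; exact inter_subset_right

def OO : Option (Fin r) → Set (ℂ × ℂ)
  | none => X0 m r
  | some j => Nn b j

theorem OO_open (h2 : (2:K) ≠ 0) : ∀ o, IsOpen (OO b o)
  | none => (pX0 h2).op
  | some j => (pN b h2 j).op

theorem OO_sub : ∀ o, X b ∩ OO b o = OO b o
  | none => inter_eq_right.2 (X0_sub b)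
  | some j => inter_eq_right.2 (N_sub b j)

theorem glueX (h2 : (2:K) ≠ 0) {a a' : ℂ × ℂ → ℂ × ℂ → K} (h0 : Eqv (X0 m r) a a') (hN : ∀ j, Eqv (Nn b j) a a') :
    Eqv (X b) a a' := by
  classical
  obtain ⟨g0, hg0⟩ := h0
  choose g hg using hN
  have hl : ∀ j, ∃ l : K, ∀ q ∈ Tt m j, g0 q = g j q + l := by
    intro j
    by_cases hT : (Tt m j).Nonempty
    · obtain ⟨q0, hq0⟩ := hT
      refine ⟨(g0 - g j) q0, fun q hq => ?_⟩
      have := (pT (m := m) h2 j).lc _ (LC.of_eqG (a := a) (b := a') (N2.mono hg0 (T_sub0 j)) (N2.mono (hg j) (T_subN b j))) q hq q0 hq0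
      rw [← this]; simp
    · exact ⟨0, fun q hq => absurd ⟨q, hq⟩ hT⟩
  choose l hl using hl
  refine glue (ι := Option (Fin r)) (O := OO b)
    (g := fun o => match o with | none => g0 | some j => fun q => g j q + l j) (OO_open b h2) ?_ ?_ ?_
  · intro q hq
    rcases X_cover b hq with h | ⟨j, h, _⟩
    · exact ⟨none, h⟩
    · exact ⟨some j, h⟩
  · intro o
    rw [OO_sub]
    match o with
    | none => exact hg0
    | some j =>
      refine N2.imp (hg j) fun y z h => ?_
      rw [h]; ring
  · intro o o' q hq h1 h3
    match o, o', h1, h3 with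
    | none, none, _, _ => rfl
    | none, some j, h1, h3 => exact hl j q (by rw [← T_eq b j]; exact ⟨h1, h3⟩)
    | some j, none, h1, h3 => exact (hl j q (by rw [← T_eq b j]; exact ⟨h3, h1⟩)).symm
    | some j, some j', h1, h3 =>
      by_cases hj : j = j'
      · subst hj; rfl
      · exact (N_disj b hj h1 h3).elim

theorem classify (h2 : (2:K) ≠ 0) {a : ℂ × ℂ → ℂ × ℂ → K} (ha : Coc (X b) a) : ∃ k x, Eqv (X b) a (comb b k x) := by
  obtain ⟨k, y, h0⟩ := (pX0 (m := m) (r := r) h2).T2 a (ha.mono (X0_sub b))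
  have hN : ∀ j, ∃ (h : K) (x : {i // b i = j} → K), Eqv (Nn b j) a (h • τ + ∑ i, x i • Bb K m j i.1) :=
    fun j => (pN b h2 j).T2 a (ha.mono (N_sub b j))
  choose kk xx hN using hN
  have key : ∀ j, k - 2 * y j = kk j ∧ y j = ∑ i, xx j i := fun j => uT h2 j
    ((((h0.mono (T_sub0 j)).trans (RT0 j k y)).symm.trans (hN j |>.mono (T_subN b j))).trans (RTN b j _ _))
  set x : Fin m → K := fun i => xx (b i) ⟨i, rfl⟩ with hx
  have hxx : ∀ j (i : {i // b i = j}), x i.1 = xx j i := by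
    rintro j ⟨i, rfl⟩; rfl
  have he : ∀ j, ee b x j = y j := by
    intro j
    rw [(key j).2, ee]
    exact Finset.sum_congr rfl fun i _ => hxx j i
  refine ⟨k, x, glueX b h2 ?_ fun j => ?_⟩
  · refine h0.trans (Eqv.symm ?_)
    have := R0 b k x
    simpa only [he] using this
  · refine (hN j).trans (Eqv.symm ?_)
    have := RN b j k x
    simpa only [he, (key j).1, hxx] using this

theorem uniqX (h2 : (2:K) ≠ 0) {k k' : K} {x x' : Fin m → K} (h : Eqv (X b) (comb b k x) (comb b k' x')) : k = k' ∧ x = x' := by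
  have h1 : Eqv (X b) (comb b (k - k') (x - x')) 0 := by
    have := h.to_sub
    convert this using 1
    funext y z
    simp only [comb, Pi.add_apply, Pi.sub_apply, Pi.smul_apply, smul_eq_mul, Finset.sum_apply, sub_mul, Finset.sum_sub_distrib]
    ring
  have h0 := (pX0 h2).uniq _ _ ((R0 b _ _).symm.trans (h1.mono (X0_sub b)))
  refine ⟨sub_eq_zero.1 h0.1, funext fun i => ?_⟩
  have := ((pN b h2 (b i)).uniq _ _ ((RN b _ _ _).symm.trans (h1.mono (N_sub b _)))).2 ⟨i, rfl⟩
  exact sub_eq_zero.1 this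

theorem mem_N_of {q : ℂ × ℂ} (hq : q ∈ X b) {j : Fin r} (h : ‖vv m j q‖ < 2 * LL m) : q ∈ Nn b j := by
  rw [mem_N]
  refine ⟨hq.1, box' (by rw [nvv hq.1]; exact h), fun i hi h => ?_⟩
  have : (starRingEnd ℂ) q.1 ≠ 0 := by simpa using hq.1
  unfold zt at h
  rw [div_eq_iff this] at h
  apply hq.2 i
  rw [hi]
  linear_combination h

open Classical in
noncomputable def sl (m r : ℕ) (q : ℂ × ℂ) : Option (Fin r) :=
  if h : ∃ j : Fin r, ‖vv m j q‖ < 3 / 2 * LL m then some h.choose else none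

theorem sl_spec {q : ℂ × ℂ} {j : Fin r} (h : sl m r q = some j) : ‖vv m j q‖ < 3 / 2 * LL m := by
  unfold sl at h
  split_ifs at h with h1
  rw [Option.some.injEq] at h
  rw [← h]; exact h1.choose_spec

theorem sl_none {q : ℂ × ℂ} (h : sl m r q = none) (j : Fin r) : 3 / 2 * LL m ≤ ‖vv m j q‖ := by
  unfold sl at h
  split_ifs at h with h1
  push Not at h1
  exact h1 j

theorem hsel : ∀ q ∈ X b, ∀ᶠ y in 𝓝[X b] q, q ∈ OO b (sl m r y) := by
  intro q hq
  have hL := LL_ge (m := m)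
  have hc : ∀ j : Fin r, Tendsto (fun y => ‖vv m j y‖) (𝓝[X b] q) (𝓝 ‖vv m j q‖) := fun j =>
    ((vv_cont (fun q hq => hq.1) j).norm q hq)
  have e1 : ∀ᶠ y in 𝓝[X b] q, ∀ j : Fin r, |‖vv m j y‖ - ‖vv m j q‖| < LL m / 2 := by
    rw [eventually_all]
    intro j
    have := (hc j).eventually (Metric.ball_mem_nhds _ (by linarith : 0 < LL m / 2))
    simpa [Real.dist_eq] using this
  filter_upwards [e1] with y hy
  cases hs : sl m r y with
  | none =>
    rcases X_cover b hq with h | ⟨j, h, hj⟩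
    · exact h
    · have h1 := sl_none hs j
      have h3 := abs_lt.1 (hy j)
      change q ∈ X0 m r
      linarith [h3.2]
  | some j =>
    have h1 := sl_spec hs
    have h3 := abs_lt.1 (hy j)
    exact mem_N_of b hq (by linarith [h3.1])

theorem relX (h2 : (2:K) ≠ 0) (hb : Function.Surjective b) {k k' : K} {x x' : Fin m → K} :
    Rel (X b) (comb b k x) (comb b k' x') ↔ ∀ i, (k - 2 * ee b x (b i)) * x' i = (k' - 2 * ee b x' (b i)) * x i := by
  constructor
  · intro h i
    have h1 := (h.mono (N_sub b (b i))).of_eqv ((comb_coc b _ _).mono (N_sub b _)) ((comb_coc b _ _).mono (N_sub b _))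
      (RN b _ _ _) (RN b _ _ _)
    exact (pN b h2 (b i)).relE _ _ _ _ h1 ⟨i, rfl⟩
  · intro h
    have hk : ∀ j, k * ee b x' j = k' * ee b x j := by
      intro j
      have : (k - 2 * ee b x j) * ee b x' j = (k' - 2 * ee b x' j) * ee b x j := by
        conv_lhs => rw [ee.eq_1 b x' j, Finset.mul_sum]
        conv_rhs => rw [ee.eq_1 b x j, Finset.mul_sum]
        refine Finset.sum_congr rfl fun i _ => ?_
        have := h i.1
        rwa [i.2] at this
      linear_combination this
    have cX0 : ∀ (h : K) (y : Fin r → K), Coc (X0 m r) (h • τ + ∑ j, y j • Aa K m j) := fun h y =>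
      ((pX0 h2).tc.smul h).add (Coc.sum _ fun j _ => ((pX0 h2).bc j).smul _)
    have cN : ∀ j (h : K) (y : {i // b i = j} → K), Coc (Nn b j) (h • τ + ∑ i, y i • Bb K m j i.1) := fun j h y =>
      ((pN b h2 j).tc.smul h).add (Coc.sum _ fun i _ => ((pN b h2 j).bc i).smul _)
    obtain ⟨c0, hc0⟩ : Rel (X0 m r) (comb b k x) (comb b k' x') :=
      ((pX0 h2).relI k k' (ee b x) (ee b x') hk).of_eqv (cX0 _ _) (cX0 _ _) (R0 b _ _).symm (R0 b _ _).symm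
    have hN : ∀ j, Rel (Nn b j) (comb b k x) (comb b k' x') := fun j =>
      ((pN b h2 j).relI (k - 2 * ee b x j) (k' - 2 * ee b x' j) (fun i => x i.1) (fun i => x' i.1) (by
        rintro ⟨i, rfl⟩; exact h i)).of_eqv (cN _ _ _) (cN _ _ _) (RN b _ _ _).symm (RN b _ _ _).symm
    choose c hc using hN
    have hmod : ∀ j, ∃ u : ℂ × ℂ → ℂ × ℂ → K, Coc (Nn b j) u ∧ N2 (Tt m j) fun y z => c0 y z = c j y z + u y z := by
      intro j
      have hco : Coc (Tt m j) (c0 - c j) := by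
        refine (N3.and (hc0.mono (T_sub0 j)) ((hc j).mono (T_subN b j))).imp ?_
        rintro y z t ⟨e1, e2⟩
        simp only [Pi.sub_apply]
        rw [e1, e2]; ring
      obtain ⟨p, q, hpq⟩ := (pT h2 j).T2 _ hco
      obtain ⟨i0, hi0⟩ := hb j
      rw [Finset.univ_unique, Finset.sum_singleton] at hpq
      obtain ⟨g, hg⟩ := hpq.trans ((Eqv.refl _ _).add ((F4 j i0).symm.smul _))
      refine ⟨fun y z => p * τ y z + q () * Bb K m j i0 y z + (g z - g y), ?_, N2.imp hg fun y z e => ?_⟩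
      · refine (N3.and (pN b h2 j).tc ((pN b h2 j).bc ⟨i0, hi0⟩)).imp ?_
        rintro y z t ⟨e1, e2⟩
        simp only at e2 ⊢
        rw [e1, e2]; ring
      · simp only [Pi.sub_apply, Pi.add_apply, Pi.smul_apply, smul_eq_mul] at e
        linear_combination e
    choose u hu hu' using hmod
    refine relGlue (ι := Option (Fin r)) (O := OO b)
      (c := fun o => match o with | none => c0 | some j => fun y z => c j y z + u j y z) ?_ ?_ (OO_open b h2) (sl m r) (hsel b)
    · intro o
      rw [OO_sub]
      match o with
      | none => exact hc0
      | some j =>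
        refine (N3.and (hc j) (hu j)).imp ?_
        rintro y z t ⟨e1, e2⟩
        simp only
        rw [e1, e2]; ring
    · intro o o'
      match o, o' with
      | none, none => exact N2.of_forall fun _ _ _ _ => rfl
      | none, some j =>
        refine (hu' j).mono ?_
        rw [← T_eq b j]; exact inter_subset_right
      | some j, none =>
        refine N2.mono ((hu' j).imp fun y z e => e.symm) ?_
        rw [← T_eq b j, inter_comm (X0 m r)]; exact inter_subset_right
      | some j, some j' =>
        by_cases hj : j = j'
        · subst hj; exact N2.of_forall fun _ _ _ _ => rfl
        · exact N2.of_forall fun q hq => (N_disj b hj hq.2.1 hq.2.2).elim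

end cl
end TA
end Part_9

section Part_10
set_option linter.all false
open Filter Topology Set

namespace TA
open Dat (τ)

section ext
open Classical in
noncomputable def extn {W W' : Set (ℂ × ℂ)} (f : C(W, W')) (q : ℂ × ℂ) : ℂ × ℂ :=
  if h : q ∈ W then (f ⟨q, h⟩ : ℂ × ℂ) else 0

theorem extn_cont {W W' : Set (ℂ × ℂ)} (f : C(W, W')) : ContinuousOn (extn f) W := by
  rw [continuousOn_iff_continuous_restrict]
  have : W.domRestrict (extn f) = fun q => (f q : ℂ × ℂ) := by
    funext q; simp [extn, domRestrict]
  rw [this]; fun_prop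

theorem extn_maps {W W' : Set (ℂ × ℂ)} (f : C(W, W')) : MapsTo (extn f) W W' := by
  intro q hq
  simp only [extn, hq, dif_pos]; exact (f ⟨q, hq⟩).2

open Classical in
theorem extn_homotopy {K : Type*} [Field K] {W W' : Set (ℂ × ℂ)} (f : C(W, W')) (g : C(W', W)) (h : (g.comp f).Homotopic (ContinuousMap.id W))
    {a : ℂ × ℂ → ℂ × ℂ → K} (ha : Coc W a) : Eqv W (pb (extn f) (pb (extn g) a)) a := by
  obtain ⟨H⟩ := h
  set H' : ℂ × ℂ → ℝ → ℂ × ℂ := fun q s => if h : q ∈ W then (H (projIcc 0 1 zero_le_one s, ⟨q, h⟩) : ℂ × ℂ) else 0 with hH'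
  have h0 : ∀ q (hq : q ∈ W) s, H' q s = H (projIcc 0 1 zero_le_one s, ⟨q, hq⟩) := fun q hq s => by
    simp only [hH', hq, dif_pos]
  have hc : ContinuousOn (fun p : (ℂ × ℂ) × ℝ => H' p.1 p.2) (W ×ˢ Icc 0 1) := by
    rw [continuousOn_iff_continuous_restrict]
    have : (W ×ˢ Icc (0:ℝ) 1).domRestrict (fun p : (ℂ × ℂ) × ℝ => H' p.1 p.2) =
        fun p => (H (projIcc 0 1 zero_le_one p.1.2, ⟨p.1.1, p.2.1⟩) : ℂ × ℂ) := by
      funext p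
      exact h0 _ p.2.1 _
    rw [this]
    refine continuous_subtype_val.comp (H.continuous.comp ?_)
    exact (continuous_projIcc.comp (by fun_prop)).prodMk (Continuous.subtype_mk (by fun_prop) _)
  have := homotopy ha H' hc (fun q hq s hs => by rw [h0 q hq]; exact Subtype.coe_prop _)
  refine Eqv.trans (Eqv.of_N2 (N2.of_forall fun y hy z hz => ?_)) (this.symm.trans (Eqv.of_N2 (N2.of_forall fun y hy z hz => ?_)))
  · have e : ∀ q ∈ W, extn g (extn f q) = H' q 0 := by
      intro q hq
      have h1 := extn_maps f hq
      rw [h0 q hq, projIcc_left]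
      have h2 : (extn f q) = (f ⟨q, hq⟩ : ℂ × ℂ) := by simp only [extn, hq, dif_pos]
      have h3 : H ((⟨0, by simp⟩ : unitInterval), ⟨q, hq⟩) = g (f ⟨q, hq⟩) := H.apply_zero _
      rw [h3]
      rw [extn, dif_pos h1]
      congr 2
      exact Subtype.ext h2
    simp only [pb, e y hy, e z hz]
  · have e : ∀ q ∈ W, H' q 1 = q := by
      intro q hq
      rw [h0 q hq, projIcc_right]
      have h3 : H ((⟨1, by simp⟩ : unitInterval), ⟨q, hq⟩) = ⟨q, hq⟩ := H.apply_one _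
      rw [h3]
    simp only [pb, e y hy, e z hz]
end ext

def rl {m r : ℕ} (b : Fin m → Fin r) {K : Type*} [Field K] (v v' : K × (Fin m → K)) : Prop :=
  ∀ i, (v.1 - 2 * ee b v.2 (b i)) * v'.2 i = (v'.1 - 2 * ee b v'.2 (b i)) * v.2 i

theorem transport {m r r' : ℕ} (b : Fin m → Fin r) (b' : Fin m → Fin r') {K : Type*} [Field K] (h2 : (2:K) ≠ 0)
    (hb : Function.Surjective b) (hb' : Function.Surjective b') (e : ContinuousMap.HomotopyEquiv (X b) (X b')) :
    ∃ T : (K × (Fin m → K)) ≃ (K × (Fin m → K)), ∀ v v', rl b' v v' ↔ rl b (T v) (T v') := by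
  have cF := extn_cont e.toFun
  have mF := extn_maps e.toFun
  have cG := extn_cont e.invFun
  have mG := extn_maps e.invFun
  have hT : ∀ v : K × (Fin m → K), ∃ w : K × (Fin m → K), Eqv (X b) (pb (extn e.toFun) (comb b' v.1 v.2)) (comb b w.1 w.2) := by
    intro v
    obtain ⟨k, x, h⟩ := classify b h2 ((comb_coc b' v.1 v.2).pb cF mF)
    exact ⟨(k, x), h⟩
  have hT' : ∀ v : K × (Fin m → K), ∃ w : K × (Fin m → K), Eqv (X b') (pb (extn e.invFun) (comb b v.1 v.2)) (comb b' w.1 w.2) := by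
    intro v
    obtain ⟨k, x, h⟩ := classify b' h2 ((comb_coc b v.1 v.2).pb cG mG)
    exact ⟨(k, x), h⟩
  choose T hT using hT
  choose T' hT' using hT'
  have l1 : ∀ v, T (T' v) = v := by
    intro v
    have := ((hT (T' v)).symm.trans ((hT' v).symm.pb cF mF)).trans (extn_homotopy e.toFun e.invFun e.left_inv (comb_coc b _ _))
    have := uniqX b h2 this
    exact Prod.ext this.1 this.2
  have l2 : ∀ v, T' (T v) = v := by
    intro v
    have := ((hT' (T v)).symm.trans ((hT v).symm.pb cG mG)).trans (extn_homotopy e.invFun e.toFun e.right_inv (comb_coc b' _ _))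
    have := uniqX b' h2 this
    exact Prod.ext this.1 this.2
  have r1 : ∀ v v', rl b' v v' → rl b (T v) (T v') := by
    intro v v' h
    have h1 := ((relX b' h2 hb').2 h).pb cF mF
    exact (relX b h2 hb).1 (h1.of_eqv ((comb_coc b' _ _).pb cF mF) ((comb_coc b' _ _).pb cF mF) (hT v) (hT v'))
  have r2 : ∀ v v', rl b v v' → rl b' (T' v) (T' v') := by
    intro v v' h
    have h1 := ((relX b h2 hb).2 h).pb cG mG
    exact (relX b' h2 hb').1 (h1.of_eqv ((comb_coc b _ _).pb cG mG) ((comb_coc b _ _).pb cG mG) (hT' v) (hT' v'))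
  refine ⟨⟨T, T', l2, l1⟩, fun v v' => ⟨r1 v v', fun h => ?_⟩⟩
  have := r2 _ _ h
  simpa only [Equiv.coe_fn_mk, l2] using this

end TA
end Part_10

section Part_11
set_option linter.all false
open Filter Topology Set

namespace TA

section cnt
variable {I : Type} [Fintype I]

theorem card_sum {G : Type} [AddCommGroup G] [Finite G] (i0 : I) (g : G) :
    Nat.card {x : I → G // ∑ i, x i = g} = Nat.card G ^ (Fintype.card I - 1) := by
  classical
  have e : ({x : I → G // ∑ i, x i = g} × G) ≃ (I → G) :=
    { toFun := fun p => p.1.1 + Pi.single i0 p.2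
      invFun := fun z => (⟨z - Pi.single i0 (∑ i, z i - g), by
        simp [Finset.sum_sub_distrib, Finset.sum_pi_single']⟩, ∑ i, z i - g)
      left_inv := by
        rintro ⟨⟨x, hx⟩, h⟩
        simp [Finset.sum_add_distrib, Finset.sum_pi_single', hx]
      right_inv := by
        intro z
        simp }
  have h1 := Nat.card_congr e
  rw [Nat.card_prod, Nat.card_fun, Nat.card_eq_fintype_card (α := I)] at h1
  have hG : 0 < Nat.card G := Nat.card_pos
  have hI : 0 < Fintype.card I := Fintype.card_pos_iff.2 ⟨i0⟩
  obtain ⟨c, hc⟩ : ∃ c, Fintype.card I = c + 1 := ⟨Fintype.card I - 1, by omega⟩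
  rw [hc, pow_succ] at h1
  rw [hc, Nat.add_sub_cancel]
  exact Nat.eq_of_mul_eq_mul_right hG h1

variable {K : Type} [Field K] [Finite K] {A : Type} [Finite A]

def par (f u : A → K) : Prop := ∀ α β, f α * u β = f β * u α

theorem par_iff {f u : A → K} (hf : f ≠ 0) : par f u ↔ ∃ c : K, u = c • f := by
  constructor
  · intro h
    obtain ⟨α, hα⟩ := Function.ne_iff.1 hf
    refine ⟨u α / f α, funext fun β => ?_⟩
    have := h α β
    simp only [Pi.zero_apply] at hα
    simp only [Pi.smul_apply, smul_eq_mul]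
    field_simp
    linear_combination this
  · rintro ⟨c, rfl⟩ α β
    simp only [Pi.smul_apply, smul_eq_mul]; ring

def blk (I : Type) [Fintype I] (κ : A → K) : Set (I → A → K) := {ξ | ∀ i, par (κ - (2:K) • ∑ i, ξ i) (ξ i)}

theorem card_blk1 (h2 : (2:K) ≠ 0) (i0 : I) (κ : A → K) :
    Nat.card {ξ : I → A → K // ξ ∈ blk I κ ∧ κ - (2:K) • ∑ i, ξ i = 0} = Nat.card (A → K) ^ (Fintype.card I - 1) := by
  rw [← card_sum i0 ((2:K)⁻¹ • κ)]
  refine Nat.card_congr (Equiv.subtypeEquivRight fun ξ => ?_)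
  constructor
  · rintro ⟨_, h⟩
    rw [sub_eq_zero.1 h, inv_smul_smul₀ h2]
  · intro h
    have : κ - (2:K) • ∑ i, ξ i = 0 := by rw [h, smul_inv_smul₀ h2, sub_self]
    refine ⟨?_, this⟩
    intro i α β
    rw [this]; simp

theorem card_blk2 (κ : A → K) :
    Nat.card {ξ : I → A → K // ξ ∈ blk I κ ∧ κ - (2:K) • ∑ i, ξ i ≠ 0} =
      Nat.card {p : (I → K) × (A → K) // p.2 ≠ 0 ∧ (1 + 2 * ∑ i, p.1 i) • p.2 = κ} := by
  symm
  have key : ∀ p : (I → K) × (A → K), p.2 ≠ 0 ∧ (1 + 2 * ∑ i, p.1 i) • p.2 = κ → κ - (2:K) • ∑ i, p.1 i • p.2 = p.2 := by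
    rintro p ⟨_, h⟩
    rw [← h, ← Finset.sum_smul, smul_smul, add_smul, one_smul, add_sub_cancel_right]
  refine Nat.card_eq_of_bijective (fun p => ⟨fun i => p.1.1 i • p.1.2, ?_, ?_⟩) ⟨?_, ?_⟩
  · intro i
    rw [key _ p.2, par_iff p.2.1]
    exact ⟨_, rfl⟩
  · rw [key _ p.2]; exact p.2.1
  · rintro ⟨p, hp⟩ ⟨p', hp'⟩ h
    simp only [Subtype.mk.injEq] at h
    have h3 : p.2 = p'.2 := by
      rw [← key p hp, ← key p' hp']
      congr 2
      exact Finset.sum_congr rfl fun i _ => congrFun h i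
    refine Subtype.ext (Prod.ext (funext fun i => ?_) h3)
    have := congrFun h i
    simp only [← h3] at this
    exact smul_left_injective _ hp.1 this
  · rintro ⟨ξ, hξ, hf⟩
    have : ∀ i, ∃ c : K, ξ i = c • (κ - (2:K) • ∑ i, ξ i) := fun i => (par_iff hf).1 (hξ i)
    choose l hl using this
    refine ⟨⟨(l, κ - (2:K) • ∑ i, ξ i), hf, ?_⟩, Subtype.ext (funext fun i => (hl i).symm)⟩
    simp only
    rw [add_smul, one_smul, mul_smul, Finset.sum_smul]
    simp only [← hl]
    rw [sub_add_cancel]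

theorem card_blk0 (h2 : (2:K) ≠ 0) (i0 : I) :
    Nat.card {p : (I → K) × (A → K) // p.2 ≠ 0 ∧ (1 + 2 * ∑ i, p.1 i) • p.2 = 0} =
      Nat.card K ^ (Fintype.card I - 1) * (Nat.card (A → K) - 1) := by
  classical
  have : Nat.card {f : A → K // f ≠ 0} = Nat.card (A → K) - 1 := by
    have := Fintype.ofFinite (A → K)
    rw [Nat.card_eq_fintype_card, Nat.card_eq_fintype_card, Fintype.card_subtype_compl, Fintype.card_subtype_eq]
  rw [← this, ← card_sum i0 (-(2:K)⁻¹), ← Nat.card_prod]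
  refine Nat.card_congr ⟨fun p => (⟨p.1.1, ?_⟩, ⟨p.1.2, p.2.1⟩), fun p => ⟨(p.1.1, p.2.1), p.2.2, ?_⟩, fun p => rfl, fun p => rfl⟩
  · have := (smul_eq_zero.1 p.2.2).resolve_right p.2.1
    field_simp
    linear_combination this
  · rw [p.1.2]
    have : (1 + 2 * -(2:K)⁻¹) = 0 := by field_simp; ring
    simp [this, h2]

theorem card_blk3 (h2 : (2:K) ≠ 0) (i0 : I) {κ : A → K} (hκ : κ ≠ 0) :
    Nat.card {p : (I → K) × (A → K) // p.2 ≠ 0 ∧ (1 + 2 * ∑ i, p.1 i) • p.2 = κ} =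
      (Nat.card K - 1) * Nat.card K ^ (Fintype.card I - 1) := by
  classical
  have hI : 0 < Fintype.card I := Fintype.card_pos_iff.2 ⟨i0⟩
  obtain ⟨c, hc⟩ : ∃ c, Fintype.card I = c + 1 := ⟨Fintype.card I - 1, by omega⟩
  have h3 : Nat.card {x : I → K // ¬ (∑ i, x i = -(2:K)⁻¹)} = (Nat.card K - 1) * Nat.card K ^ (Fintype.card I - 1) := by
    have := Fintype.ofFinite (I → K)
    have h4 := card_sum (I := I) i0 (-(2:K)⁻¹)
    rw [Nat.card_eq_fintype_card] at h4 
    rw [Nat.card_eq_fintype_card, Fintype.card_subtype_compl, h4, ← Nat.card_eq_fintype_card, Nat.card_fun,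
      Nat.card_eq_fintype_card (α := I), hc, Nat.add_sub_cancel, Nat.sub_mul, one_mul, pow_succ']
  rw [← h3]
  have hh : ∀ x : I → K, (∑ i, x i ≠ -(2:K)⁻¹) ↔ (1 + 2 * ∑ i, x i) ≠ 0 := by
    intro x
    rw [not_iff_not]
    constructor
    · intro h; rw [h]; field_simp; ring
    · intro h; field_simp; linear_combination h
  refine Nat.card_congr ⟨fun p => ⟨p.1.1, ?_⟩, fun x => ⟨(x.1, (1 + 2 * ∑ i, x.1 i)⁻¹ • κ), ?_, ?_⟩, fun p => ?_, fun p => rfl⟩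
  · refine (hh _).2 fun h => hκ ?_
    rw [← p.2.2, h, zero_smul]
  · exact smul_ne_zero (inv_ne_zero ((hh _).1 x.2)) hκ
  · exact smul_inv_smul₀ ((hh _).1 x.2) _
  · have h5 : (1 + 2 * ∑ i, p.1.1 i) ≠ 0 := fun h => hκ (by rw [← p.2.2, h, zero_smul])
    refine Subtype.ext (Prod.ext rfl ?_)
    simp only
    have h6 := p.2.2
    have h7 := inv_smul_smul₀ h5 p.1.2
    rwa [h6] at h7

theorem card_blk (h2 : (2:K) ≠ 0) (i0 : I) (κ : A → K) [Decidable (κ = 0)] :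
    (Nat.card (blk I κ) : ℂ) = (Nat.card (A → K) : ℂ) ^ (Fintype.card I - 1) +
      ((if κ = 0 then (Nat.card (A → K) : ℂ) else (Nat.card K : ℂ)) - 1) * (Nat.card K : ℂ) ^ (Fintype.card I - 1) := by
  classical
  have hs : Nat.card (blk I κ) = Nat.card {ξ : I → A → K // ξ ∈ blk I κ ∧ κ - (2:K) • ∑ i, ξ i = 0} +
      Nat.card {ξ : I → A → K // ξ ∈ blk I κ ∧ κ - (2:K) • ∑ i, ξ i ≠ 0} := by
    rw [← Nat.card_sum]
    refine Nat.card_congr ((Equiv.sumCompl fun ξ : blk I κ => κ - (2:K) • ∑ i, ξ.1 i = 0).symm.trans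
      (Equiv.sumCongr (Equiv.subtypeSubtypeEquivSubtypeInter (fun ξ => ξ ∈ blk I κ) (fun ξ => κ - (2:K) • ∑ i, ξ i = 0))
        (Equiv.subtypeSubtypeEquivSubtypeInter (fun ξ => ξ ∈ blk I κ) (fun ξ => ¬ κ - (2:K) • ∑ i, ξ i = 0))))
  rw [hs, card_blk1 h2 i0, card_blk2]
  have hK : 1 ≤ Nat.card K := Nat.card_pos
  have hA : 1 ≤ Nat.card (A → K) := Nat.card_pos
  split_ifs with h
  · subst h
    rw [card_blk0 h2 i0]
    push_cast [Nat.cast_sub hA]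
    ring
  · rw [card_blk3 h2 i0 h]
    push_cast [Nat.cast_sub hK]
    ring

end cnt

section tup
variable {m r : ℕ} (b : Fin m → Fin r) {K : Type} [Field K] [Finite K]

def tup (s : ℕ) : Set (Fin s → K × (Fin m → K)) := {w | ∀ α β, rl b (w α) (w β)}

noncomputable def tupEquiv (s : ℕ) : tup b (K := K) s ≃ Σ κ : Fin s → K, ∀ j, blk {i // b i = j} κ where
  toFun w := ⟨fun α => (w.1 α).1, fun j => ⟨fun i α => (w.1 α).2 i.1, by
    rintro ⟨i, rfl⟩ α β
    have := w.2 α β i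
    simpa [ee] using this⟩⟩
  invFun p := ⟨fun α => (p.1 α, fun i => (p.2 (b i)).1 ⟨i, rfl⟩ α), by
    intro α β i
    have := (p.2 (b i)).2 ⟨i, rfl⟩ α β
    have e : ∀ α, ee b (fun i' => (p.2 (b i')).1 ⟨i', rfl⟩ α) (b i) = ∑ i' : {i' // b i' = b i}, (p.2 (b i)).1 i' α := by
      intro α
      unfold ee
      refine Finset.sum_congr rfl ?_
      rintro ⟨i', hi'⟩ _
      have : ∀ j (hj : b i' = j), (p.2 (b i')).1 ⟨i', rfl⟩ α = (p.2 j).1 ⟨i', hj⟩ α := by rintro j rfl; rfl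
      exact this _ hi'
    simp only [e]
    simpa using this⟩
  left_inv w := rfl
  right_inv p := by
    obtain ⟨κ, x⟩ := p
    refine Sigma.ext rfl (heq_of_eq (funext fun j => Subtype.ext (funext ?_)))
    rintro ⟨i, rfl⟩
    rfl

theorem card_tup (h2 : (2:K) ≠ 0) (hb : Function.Surjective b) (s : ℕ) : (Nat.card (tup b (K := K) s) : ℂ) =
    (∏ j, (((Nat.card K : ℂ) ^ s) ^ (Fintype.card {i // b i = j} - 1) +
      ((Nat.card K : ℂ) ^ s - 1) * (Nat.card K : ℂ) ^ (Fintype.card {i // b i = j} - 1))) +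
    ((Nat.card K : ℂ) ^ s - 1) * (∏ j, (((Nat.card K : ℂ) ^ s) ^ (Fintype.card {i // b i = j} - 1) +
      ((Nat.card K : ℂ) - 1) * (Nat.card K : ℂ) ^ (Fintype.card {i // b i = j} - 1))) := by
  classical
  have hc : Nat.card (Fin s → K) = Nat.card K ^ s := by rw [Nat.card_fun, Nat.card_fin]
  have := Fintype.ofFinite (Fin s → K)
  rw [Nat.card_congr (tupEquiv b s), Nat.card_sigma]
  simp only [Nat.card_pi]
  push_cast
  have e : ∀ (κ : Fin s → K) (j : Fin r), (Nat.card (blk {i // b i = j} κ) : ℂ) = _ := fun κ j =>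
    card_blk h2 ⟨(hb j).choose, (hb j).choose_spec⟩ κ
  simp only [e, hc]
  push_cast
  rw [← Finset.add_sum_erase _ _ (Finset.mem_univ (0 : Fin s → K))]
  simp only [if_true]
  congr 1
  rw [Finset.sum_congr rfl (fun κ hκ => by rw [if_neg (Finset.ne_of_mem_erase hκ)])]
  rw [Finset.sum_const, Finset.card_erase_of_mem (Finset.mem_univ _), Finset.card_univ, ← Nat.card_eq_fintype_card, hc, nsmul_eq_mul,
    Nat.cast_sub (Nat.one_le_pow _ _ Nat.card_pos)]
  push_cast
  rfl

end tup
end TA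
end Part_11

section Part_12
set_option linter.all false
open Filter Topology Set
namespace TA
open Polynomial in
theorem prod_det (f : ℕ → ℂ[X]) (z : ℕ → ℂ) (h0 : ∀ a, 0 < a → (f a).eval (z a) = 0)
    (h1 : ∀ a b, 0 < b → b < a → (f b).eval (z a) ≠ 0) :
    ∀ (n : ℕ) (A B : Multiset ℕ), A.card + B.card = n → (∀ a ∈ A, 0 < a) → (∀ a ∈ B, 0 < a) →
      (A.map f).prod = (B.map f).prod → A = B := by
  have key : ∀ (A B : Multiset ℕ), (∀ a ∈ B, 0 < a) → (A.map f).prod = (B.map f).prod →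
      ∀ M ∈ A, 0 < M → (∀ x ∈ B, x ≤ M) → M ∈ B := by
    intro A B hB h M hM hM0 hx
    have h2 : ((B.map f).prod).eval (z M) = 0 := by
      rw [← h, ← Multiset.cons_erase hM, Multiset.map_cons, Multiset.prod_cons, eval_mul, h0 M hM0, zero_mul]
    rw [eval_multiset_prod, Multiset.prod_eq_zero_iff] at h2
    simp only [Multiset.map_map, Multiset.mem_map, Function.comp] at h2
    obtain ⟨b, hb, hb'⟩ := h2
    rcases (hx b hb).lt_or_eq with h3 | h3
    · exact absurd hb' (h1 M b (hB b hb) h3)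
    · exact h3 ▸ hb
  intro n
  induction n using Nat.strong_induction_on with
  | _ n ih =>
    intro A B hn hA hB h
    rcases Multiset.empty_or_exists_mem (A + B) with h3 | ⟨x, hx⟩
    · have h4 := congrArg Multiset.card h3
      simp only [Multiset.card_add, Multiset.card_zero] at h4
      rw [Multiset.card_eq_zero.1 (show A.card = 0 by omega), Multiset.card_eq_zero.1 (show B.card = 0 by omega)]
    · obtain ⟨M, hM, hmax⟩ : ∃ M ∈ A + B, ∀ x ∈ A + B, x ≤ M := by
        obtain ⟨M, hM, hmax⟩ := (A + B).toFinset.exists_max_image id ⟨x, by simpa using hx⟩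
        exact ⟨M, by simpa using hM, fun x hx => hmax x (Multiset.mem_toFinset.2 hx)⟩
      have hMp : 0 < M := by
        rcases Multiset.mem_add.1 hM with h | h
        · exact hA _ h
        · exact hB _ h
      have hmem : M ∈ A ∧ M ∈ B := by
        rcases Multiset.mem_add.1 hM with h' | h'
        · exact ⟨h', key A B hB h M h' hMp fun x hx => hmax x (Multiset.mem_add.2 (Or.inr hx))⟩
        · exact ⟨key B A hA h.symm M h' hMp fun x hx => hmax x (Multiset.mem_add.2 (Or.inl hx)), h'⟩
      obtain ⟨A1, rfl⟩ := Multiset.exists_cons_of_mem hmem.1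
      obtain ⟨B1, rfl⟩ := Multiset.exists_cons_of_mem hmem.2
      congr 1
      simp only [Multiset.map_cons, Multiset.prod_cons] at h
      have hf : f M ≠ 0 := by
        intro h5
        have := h1 (M+1) M hMp (Nat.lt_succ_self M)
        simp [h5] at this
      simp only [Multiset.card_cons] at hn
      exact ih (A1.card + B1.card) (by omega) A1 B1 rfl (fun a ha => hA a (Multiset.mem_cons_of_mem ha))
        (fun a ha => hB a (Multiset.mem_cons_of_mem ha)) (mul_left_cancel₀ hf h)

open Polynomial in
/-- products of `1 - x^a` determine the multiset -/
theorem det1 (A B : Multiset ℕ) (hA : ∀ a ∈ A, 0 < a) (hB : ∀ a ∈ B, 0 < a)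
    (h : ∀ x : ℂ, (A.map fun a => 1 - x ^ a).prod = (B.map fun a => 1 - x ^ a).prod) : A = B := by
  refine prod_det (fun a => 1 - Polynomial.X ^ a) (fun a => Complex.exp (2 * Real.pi * Complex.I / a)) ?_ ?_ _ A B rfl hA hB ?_
  · intro a ha
    have := (Complex.isPrimitiveRoot_exp a ha.ne').pow_eq_one
    simp [this]
  · intro a b hb hab
    have := (Complex.isPrimitiveRoot_exp a (by omega)).pow_ne_one_of_pos_of_lt hb.ne' hab
    simp only [eval_sub, eval_one, eval_pow, eval_X]
    exact sub_ne_zero.2 this.symm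
  · refine Polynomial.funext fun x => ?_
    simp only [eval_multiset_prod, Multiset.map_map, Function.comp_def, eval_sub, eval_one, eval_pow, eval_X]
    exact h x

theorem root_ex (a : ℕ) : ∃ z : ℝ, 0 < a → z ^ a + z - 1 = 0 ∧ 0 < z ∧ z < 1 := by
  by_cases ha : 0 < a
  · have := intermediate_value_Icc (a := (0:ℝ)) (b := 1) zero_le_one (f := fun z => z ^ a + z - 1) (by fun_prop)
    obtain ⟨z, hz, h⟩ := this (show (0:ℝ) ∈ _ by simp [ha.ne'])
    refine ⟨z, fun _ => ⟨h, lt_of_le_of_ne hz.1 ?_, lt_of_le_of_ne hz.2 ?_⟩⟩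
    · rintro rfl; simp [ha.ne'] at h
    · rintro rfl; simp at h
  · exact ⟨0, fun h => absurd h ha⟩

open Polynomial in
theorem det2 (A B : Multiset ℕ) (hA : ∀ a ∈ A, 0 < a) (hB : ∀ a ∈ B, 0 < a)
    (h : ∀ x : ℂ, (A.map fun a => x ^ a + x - 1).prod = (B.map fun a => x ^ a + x - 1).prod) : A = B := by
  choose z hz using root_ex
  refine prod_det (fun a => Polynomial.X ^ a + Polynomial.X - 1) (fun a => (z a : ℂ)) ?_ ?_ _ A B rfl hA hB ?_
  · intro a ha
    simp only [eval_sub, eval_add, eval_one, eval_pow, eval_X]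
    exact_mod_cast (hz a ha).1
  · intro a b hb hab
    simp only [eval_sub, eval_add, eval_one, eval_pow, eval_X]
    obtain ⟨h1, h2, h3⟩ := hz a (by omega)
    have := pow_lt_pow_right_of_lt_one₀ h2 h3 hab
    have h4 : z a ^ b + z a - 1 ≠ 0 := by intro h; linarith
    exact_mod_cast h4
  · refine Polynomial.funext fun x => ?_
    simp only [eval_multiset_prod, Multiset.map_map, Function.comp_def, eval_sub, eval_add, eval_one, eval_pow, eval_X]
    exact h x

noncomputable def CD (D : Multiset ℕ) (Y P : ℂ) : ℂ :=
  (D.map fun a => Y ^ a + (Y - 1) * P ^ a).prod + (Y - 1) * (D.map fun a => Y ^ a + (P - 1) * P ^ a).prod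

open Polynomial in
theorem CD_ext (D D' : Multiset ℕ) (h : ∀ p : ℕ, p.Prime → p ≠ 2 → ∀ s : ℕ, CD D ((p:ℂ) ^ s) p = CD D' ((p:ℂ) ^ s) p) :
    ∀ Y P, CD D Y P = CD D' Y P := by
  have h1 : ∀ p : ℕ, p.Prime → p ≠ 2 → ∀ Y, CD D Y p = CD D' Y p := by
    intro p hp hp2 Y
    let F : Multiset ℕ → ℂ[X] := fun D =>
      (D.map fun a => Polynomial.X ^ a + (Polynomial.X - 1) * C ((p:ℂ) ^ a)).prod + (Polynomial.X - 1) * (D.map fun a => Polynomial.X ^ a + C (((p:ℂ) - 1) * (p:ℂ) ^ a)).prod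
    have hF : ∀ D y, (F D).eval y = CD D y p := by
      intro D y
      simp only [F, CD, eval_add, eval_mul, eval_multiset_prod, Multiset.map_map, Function.comp_def, eval_sub, eval_one, eval_pow, eval_X, eval_C]
    have : F D = F D' := by
      refine eq_of_infinite_eval_eq _ _ (Set.Infinite.mono (s := Set.range fun s : ℕ => (p:ℂ) ^ s) ?_ (Set.infinite_range_of_injective ?_))
      · rintro _ ⟨s, rfl⟩
        simp only [Set.mem_setOf_eq, hF, h p hp hp2 s]
      · intro s t hst
        have h5 : (p:ℂ) ^ s = (p:ℂ) ^ t := hst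
        have : p ^ s = p ^ t := by exact_mod_cast h5
        exact Nat.pow_right_injective hp.two_le this
    rw [← hF, this, hF]
  intro Y P
  let F : Multiset ℕ → ℂ[X] := fun D =>
      (D.map fun a => C (Y ^ a) + C (Y - 1) * Polynomial.X ^ a).prod + C (Y - 1) * (D.map fun a => C (Y ^ a) + (Polynomial.X - 1) * Polynomial.X ^ a).prod
  have hF : ∀ D y, (F D).eval y = CD D Y y := by
    intro D y
    simp only [F, CD, eval_add, eval_mul, eval_multiset_prod, Multiset.map_map, Function.comp_def, eval_sub, eval_one, eval_pow, eval_X, eval_C]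
  have : F D = F D' := by
    refine eq_of_infinite_eval_eq _ _ (Set.Infinite.mono (s := (Nat.cast : ℕ → ℂ) '' {p | p.Prime ∧ p ≠ 2}) ?_ (Set.Infinite.image Nat.cast_injective.injOn ?_))
    · rintro _ ⟨p, ⟨hp, hp2⟩, rfl⟩
      simp only [Set.mem_setOf_eq, hF, h1 p hp hp2]
    · exact (Nat.infinite_setOf_prime.diff (Set.finite_singleton 2)).mono fun p hp => ⟨hp.1, hp.2⟩
  rw [← hF, this, hF]
end TA
end Part_12

section Part_13
set_option linter.all false
open Filter Topology Set
namespace TA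

theorem CD_split (t : ℕ) (A : Multiset ℕ) (Y P : ℂ) : CD (Multiset.replicate t 0 + A) Y P =
    Y ^ t * (A.map fun a => Y ^ a + (Y - 1) * P ^ a).prod + (Y - 1) * (P ^ t * (A.map fun a => Y ^ a + (P - 1) * P ^ a).prod) := by
  simp [CD, Multiset.map_add, Multiset.prod_add, Multiset.map_replicate]

theorem prod_pow_sum (A : Multiset ℕ) (Y : ℂ) : (A.map fun a => Y ^ a).prod = Y ^ A.sum := by
  induction A using Multiset.induction_on with
  | empty => simp
  | cons a A ih => simp [ih, pow_add]

theorem CD_zero (t : ℕ) (A : Multiset ℕ) (hA : ∀ a ∈ A, 0 < a) (Y : ℂ) : CD (Multiset.replicate t 0 + A) Y 0 =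
    Y ^ t * Y ^ A.sum + (Y - 1) * (0 ^ t * Y ^ A.sum) := by
  rw [CD_split]
  have e1 : (A.map fun a => Y ^ a + (Y - 1) * (0:ℂ) ^ a) = A.map fun a => Y ^ a :=
    Multiset.map_congr rfl fun a ha => by simp [(hA a ha).ne']
  have e2 : (A.map fun a => Y ^ a + ((0:ℂ) - 1) * (0:ℂ) ^ a) = A.map fun a => Y ^ a :=
    Multiset.map_congr rfl fun a ha => by simp [(hA a ha).ne']
  rw [e1, e2, prod_pow_sum]

theorem CD_one (t : ℕ) (A : Multiset ℕ) (Y : ℂ) : CD (Multiset.replicate t 0 + A) Y 1 =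
    Y ^ t * (A.map fun a => Y ^ a + Y - 1).prod + (Y - 1) * Y ^ A.sum := by
  rw [CD_split]
  simp [prod_pow_sum, add_sub_assoc]

noncomputable def GG (t : ℕ) (A : Multiset ℕ) (Y Q : ℂ) : ℂ :=
  (A.map fun a => 1 + (Y - 1) * Q ^ a).prod + (Y - 1) * (Q ^ t * (A.map fun a => 1 + (Q * Y - 1) * Q ^ a).prod)

theorem CD_GG (t : ℕ) (A : Multiset ℕ) (Y Q : ℂ) : CD (Multiset.replicate t 0 + A) Y (Q * Y) =
    Y ^ (t + A.sum) * GG t A Y Q := by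
  rw [CD_split]
  have e : ∀ u : ℂ, (A.map fun a => Y ^ a + u * (Q * Y) ^ a).prod = Y ^ A.sum * (A.map fun a => 1 + u * Q ^ a).prod := by
    intro u
    rw [← prod_pow_sum, ← Multiset.prod_map_mul]
    congr 1
    refine Multiset.map_congr rfl fun a ha => ?_
    rw [mul_pow]; ring
  rw [e, e, GG, mul_pow]
  ring

theorem GG_cont (t : ℕ) (A : Multiset ℕ) (Q : ℂ) : Continuous fun Y => GG t A Y Q := by
  have e : ∀ f : ℕ → ℂ → ℂ, (∀ a, Continuous (f a)) → Continuous fun Y => (A.map fun a => f a Y).prod := by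
    intro f hf
    induction A using Multiset.induction_on with
    | empty => simpa using continuous_const
    | cons a A ih => 
      simp only [Multiset.map_cons, Multiset.prod_cons]
      exact (hf a).mul ih
  unfold GG
  have h1 := e (fun a Y => 1 + (Y - 1) * Q ^ a) (fun a => by fun_prop)
  have h2 := e (fun a Y => 1 + (Q * Y - 1) * Q ^ a) (fun a => by fun_prop)
  fun_prop

theorem GG_zero (t : ℕ) (A : Multiset ℕ) (Q : ℂ) : GG t A 0 Q = ((t ::ₘ A).map fun a => 1 - Q ^ a).prod := by
  simp only [GG, Multiset.map_cons, Multiset.prod_cons, mul_zero, zero_sub]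
  have e : (A.map fun a => 1 + -1 * Q ^ a) = A.map fun a => 1 - Q ^ a := Multiset.map_congr rfl fun a ha => by ring
  rw [e]; ring

theorem prod_cmp (R : Multiset ℕ) : 0 < (R.map fun a => 1 + 2 ^ a).prod ∧
    (R.map fun a => 1 + 2 ^ a).prod ≤ (R.map fun a => 1 + 3 * 2 ^ a).prod ∧
    (R ≠ 0 → (R.map fun a => 1 + 2 ^ a).prod < (R.map fun a => 1 + 3 * 2 ^ a).prod) := by
  induction R using Multiset.induction_on with
  | empty => simp
  | cons a R ih =>
    obtain ⟨h1, h2, -⟩ := ih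
    simp only [Multiset.map_cons, Multiset.prod_cons]
    have h3 : 0 < 2 ^ a := by positivity
    have : (1 + 2 ^ a) * (R.map fun a => 1 + 2 ^ a).prod < (1 + 3 * 2 ^ a) * (R.map fun a => 1 + 3 * 2 ^ a).prod := by
      nlinarith
    exact ⟨by positivity, this.le, fun _ => this⟩

def Good (D : Multiset ℕ) : Prop := ∀ t a, D = a ::ₘ Multiset.replicate t 0 → 0 < a → a ≤ t

theorem mixed (t' : ℕ) (A A' : Multiset ℕ) (hA : ∀ a ∈ A, 0 < a) (hA' : ∀ a ∈ A', 0 < a) (ht' : 0 < t')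
    (hs : A.sum + A.card = t' + A'.sum + A'.card)
    (g : Good (Multiset.replicate 0 0 + A))
    (h : ∀ Y P, CD (Multiset.replicate 0 0 + A) Y P = CD (Multiset.replicate t' 0 + A') Y P) : False := by
  have h1 := h 2 0
  rw [CD_zero _ _ hA, CD_zero _ _ hA', zero_pow ht'.ne'] at h1
  have h2 : A.sum + 1 = t' + A'.sum := by
    have h3 : (2:ℂ) ^ (A.sum + 1) = (2:ℂ) ^ (t' + A'.sum) := by rw [pow_succ, pow_add]; linear_combination h1
    have h4 : 2 ^ (A.sum + 1) = 2 ^ (t' + A'.sum) := by exact_mod_cast h3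
    exact Nat.pow_right_injective le_rfl h4
  have hc : A.card = A'.card + 1 := by omega
  obtain ⟨x, hx⟩ := Multiset.card_pos_iff_exists_mem.1 (show 0 < A.card by omega)
  have hsum : A.sum ≠ 0 := by
    have := Multiset.le_sum_of_mem hx
    have := hA x hx
    omega
  have h5 := h 0 1
  rw [CD_one, CD_one, zero_pow ht'.ne', zero_pow hsum] at h5
  have e : (A.map fun a => (0:ℂ) ^ a + 0 - 1) = A.map fun a => (-1:ℂ) := Multiset.map_congr rfl fun a ha => by
    rw [zero_pow (hA a ha).ne']; ring
  rw [e, Multiset.map_const', Multiset.prod_replicate] at h5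
  have h6 : A'.sum = 0 := by
    by_contra h7
    rw [zero_pow h7] at h5
    simp at h5
  have h7 : A' = 0 := by
    refine Multiset.eq_zero_of_forall_notMem fun a ha => ?_
    have := Multiset.le_sum_of_mem ha
    have := hA' a ha
    omega
  subst h7
  obtain ⟨a, rfl⟩ := Multiset.card_eq_one.1 hc
  have ha := hA a (by simp)
  have := g 0 a (by simp) ha
  omega

theorem CD_det' (t t' : ℕ) (A A' : Multiset ℕ) (hA : ∀ a ∈ A, 0 < a) (hA' : ∀ a ∈ A', 0 < a)
    (hs : t + A.sum + A.card = t' + A'.sum + A'.card)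
    (g : Good (Multiset.replicate t 0 + A)) (g' : Good (Multiset.replicate t' 0 + A'))
    (h : ∀ Y P, CD (Multiset.replicate t 0 + A) Y P = CD (Multiset.replicate t' 0 + A') Y P) : t = t' ∧ A = A' := by
  rcases Nat.eq_zero_or_pos t with rfl | ht <;> rcases Nat.eq_zero_or_pos t' with rfl | ht'
  · refine ⟨rfl, ?_⟩
    have h1 := h 2 0
    rw [CD_zero _ _ hA, CD_zero _ _ hA'] at h1
    have h2 : A.sum = A'.sum := by
      have h3 : (2:ℂ) ^ (A.sum) = (2:ℂ) ^ (A'.sum) := by linear_combination h1 / 2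
      have h4 : 2 ^ (A.sum) = 2 ^ (A'.sum) := by exact_mod_cast h3
      exact Nat.pow_right_injective le_rfl h4
    refine det2 A A' hA hA' fun x => ?_
    have h3 := h x 1
    rw [CD_one, CD_one, h2] at h3
    linear_combination h3
  · exact (mixed t' A A' hA hA' ht' (by omega) g h).elim
  · exact (mixed t A' A hA' hA ht (by omega) g' fun Y P => (h Y P).symm).elim
  · have h1 := h 2 0
    rw [CD_zero _ _ hA, CD_zero _ _ hA', zero_pow ht.ne', zero_pow ht'.ne'] at h1
    have h2 : t + A.sum = t' + A'.sum := by
      have h3 : (2:ℂ) ^ (t + A.sum) = (2:ℂ) ^ (t' + A'.sum) := by rw [pow_add, pow_add]; linear_combination h1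
      have h4 : 2 ^ (t + A.sum) = 2 ^ (t' + A'.sum) := by exact_mod_cast h3
      exact Nat.pow_right_injective le_rfl h4
    have hG : ∀ Q Y, GG t A Y Q = GG t' A' Y Q := by
      intro Q
      refine congrFun (Continuous.ext_on (dense_compl_singleton (0:ℂ)) (GG_cont t A Q) (GG_cont t' A' Q) ?_)
      intro Y hY
      have h3 := h Y (Q * Y)
      rw [CD_GG, CD_GG, h2] at h3
      exact mul_left_cancel₀ (pow_ne_zero _ hY) h3
    have h3 : t ::ₘ A = t' ::ₘ A' := by
      refine det1 _ _ ?_ ?_ fun x => by rw [← GG_zero, ← GG_zero, hG]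
      · intro a ha
        rcases Multiset.mem_cons.1 ha with rfl | ha
        · exact ht
        · exact hA a ha
      · intro a ha
        rcases Multiset.mem_cons.1 ha with rfl | ha
        · exact ht'
        · exact hA' a ha
    rcases Multiset.cons_eq_cons.1 h3 with h4 | ⟨hne, R, rfl, rfl⟩
    · exact h4
    · exfalso
      have hR : R = 0 := by
        by_contra hR
        have h5 := hG 2 2
        simp only [GG, Multiset.map_cons, Multiset.prod_cons] at h5
        have e1 : (R.map fun a => 1 + ((2:ℂ) - 1) * 2 ^ a).prod = ((R.map fun a => 1 + 2 ^ a).prod : ℕ) := by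
          rw [Nat.cast_multiset_prod, Multiset.map_map]
          congr 1
          refine Multiset.map_congr rfl fun a ha => ?_
          push_cast [Function.comp]; ring
        have e2 : (R.map fun a => 1 + ((2:ℂ) * 2 - 1) * 2 ^ a).prod = ((R.map fun a => 1 + 3 * 2 ^ a).prod : ℕ) := by
          rw [Nat.cast_multiset_prod, Multiset.map_map]
          congr 1
          refine Multiset.map_congr rfl fun a ha => ?_
          push_cast [Function.comp]; ring
        rw [e1, e2] at h5
        have h6 := ((prod_cmp R).2.2 hR).ne
        generalize (R.map fun a => 1 + 2 ^ a).prod = u at *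
        generalize (R.map fun a => 1 + 3 * 2 ^ a).prod = v at *
        have h7 : ((2:ℂ) ^ t' - 2 ^ t) * ((u:ℂ) - v) = 0 := by linear_combination h5
        rcases mul_eq_zero.1 h7 with h8 | h8
        · have h9 : 2 ^ t' = 2 ^ t := by exact_mod_cast sub_eq_zero.1 h8
          exact hne (Nat.pow_right_injective le_rfl h9).symm
        · exact h6 (by exact_mod_cast sub_eq_zero.1 h8)
      subst hR
      have a1 := g t t' (by rw [add_comm, Multiset.cons_add, zero_add]) ht'
      have a2 := g' t' t (by rw [add_comm, Multiset.cons_add, zero_add]) ht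
      omega

theorem CD_det (D D' : Multiset ℕ) (g : Good D) (g' : Good D') (hs : D.sum + D.card = D'.sum + D'.card)
    (h : ∀ Y P, CD D Y P = CD D' Y P) : D = D' := by
  have key : ∀ D : Multiset ℕ, ∃ t A, (∀ a ∈ A, 0 < a) ∧ D = Multiset.replicate t 0 + A := by
    intro D
    refine ⟨(D.filter (· = 0)).card, D.filter (¬ · = 0), fun a ha => Nat.pos_of_ne_zero (Multiset.mem_filter.1 ha).2, ?_⟩
    conv_lhs => rw [← Multiset.filter_add_not (· = 0) D]
    congr 1
    exact Multiset.eq_replicate_card.2 fun a ha => (Multiset.mem_filter.1 ha).2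
  obtain ⟨t, A, hA, rfl⟩ := key D
  obtain ⟨t', A', hA', rfl⟩ := key D'
  simp only [Multiset.sum_add, Multiset.card_add, Multiset.sum_replicate, Multiset.card_replicate, smul_zero, zero_add] at hs
  obtain ⟨rfl, rfl⟩ := CD_det' t t' A A' hA hA' (by omega) g g' h
  rfl

/-- multiset of parts minus one -/
def dec {m : ℕ} (μ : Nat.Partition m) : Multiset ℕ := μ.parts.map (· - 1)

theorem dec_inv {m : ℕ} (μ : Nat.Partition m) : (dec μ).map (· + 1) = μ.parts := by
  rw [dec, Multiset.map_map]
  conv_rhs => rw [← Multiset.map_id μ.parts]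
  refine Multiset.map_congr rfl fun a ha => ?_
  have := μ.parts_pos ha
  simp only [Function.comp, id]; omega

theorem dec_inj {m : ℕ} {μ ν : Nat.Partition m} (h : dec μ = dec ν) : μ = ν :=
  Nat.Partition.ext (by rw [← dec_inv μ, ← dec_inv ν, h])

theorem dec_sum {m : ℕ} (μ : Nat.Partition m) : (dec μ).sum + (dec μ).card = m := by
  conv_rhs => rw [← μ.parts_sum, ← dec_inv μ]
  rw [Multiset.sum_map_add]
  simp

theorem card_good (m : ℕ) : Fintype.card (Nat.Partition m) - m / 2 ≤ Nat.card {μ : Nat.Partition m // Good (dec μ)} := by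
  classical
  have hbad : Fintype.card {μ : Nat.Partition m // ¬ Good (dec μ)} ≤ m / 2 := by
    have hex : ∀ μ : {μ : Nat.Partition m // ¬ Good (dec μ)}, ∃ t : Fin (m / 2), dec μ.1 = (m - 1 - t) ::ₘ Multiset.replicate t 0 := by
      rintro ⟨μ, hμ⟩
      simp only [Good, not_forall] at hμ
      obtain ⟨t, a, h, ha, hat⟩ := hμ
      have := dec_sum μ
      rw [h] at this
      simp at this
      exact ⟨⟨t, by omega⟩, by rw [h]; congr 1; simp only; omega⟩
    choose f hf using hex
    have : Function.Injective f := by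
      intro μ ν h
      refine Subtype.ext (dec_inj ?_)
      rw [hf, hf, h]
    simpa using Fintype.card_le_of_injective f this
  have := Fintype.card_subtype_compl (fun μ : Nat.Partition m => Good (dec μ))
  have h2 := Fintype.card_subtype_le (fun μ : Nat.Partition m => Good (dec μ))
  rw [Nat.card_eq_fintype_card]
  omega
end TA
end Part_13

section Part_14
set_option linter.all false
open Filter Topology Set

namespace TA
theorem exists_blocks {m : ℕ} (μ : Nat.Partition m) : ∃ (r : ℕ) (b : Fin m → Fin r), Function.Surjective b ∧
    ∀ f : ℕ → ℂ, ∏ j, f (Fintype.card {i // b i = j} - 1) = ((dec μ).map f).prod := by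
  classical
  let l := μ.parts.toList
  let g : Fin l.length → ℕ := l.get
  have hl : (l : Multiset ℕ) = μ.parts := Multiset.coe_toList _
  have hg : List.ofFn g = l := List.ofFn_get l
  have hsum : ∑ j, g j = m := by
    rw [← List.sum_ofFn, hg, ← Multiset.sum_coe, hl, μ.parts_sum]
  let e : (Σ j, Fin (g j)) ≃ Fin m := finSigmaFinEquiv.trans (finCongr hsum)
  let b : Fin m → Fin l.length := fun i => (e.symm i).1
  have hcard : ∀ j, Fintype.card {i // b i = j} = g j := by
    intro j
    rw [← Fintype.card_fin (g j)]
    refine Fintype.card_congr (Equiv.trans ?_ (Equiv.sigmaSubtype (β := fun j => Fin (g j)) j))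
    exact e.symm.subtypeEquiv fun i => Iff.rfl
  refine ⟨l.length, b, ?_, ?_⟩
  · intro j
    have hj : 0 < g j := μ.parts_pos (by rw [← hl]; exact List.get_mem _ _)
    exact ⟨e ⟨j, ⟨0, hj⟩⟩, by simp [b]⟩
  · intro f
    simp only [hcard]
    have h1 : (l.map fun a => f (a - 1)).prod = ∏ x, f (g x - 1) := by
      have h2 := congrArg (fun l : List ℕ => (l.map fun a => f (a - 1)).prod) hg
      rw [← h2]
      simp only [List.map_ofFn, List.prod_ofFn, Function.comp]
    rw [dec, ← hl, Multiset.map_coe, Multiset.map_coe, Multiset.prod_coe, List.map_map, ← h1]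
    rfl

noncomputable def Lm (c k : ℝ) : ℂ →ₗ[ℝ] ℂ × ℂ :=
  LinearMap.prod LinearMap.id (c • LinearMap.id + k • Complex.conjAe.toLinearMap)

theorem mem_Lm (c k : ℝ) (q : ℂ × ℂ) : q ∈ LinearMap.range (Lm c k) ↔ q.2 - c * q.1 - k * (starRingEnd ℂ) q.1 = 0 := by
  constructor
  · rintro ⟨z, rfl⟩
    simp [Lm]
  · intro h
    refine ⟨q.1, Prod.ext rfl ?_⟩
    change c • q.1 + k • (starRingEnd ℂ) q.1 = q.2
    rw [Complex.real_smul, Complex.real_smul]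
    linear_combination -h

variable {m r : ℕ} (b : Fin m → Fin r)

noncomputable def PL : Fin (m+1) → Submodule ℝ (ℂ × ℂ) :=
  Fin.cons (LinearMap.range (LinearMap.inr ℝ ℂ ℂ)) fun i => LinearMap.range (Lm (CC m (b i)) (i : ℕ))

theorem PL_rank (i : Fin (m+1)) : Module.finrank ℝ (PL b i) = 2 := by
  refine Fin.cases ?_ (fun i => ?_) i
  · change Module.finrank ℝ (LinearMap.range (LinearMap.inr ℝ ℂ ℂ)) = 2
    rw [LinearMap.finrank_range_of_inj LinearMap.inr_injective, Complex.finrank_real_complex]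
  · change Module.finrank ℝ (LinearMap.range (Lm (CC m (b i)) (i : ℕ))) = 2
    rw [LinearMap.finrank_range_of_inj, Complex.finrank_real_complex]
    intro x y h
    exact congrArg Prod.fst h

theorem mem_PL0 (q : ℂ × ℂ) : q ∈ PL b 0 ↔ q.1 = 0 := by
  simp only [PL, Fin.cons_zero]
  constructor
  · rintro ⟨z, rfl⟩; rfl
  · intro h; exact ⟨q.2, Prod.ext h.symm rfl⟩

theorem mem_PLs (i : Fin m) (q : ℂ × ℂ) : q ∈ PL b i.succ ↔ q.2 - CC m (b i) * q.1 - (i : ℕ) * (starRingEnd ℂ) q.1 = 0 := by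
  simp only [PL, Fin.cons_succ, mem_Lm]
  norm_num

theorem mem_X (q : ℂ × ℂ) : q ∈ X b ↔ ∀ i, q ∉ PL b i := by
  rw [Fin.forall_fin_succ]
  simp only [mem_PL0, mem_PLs]
  rfl

theorem PL_disj (i j : Fin (m+1)) (h : i ≠ j) (q : ℂ × ℂ) (hi : q ∈ PL b i) (hj : q ∈ PL b j) : q = 0 := by
  have h0 : ∀ i : Fin m, q ∈ PL b 0 → q ∈ PL b i.succ → q = 0 := by
    intro i hi hj
    rw [mem_PL0] at hi
    rw [mem_PLs, hi] at hj
    refine Prod.ext hi ?_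
    simpa using hj
  revert h hi hj
  refine Fin.cases ?_ (fun i => ?_) i <;> refine Fin.cases ?_ (fun j => ?_) j
  · intro h; exact absurd rfl h
  · intro _ hi hj; exact h0 _ hi hj
  · intro _ hi hj; exact h0 _ hj hi
  · intro h hi hj
    have hij : i ≠ j := fun e => h (by rw [e])
    rw [mem_PLs] at hi hj
    have key : ((CC m (b i) : ℂ) - CC m (b j)) * q.1 = ((j:ℕ) - (i:ℕ)) * (starRingEnd ℂ) q.1 := by
      linear_combination hj - hi
    have hn : |CC m (b i) - CC m (b j)| * ‖q.1‖ = |((j:ℕ):ℝ) - (i:ℕ)| * ‖q.1‖ := by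
      have := congrArg norm key
      rw [norm_mul, norm_mul, RCLike.norm_conj] at this
      have e1 : ‖((CC m (b i) : ℂ) - CC m (b j))‖ = |CC m (b i) - CC m (b j)| := by
        rw [← Complex.ofReal_sub, Complex.norm_real, Real.norm_eq_abs]
      have e2 : ‖(((j:ℕ):ℂ) - (i:ℕ))‖ = |((j:ℕ):ℝ) - (i:ℕ)| := by
        rw [← Complex.ofReal_natCast, ← Complex.ofReal_natCast, ← Complex.ofReal_sub, Complex.norm_real, Real.norm_eq_abs]
      rw [e1, e2] at this
      exact this
    have hq : q.1 = 0 := by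
      by_contra hq
      have hn2 := mul_right_cancel₀ (norm_ne_zero_iff.2 hq) hn
      by_cases hb : b i = b j
      · rw [hb, sub_self, abs_zero] at hn2
        have h3 := sub_eq_zero.1 (abs_eq_zero.1 hn2.symm)
        exact hij (Fin.ext (by exact_mod_cast h3.symm))
      · have h3 := CC_sep (m := m) hb
        have h4 := dd_lt i
        have h5 := dd_lt j
        have h6 : |((j:ℕ):ℝ) - (i:ℕ)| ≤ LL m := by
          have : (0:ℝ) ≤ (i:ℕ) := Nat.cast_nonneg _
          have : (0:ℝ) ≤ (j:ℕ) := Nat.cast_nonneg _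
          rw [abs_le]; constructor <;> linarith
        have := LL_ge (m := m)
        linarith
    rw [hq] at hi
    refine Prod.ext hq ?_
    simpa using hi

theorem realize : ∃ H : Fin (m+1) → Submodule ℝ (EuclideanSpace ℝ (Fin 4)), IsTwoArrangement H ∧
    Nonempty (((⋃ i, (H i : Set (EuclideanSpace ℝ (Fin 4))))ᶜ : Set (EuclideanSpace ℝ (Fin 4))) ≃ₜ X b) := by
  let φ : (ℂ × ℂ) ≃L[ℝ] EuclideanSpace ℝ (Fin 4) := ContinuousLinearEquiv.ofFinrankEq (by
    rw [Module.finrank_prod, Complex.finrank_real_complex, finrank_euclideanSpace_fin])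
  have hmem : ∀ i x, x ∈ (PL b i).map (φ.toLinearEquiv : (ℂ × ℂ) →ₗ[ℝ] EuclideanSpace ℝ (Fin 4)) ↔ φ.symm x ∈ PL b i := by
    intro i x
    constructor
    · rintro ⟨y, hy, rfl⟩
      have : φ.symm (φ y) = y := φ.symm_apply_apply y
      change φ.symm (φ y) ∈ _
      rwa [this]
    · intro h
      exact ⟨_, h, φ.apply_symm_apply x⟩
  refine ⟨fun i => (PL b i).map (φ.toLinearEquiv : (ℂ × ℂ) →ₗ[ℝ] EuclideanSpace ℝ (Fin 4)), ⟨fun i => ?_, fun i j hij => ?_⟩, ⟨?_⟩⟩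
  · rw [LinearEquiv.finrank_map_eq, PL_rank]
  · rw [eq_bot_iff]
    intro x hx
    have := PL_disj b i j hij _ ((hmem i x).1 hx.1) ((hmem j x).1 hx.2)
    rw [Submodule.mem_bot]
    simpa using this
  · refine φ.symm.toHomeomorph.subtype fun x => ?_
    have e : φ.symm.toHomeomorph x = φ.symm x := rfl
    rw [e, mem_X, Set.mem_compl_iff, Set.mem_iUnion, not_exists]
    exact forall_congr' fun i => not_congr (hmem i x)

theorem CD_of_hequiv {m r r' : ℕ} (μ ν : Nat.Partition m) (b : Fin m → Fin r) (b' : Fin m → Fin r')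
    (hb : Function.Surjective b) (hb' : Function.Surjective b')
    (hf : ∀ f : ℕ → ℂ, ∏ j, f (Fintype.card {i // b i = j} - 1) = ((dec μ).map f).prod)
    (hf' : ∀ f : ℕ → ℂ, ∏ j, f (Fintype.card {i // b' i = j} - 1) = ((dec ν).map f).prod)
    (e : ContinuousMap.HomotopyEquiv (X b) (X b')) : ∀ Y P, CD (dec μ) Y P = CD (dec ν) Y P := by
  refine CD_ext _ _ fun p hp hp2 s => ?_
  haveI : Fact p.Prime := ⟨hp⟩
  have h2 : (2 : ZMod p) ≠ 0 := by
    intro h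
    have h3 : ((2:ℕ) : ZMod p) = 0 := by exact_mod_cast h
    rw [ZMod.natCast_eq_zero_iff] at h3
    exact hp2 ((Nat.prime_dvd_prime_iff_eq hp Nat.prime_two).1 h3)
  obtain ⟨T, hT⟩ := transport b b' h2 hb hb' e
  have hc : Nat.card (tup b' (K := ZMod p) s) = Nat.card (tup b (K := ZMod p) s) := by
    refine Nat.card_congr ((Equiv.arrowCongr (Equiv.refl (Fin s)) T).subtypeEquiv fun w => ?_)
    exact forall_congr' fun α => forall_congr' fun β => hT _ _
  have h1 := card_tup b h2 hb s
  have h1' := card_tup b' h2 hb' s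
  rw [hc, h1] at h1'
  rw [Nat.card_zmod] at h1'
  rw [hf (fun a => ((p:ℂ) ^ s) ^ a + ((p:ℂ) ^ s - 1) * (p:ℂ) ^ a), hf (fun a => ((p:ℂ) ^ s) ^ a + ((p:ℂ) - 1) * (p:ℂ) ^ a),
    hf' (fun a => ((p:ℂ) ^ s) ^ a + ((p:ℂ) ^ s - 1) * (p:ℂ) ^ a), hf' (fun a => ((p:ℂ) ^ s) ^ a + ((p:ℂ) - 1) * (p:ℂ) ^ a)] at h1'
  exact h1'

theorem final (m : ℕ) : ∃ H : Fin (Fintype.card (Nat.Partition m) - m / 2) → Fin (m+1) → Submodule ℝ (EuclideanSpace ℝ (Fin 4)),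
      (∀ a, IsTwoArrangement (H a)) ∧ ∀ a b, a ≠ b → IsEmpty (ContinuousMap.HomotopyEquiv
          ((⋃ i, (H a i : Set (EuclideanSpace ℝ (Fin 4))))ᶜ : Set (EuclideanSpace ℝ (Fin 4)))
          ((⋃ i, (H b i : Set (EuclideanSpace ℝ (Fin 4))))ᶜ : Set (EuclideanSpace ℝ (Fin 4)))) := by
  classical
  obtain ⟨ι⟩ : Nonempty (Fin (Fintype.card (Nat.Partition m) - m / 2) ↪ {μ : Nat.Partition m // Good (dec μ)}) := by
    refine Function.Embedding.nonempty_of_card_le ?_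
    have h1 := card_good m
    rw [Nat.card_eq_fintype_card] at h1
    rw [Fintype.card_fin]
    exact h1
  choose r b hb hf using fun μ : Nat.Partition m => exists_blocks μ
  choose H hH hX using fun μ : Nat.Partition m => realize (b μ)
  refine ⟨fun a => H (ι a).1, fun a => hH _, fun a a' h => ⟨fun e => h ?_⟩⟩
  obtain ⟨f⟩ := hX (ι a).1
  obtain ⟨f'⟩ := hX (ι a').1
  have e2 : ContinuousMap.HomotopyEquiv (X (b (ι a).1)) (X (b (ι a').1)) :=
    (f.symm.toHomotopyEquiv.trans e).trans f'.toHomotopyEquiv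
  have h1 := CD_of_hequiv _ _ _ _ (hb _) (hb _) (hf _) (hf _) e2
  have h2 := CD_det _ _ (ι a).2 (ι a').2 (by rw [dec_sum, dec_sum]) h1
  exact ι.injective (Subtype.ext (dec_inj h2))
end TA
end Part_14

/-- For every `n ≥ 1` there exist `p(n-1) - ⌊(n-1)/2⌋` two-arrangements of `n` planes
in `ℝ⁴` whose complements are pairwise non-homotopy-equivalent. -/
theorem num_homotopy_types_lower_bound (n : ℕ) (hn : 1 ≤ n) :
    ∃ H : Fin (Fintype.card (Nat.Partition (n - 1)) - (n - 1) / 2) →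
        Fin n → Submodule ℝ (EuclideanSpace ℝ (Fin 4)),
      (∀ a, IsTwoArrangement (H a)) ∧
      ∀ a b, a ≠ b →
        IsEmpty (ContinuousMap.HomotopyEquiv
          ((⋃ i, (H a i : Set (EuclideanSpace ℝ (Fin 4))))ᶜ : Set (EuclideanSpace ℝ (Fin 4)))
          ((⋃ i, (H b i : Set (EuclideanSpace ℝ (Fin 4))))ᶜ : Set (EuclideanSpace ℝ (Fin 4)))) := by
  obtain ⟨m, rfl⟩ : ∃ m, n = m + 1 := ⟨n - 1, by omega⟩
  exact TA.final m
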